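/- arXiv:1607.00054 — 2 statements merged into one kernel-verified Lean document; each statement's English description precedes it below -/
import Mathlib

section
/- Let n ≥ 1, let F_n be the free group on generators a₁,…,aₙ, let c be a circular order on F_n, and let ρ be a dynamical realization of c with basepoint x₀ ∈ S¹. Then c is isolated in CO(F_n) if and only if there exist pairwise disjoint nonempty closed sets D(s) ⊆ S¹, one for each s ∈ {a₁^{±1},…,aₙ^{±1}}, each having finitely many connected components, such that ρ(s)(S¹ ∖ D(s⁻¹)) ⊆ D(s) for every s ∈ {a₁^{±1},…,aₙ^{±1}} and x₀ ∉ ⋃_s D(s). -/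
noncomputable section

open Classical in
/-- The circle `ℝ/ℤ`. -/
abbrev S1 : Type := AddCircle (1 : ℝ)

/-- The canonical representative of a point of the circle in `[0,1)`. -/
noncomputable def S1.rep (x : S1) : ℝ := (AddCircle.equivIco 1 0 x : ℝ)

open Classical in
/-- The orientation cocycle on the circle: `1` on positively oriented (counterclockwise)
triples of pairwise distinct points, `-1` on negatively oriented ones, `0` otherwise. -/
noncomputable def circOrd (x y z : S1) : ℤ :=
  if x = y ∨ y = z ∨ x = z then 0
  else if (S1.rep x < S1.rep y ∧ S1.rep y < S1.rep z) ∨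
      (S1.rep y < S1.rep z ∧ S1.rep z < S1.rep x) ∨
      (S1.rep z < S1.rep x ∧ S1.rep x < S1.rep y) then 1 else -1

/-- The group `Homeo₊(S¹)` of orientation preserving homeomorphisms of the circle, realized
as the subgroup of bijections of `S¹` which are homeomorphisms and preserve the orientation
cocycle. -/
noncomputable def HomeoPos : Subgroup (Equiv.Perm S1) where
  carrier := {f | Continuous f ∧ Continuous f.symm ∧
    ∀ x y z, circOrd (f x) (f y) (f z) = circOrd x y z}
  one_mem' := ⟨by simpa using continuous_id, by exact continuous_id, by simp⟩
  mul_mem' := by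
    rintro a b ⟨ha1, ha2, ha3⟩ ⟨hb1, hb2, hb3⟩
    refine ⟨?_, ?_, ?_⟩
    · have : ⇑(a * b) = ⇑a ∘ ⇑b := by ext x; simp [Equiv.Perm.mul_apply]
      rw [this]; exact ha1.comp hb1
    · have : ⇑(a * b).symm = ⇑b.symm ∘ ⇑a.symm := by
        ext x; rfl
      rw [this]; exact hb2.comp ha2
    · intro x y z
      simp only [Equiv.Perm.mul_apply]
      rw [ha3, hb3]
  inv_mem' := by
    rintro a ⟨ha1, ha2, ha3⟩
    refine ⟨ha2, by exact ha1, ?_⟩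
    intro x y z
    have := ha3 (a⁻¹ x) (a⁻¹ y) (a⁻¹ z)
    simpa using this.symm

/-- The action of an element of `Homeo₊(S¹)` on the circle. -/
def ap (h : ↥HomeoPos) (x : S1) : S1 := h.1 x

lemma ap_one (x : S1) : ap 1 x = x := rfl

lemma ap_mul (h₁ h₂ : ↥HomeoPos) (x : S1) : ap (h₁ * h₂) x = ap h₁ (ap h₂ x) := rfl

variable {G : Type*} [Group G]

/-- A (left-invariant) circular order on a group `G`: a function `G³ → {-1,0,1}` vanishing
exactly on degenerate triples, satisfying the cocycle identity, and left-invariant. -/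
def IsCircularOrder (c : G → G → G → ℤ) : Prop :=
  (∀ a b d, c a b d = 0 ↔ a = b ∨ b = d ∨ a = d) ∧
  (∀ a b d, c a b d = 1 ∨ c a b d = 0 ∨ c a b d = -1) ∧
  (∀ g₁ g₂ g₃ g₄, c g₂ g₃ g₄ - c g₁ g₃ g₄ + c g₁ g₂ g₄ - c g₁ g₂ g₃ = 0) ∧
  (∀ g u v w, c (g * u) (g * v) (g * w) = c u v w)

/-- `c` is an isolated point of the space `CO(G)` of circular orders on `G` (with the
topology induced from the product topology on `{-1,0,1}^{G³}`): some basic neighborhood,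
determined by agreement on a finite subset of `G`, contains only `c`. -/
def IsIsolatedCO (c : G → G → G → ℤ) : Prop :=
  ∃ S : Finset G, ∀ c' : G → G → G → ℤ, IsCircularOrder c' →
    (∀ u ∈ S, ∀ v ∈ S, ∀ w ∈ S, c' u v w = c u v w) → c' = c

/-- The basepoint `x₀` has trivial stabilizer under the action `ρ`. -/
def TrivialStabilizer (ρ : G →* ↥HomeoPos) (x₀ : S1) : Prop :=
  ∀ g : G, ap (ρ g) x₀ = x₀ → g = 1

/-- The circular order on `G` induced by the orbit of a point `x₀` with trivial stabilizer. -/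
def inducedCO (ρ : G →* ↥HomeoPos) (x₀ : S1) (g₁ g₂ g₃ : G) : ℤ :=
  circOrd (ap (ρ g₁) x₀) (ap (ρ g₂) x₀) (ap (ρ g₃) x₀)

/-- A continuous degree-one monotone map of the circle: a continuous surjection which
weakly preserves the orientation cocycle. -/
def DegOneMonotone (f : S1 → S1) : Prop :=
  Continuous f ∧ Function.Surjective f ∧
    ∀ x y z, f x ≠ f y → f y ≠ f z → f x ≠ f z → circOrd (f x) (f y) (f z) = circOrd x y z

/-- `ρ` is a dynamical realization of the circular order `c` with basepoint `x₀`. -/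
def IsDynamicalRealization (ρ : G →* ↥HomeoPos) (x₀ : S1) (c : G → G → G → ℤ) : Prop :=
  TrivialStabilizer ρ x₀ ∧
  (∀ g₁ g₂ g₃, inducedCO ρ x₀ g₁ g₂ g₃ = c g₁ g₂ g₃) ∧
  ∀ ρ' : G →* ↥HomeoPos, TrivialStabilizer ρ' x₀ →
    (∀ g₁ g₂ g₃, inducedCO ρ' x₀ g₁ g₂ g₃ = c g₁ g₂ g₃) →
    ∃ f : S1 → S1, DegOneMonotone f ∧ f x₀ = x₀ ∧
      ∀ g : G, (ap (ρ g)) ∘ f = f ∘ (ap (ρ' g))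

end
noncomputable section

/-- The generators `a₁^{±1}, …, aₙ^{±1}` of the free group `F_n`, indexed by a generator
index and a sign (`true` for the generator, `false` for its inverse). -/
def freeGen {n : ℕ} (s : Fin n × Bool) : FreeGroup (Fin n) :=
  if s.2 then FreeGroup.of s.1 else (FreeGroup.of s.1)⁻¹

noncomputable section
namespace PP
section letters
variable {n : ℕ}

abbrev Fr (n : ℕ) := FreeGroup (Fin n)
def hd (g : Fr n) : Option (Fin n × Bool) := g.toWord.head?
def linv (s : Fin n × Bool) : Fin n × Bool := (s.1, !s.2)

@[simp] lemma linv_linv (s : Fin n × Bool) : linv (linv s) = s := by simp [linv]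
lemma linv_ne (s : Fin n × Bool) : linv s ≠ s := by
  intro h; have := congrArg Prod.snd h; simp [linv] at this

lemma freeGen_eq_mk (s : Fin n × Bool) : freeGen s = FreeGroup.mk [s] := by
  obtain ⟨i, b⟩ := s
  cases b <;> simp [freeGen, FreeGroup.of, FreeGroup.inv_mk, FreeGroup.invRev]

lemma freeGen_linv (s : Fin n × Bool) : freeGen (linv s) = (freeGen s)⁻¹ := by
  obtain ⟨i, b⟩ := s
  cases b <;> simp [freeGen, linv]

lemma freeGen_inv (s : Fin n × Bool) : (freeGen s)⁻¹ = freeGen (linv s) := (freeGen_linv s).symm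

lemma toWord_gen_mul {s : Fin n × Bool} {g : Fr n} (h : hd g ≠ some (linv s)) :
    (freeGen s * g).toWord = s :: g.toWord := by
  rw [freeGen_eq_mk]
  conv_lhs => rw [← FreeGroup.mk_toWord (x := g), FreeGroup.mul_mk, FreeGroup.toWord_mk]
  simp only [List.singleton_append, FreeGroup.reduce.cons, FreeGroup.reduce_toWord]
  unfold hd at h
  rcases hw : g.toWord with _ | ⟨t, w⟩
  · simp
  · rw [hw] at h
    simp only [List.head?_cons, ne_eq, Option.some.injEq] at h
    simp only
    rw [if_neg]
    rintro ⟨h1, h2⟩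
    apply h
    ext
    · simp [linv, h1]
    · simp [linv, h2]

lemma hd_gen_mul {s : Fin n × Bool} {g : Fr n} (h : hd g ≠ some (linv s)) :
    hd (freeGen s * g) = some s := by
  simp [hd, toWord_gen_mul h]

lemma norm_gen_mul {s : Fin n × Bool} {g : Fr n} (h : hd g ≠ some (linv s)) :
    (freeGen s * g).norm = g.norm + 1 := by
  simp [FreeGroup.norm, toWord_gen_mul h]

lemma hd_eq_none {g : Fr n} : hd g = none ↔ g = 1 := by
  simp [hd]

@[simp] lemma hd_one : hd (1 : Fr n) = none := by simp [hd]

lemma hd_tail {s : Fin n × Bool} {u : Fr n} (h : hd u = some s) :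
    ∃ g, u = freeGen s * g ∧ hd g ≠ some (linv s) := by
  rcases hw : u.toWord with _ | ⟨t, w⟩
  · simp [hd, hw] at h
  · have ht : t = s := by simpa [hd, hw] using h
    subst ht
    have hred := FreeGroup.isReduced_toWord (x := u)
    rw [hw] at hred
    have hred2 : FreeGroup.IsReduced w := by
      exact hred.infix (List.suffix_cons t w).isInfix
    refine ⟨FreeGroup.mk w, ?_, ?_⟩
    · rw [freeGen_eq_mk, FreeGroup.mul_mk, ← FreeGroup.mk_toWord (x := u), hw]; rfl
    · unfold hd
      rw [FreeGroup.toWord_mk, hred2.reduce_eq]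
      rcases w with _ | ⟨a, w⟩
      · simp
      · simp only [List.head?_cons, ne_eq, Option.some.injEq]
        rintro rfl
        rw [FreeGroup.isReduced_cons_cons] at hred
        have := hred.1 rfl
        simp [linv] at this

lemma hd_cases (g : Fr n) : g = 1 ∨ ∃ s h, g = freeGen s * h ∧ hd h ≠ some (linv s) := by
  rcases hh : hd g with _ | s
  · left; exact hd_eq_none.1 hh
  · right; obtain ⟨h, h1, h2⟩ := hd_tail hh
    exact ⟨s, h, h1, h2⟩

/-- cancel case -/
lemma gen_mul_cancel {s : Fin n × Bool} {g : Fr n} (h : hd g = some (linv s)) :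
    hd (freeGen s * g) ≠ some s ∧ g.norm = (freeGen s * g).norm + 1 := by
  obtain ⟨g', rfl, h2⟩ := hd_tail h
  rw [linv_linv] at h2
  have : freeGen s * (freeGen (linv s) * g') = g' := by rw [freeGen_linv]; group
  rw [this]
  refine ⟨h2, norm_gen_mul (by rwa [linv_linv])⟩

lemma norm_gen_mul_le (s : Fin n × Bool) (g : Fr n) : (freeGen s * g).norm ≤ g.norm + 1 := by
  by_cases h : hd g = some (linv s)
  · have := (gen_mul_cancel h).2; omega
  · rw [norm_gen_mul h]

lemma norm_freeGen (s : Fin n × Bool) : (freeGen s).norm = 1 := by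
  have := norm_gen_mul (s := s) (g := 1) (by simp)
  simpa using this

lemma hd_freeGen (s : Fin n × Bool) : hd (freeGen s) = some s := by
  have := hd_gen_mul (s := s) (g := 1) (by simp)
  simpa using this

lemma freeGen_ne_one (s : Fin n × Bool) : freeGen s ≠ 1 := by
  intro h; have := hd_freeGen s; rw [h] at this; simp at this

@[elab_as_elim]
lemma fr_induction {P : Fr n → Prop} (g : Fr n) (h1 : P 1)
    (hs : ∀ s g, hd g ≠ some (linv s) → P g → P (freeGen s * g)) : P g := by
  induction hN : g.norm generalizing g with
  | zero => rw [FreeGroup.norm_eq_zero] at hN; rwa [hN]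
  | succ N ih =>
    rcases hd_cases g with rfl | ⟨s, h, rfl, hh⟩
    · exact h1
    · rw [norm_gen_mul hh] at hN
      exact hs s h hh (ih h (by omega))

lemma hd_inv_gen_mul {s : Fin n × Bool} {u : Fr n} (h : hd u = some s) :
    hd ((freeGen s)⁻¹ * u) ≠ some (linv s) ∧ u.norm = ((freeGen s)⁻¹ * u).norm + 1 := by
  rw [freeGen_inv]
  exact gen_mul_cancel (s := linv s) (by simpa using h)

lemma ball_finite (n L : ℕ) : {g : Fr n | g.norm ≤ L}.Finite := by
  have h := List.finite_length_le (Fin n × Bool) L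
  refine Set.Finite.of_finite_image (f := FreeGroup.toWord) (h.subset ?_)
    FreeGroup.toWord_injective.injOn
  rintro _ ⟨g, hg, rfl⟩
  exact hg

lemma fr_norm_inv_mul {a b : Fr n} (h : hd a ≠ hd b) : (a⁻¹ * b).norm = a.norm + b.norm := by
  induction a using fr_induction generalizing b with
  | h1 => simp
  | hs s g hg ih =>
    rw [hd_gen_mul hg] at h
    rw [mul_inv_rev, mul_assoc, norm_gen_mul hg, freeGen_inv]
    have hb : hd b ≠ some (linv (linv s)) := by rw [linv_linv]; exact fun h' => h h'.symm
    rw [ih, norm_gen_mul hb]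
    · omega
    · rw [hd_gen_mul hb]; exact hg

end letters
end PP
end

noncomputable section
set_option linter.unusedSimpArgs false
set_option linter.unusedVariables false
namespace PP
section co
variable {G : Type*} [Group G] {c : G → G → G → ℤ}

lemma co_eq (hc : IsCircularOrder c) (u v w : G) : c u v w = c 1 v w - c 1 u w + c 1 u v := by
  have := hc.2.2.1 1 u v w; omega
lemma co_00 (hc : IsCircularOrder c) (a b : G) : c a b b = 0 := (hc.1 _ _ _).2 (by simp)
lemma co_01 (hc : IsCircularOrder c) (a b : G) : c a a b = 0 := (hc.1 _ _ _).2 (by simp)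
lemma co_02 (hc : IsCircularOrder c) (a b : G) : c a b a = 0 := (hc.1 _ _ _).2 (by simp)
lemma co_swap (hc : IsCircularOrder c) (a b d : G) : c a d b = - c a b d := by
  have := hc.2.2.1 a b d b
  have := co_00 hc a b
  have := co_02 hc b d
  omega
lemma co_rot (hc : IsCircularOrder c) (a b d : G) : c b d a = c a b d := by
  have h1 := hc.2.2.1 a b d a
  have := co_02 hc a d
  have := co_02 hc a b
  omega
lemma co_trans (hc : IsCircularOrder c) {x a b d : G} (h1 : c x a b = 1) (h2 : c x b d = 1) :
    c x a d = 1 := by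
  have := hc.2.2.1 x a b d
  have h3 := hc.2.1 a b d
  have h4 := hc.2.1 x a d
  omega
lemma co_inv (hc : IsCircularOrder c) (g u v w : G) : c (g * u) (g * v) (g * w) = c u v w :=
  hc.2.2.2 g u v w
/-- apply g⁻¹ to base -/
lemma co_base (hc : IsCircularOrder c) (g u v : G) : c g u v = c 1 (g⁻¹ * u) (g⁻¹ * v) := by
  have := hc.2.2.2 g⁻¹ g u v
  simpa using this.symm
lemma co_ne (hc : IsCircularOrder c) {a b d : G} (h1 : a ≠ b) (h2 : b ≠ d) (h3 : a ≠ d) :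
    c a b d = 1 ∨ c a b d = -1 := by
  have h := hc.2.1 a b d
  have : c a b d ≠ 0 := by
    intro h; rw [hc.1] at h; tauto
  tauto
lemma co_of_ne (hc : IsCircularOrder c) {a b d : G} (h : c a b d ≠ 0) : a ≠ b ∧ b ≠ d ∧ a ≠ d := by
  rw [Ne, hc.1] at h; tauto

open Classical in
/-- linear order sign with 1 as minimum -/
def sgc (c : G → G → G → ℤ) (a b : G) : ℤ :=
  if a = b then 0 else if a = 1 then 1 else if b = 1 then -1 else c 1 a b

lemma co_eq_sgc (hc : IsCircularOrder c) (a b d : G) :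
    c a b d = sgc c a b + sgc c b d + sgc c d a := by
  have h00 := co_00 hc
  have h01 := co_01 hc
  have h02 := co_02 hc
  have hs := co_swap hc
  unfold sgc
  by_cases h1 : a = b
  · subst h1
    by_cases h2 : a = d
    · subst h2; simp [h00]
    · by_cases h3 : a = 1
      · subst h3; simp [h01, h2, Ne.symm h2]
      · by_cases h4 : d = 1
        · subst h4; simp [h01, h3, Ne.symm h3]
        · simp [h01, h2, Ne.symm h2, h3, h4, hs 1 a d]
  · by_cases h2 : b = d
    · subst h2
      by_cases h3 : b = 1
      · subst h3; simp [h00, h1, Ne.symm h1]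
      · by_cases h4 : a = 1
        · subst h4; simp [h00, h3, Ne.symm h3]
        · simp [h00, h1, Ne.symm h1, h3, h4, hs 1 a b]
    · by_cases h3 : a = d
      · subst h3
        by_cases h3 : b = 1
        · subst h3; simp [h02, h1, Ne.symm h1]
        · by_cases h4 : a = 1
          · subst h4; simp [h02, h3, Ne.symm h3]
          · simp [h02, h1, Ne.symm h1, h3, h4, hs 1 a b]
      · have h6 := hs 1 a d
        have h5 := co_eq hc a b d
        have r1 := co_rot hc a b d
        have r2 := co_rot hc b d a
        by_cases e1 : a = 1
        · subst e1; simp [h1, h2, h3, Ne.symm h1, Ne.symm h2, Ne.symm h3]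
        by_cases e2 : b = 1
        · subst e2; simp [h1, h2, h3, Ne.symm h1, Ne.symm h2, Ne.symm h3]; omega
        by_cases e3 : d = 1
        · subst e3; simp [h1, h2, h3, Ne.symm h1, Ne.symm h2, Ne.symm h3]; omega
        simp [h1, h2, h3, Ne.symm h1, Ne.symm h2, Ne.symm h3, e1, e2, e3]
        omega

end co

section star
variable {n : ℕ} {c : Fr n → Fr n → Fr n → ℤ}

/-- the finiteness property (*) -/
def Star (c : Fr n → Fr n → Fr n → ℤ) : Prop :=
  ∃ E : Finset (Fr n), ∀ u v, u ≠ 1 → v ≠ 1 → hd u ≠ hd v → c 1 u v = 1 →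
    ∃ e ∈ E, e ≠ 1 ∧ (u = e ∨ c 1 u e = 1) ∧ (e = v ∨ c 1 e v = 1)

lemma finset_ball (E : Finset (Fr n)) : ∃ L, 1 ≤ L ∧ ∀ e ∈ E, e.norm ≤ L := by
  refine ⟨E.sup (fun e => e.norm) + 1, by omega, fun e he => ?_⟩
  have := Finset.le_sup (f := fun e : Fr n => e.norm) he
  omega

lemma star_isolated (hc : IsCircularOrder c) (h : Star c) : IsIsolatedCO c := by
  obtain ⟨E, hE⟩ := h
  obtain ⟨L, hL1, hL⟩ := finset_ball E
  refine ⟨(ball_finite n (L+1)).toFinset, fun c' hc' hag => ?_⟩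
  have key : ∀ N, L + 1 ≤ N → ∀ u v w : Fr n, u.norm ≤ N → v.norm ≤ N → w.norm ≤ N →
      c' u v w = c u v w := by
    intro N hN
    induction N, hN using Nat.le_induction with
    | base => 
      intro u v w hu hv hw
      exact hag u (by simpa using hu) v (by simpa using hv) w (by simpa using hw)
    | succ N hN ih =>
      -- generic shift
      have shift : ∀ (s : Fin n × Bool) (u v : Fr n), ((freeGen s)⁻¹ * u).norm ≤ N →
          ((freeGen s)⁻¹ * v).norm ≤ N → c' 1 u v = c 1 u v := by
        intro s u v hu hv
        rw [← co_inv hc (freeGen s)⁻¹, ← co_inv hc' (freeGen s)⁻¹]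
        apply ih _ _ _ _ hu hv
        simp [FreeGroup.norm_inv_eq, norm_freeGen]; omega
      have small : ∀ (s : Fin n × Bool) (u : Fr n), hd u = some s → u.norm ≤ N + 1 →
          ((freeGen s)⁻¹ * u).norm ≤ N := by
        intro s u hu hn
        have := (hd_inv_gen_mul hu).2; omega
      have ball : ∀ (s : Fin n × Bool) (u : Fr n), u.norm + 1 ≤ N →
          ((freeGen s)⁻¹ * u).norm ≤ N := by
        intro s u hu
        rw [freeGen_inv]
        have := norm_gen_mul_le (linv s) u; omega
      have one : ∀ u v : Fr n, u.norm ≤ N + 1 → v.norm ≤ N + 1 → c 1 u v = 1 → c' 1 u v = 1 := by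
        intro u v hu hv huv
        obtain ⟨h1, h2, h3⟩ := co_of_ne hc (by rw [huv]; norm_num)
        obtain ⟨s, hs⟩ : ∃ s, hd u = some s := by
          rcases h : hd u with _ | s
          · exact absurd (hd_eq_none.1 h).symm h1
          · exact ⟨s, rfl⟩
        obtain ⟨t, ht⟩ : ∃ s, hd v = some s := by
          rcases h : hd v with _ | s
          · exact absurd (hd_eq_none.1 h).symm h3
          · exact ⟨s, rfl⟩
        by_cases hst : s = t
        · subst hst
          rw [shift s u v (small s u hs hu) (small s v ht hv), huv]
        · obtain ⟨e, heE, he1, hue, hev⟩ := hE u v h1.symm h3.symm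
            (by rw [hs, ht]; simpa using hst) huv
          have hel := hL e heE
          have A : u = e ∨ c' 1 u e = 1 := by
            refine hue.imp id fun h => ?_
            rw [shift s u e (small s u hs hu) (ball s e (by omega)), h]
          have B : e = v ∨ c' 1 e v = 1 := by
            refine hev.imp id fun h => ?_
            rw [shift t e v (ball t e (by omega)) (small t v ht hv), h]
          rcases A with rfl | A
          · rcases B with rfl | B
            · exact absurd rfl h2
            · exact B
          · rcases B with rfl | B
            · exact A
            · exact co_trans hc' A B
      have gen : ∀ u v : Fr n, u.norm ≤ N + 1 → v.norm ≤ N + 1 → c' 1 u v = c 1 u v := by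
        intro u v hu hv
        rcases hc.2.1 1 u v with h | h | h
        · rw [h, one u v hu hv h]
        · rw [h]; rw [hc.1] at h; rwa [hc'.1]
        · have := one v u hv hu (by rw [co_swap hc, h]; rfl)
          rw [co_swap hc' 1 v u, this, h]
      intro u v w hu hv hw
      rw [co_eq hc, co_eq hc', gen _ _ hu hv, gen _ _ hv hw, gen _ _ hu hw]
  funext u v w
  exact key (L + 1 + u.norm + v.norm + w.norm) (by omega) u v w (by omega) (by omega) (by omega)
end star
end PP
end

noncomputable section
set_option linter.unusedSimpArgs false
set_option linter.unusedVariables false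
namespace PP
section po
variable {n : ℕ}

def dl (σ : Fr n → Fr n → ℤ) (a b d : Fr n) : ℤ := σ a b + σ b d + σ d a

structure PO (X : Set (Fr n)) (σ : Fr n → Fr n → ℤ) : Prop where
  ball1 : ∀ g : Fr n, g.norm ≤ 1 → g ∈ X
  suff : ∀ s g, freeGen s * g ∈ X → hd g ≠ some (linv s) → g ∈ X
  anti : ∀ a ∈ X, ∀ b ∈ X, σ b a = - σ a b
  pm : ∀ a ∈ X, ∀ b ∈ X, a ≠ b → σ a b = 1 ∨ σ a b = -1
  trans : ∀ a ∈ X, ∀ b ∈ X, ∀ d ∈ X, σ a b = 1 → σ b d = 1 → σ a d = 1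
  one : ∀ a ∈ X, a ≠ 1 → σ 1 a = 1
  inv : ∀ s, ∀ a ∈ X, ∀ b ∈ X, ∀ d ∈ X, freeGen s * a ∈ X → freeGen s * b ∈ X →
    freeGen s * d ∈ X → dl σ (freeGen s * a) (freeGen s * b) (freeGen s * d) = dl σ a b d

variable {X : Set (Fr n)} {σ : Fr n → Fr n → ℤ}

lemma PO.self (h : PO X σ) {a} (ha : a ∈ X) : σ a a = 0 := by
  have := h.anti a ha a ha; omega

lemma PO.one_mem (h : PO X σ) : (1 : Fr n) ∈ X := h.ball1 1 (by simp)
lemma PO.gen_mem (h : PO X σ) (s : Fin n × Bool) : freeGen s ∈ X :=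
  h.ball1 _ (by rw [norm_freeGen])

lemma PO.val (h : PO X σ) {a b d} (ha : a ∈ X) (hb : b ∈ X) (hd : d ∈ X) (h1 : a ≠ b)
    (h2 : b ≠ d) (h3 : a ≠ d) : dl σ a b d = 1 ∨ dl σ a b d = -1 := by
  unfold dl
  have p1 := h.pm a ha b hb h1
  have p2 := h.pm b hb d hd h2
  have p3 := h.pm d hd a ha h3.symm
  have a1 := h.anti a ha b hb
  have a2 := h.anti b hb d hd
  have a3 := h.anti d hd a ha
  have t1 := h.trans a ha b hb d hd
  have t2 := h.trans d hd b hb a ha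
  omega

lemma PO.val' (h : PO X σ) {a b d} (ha : a ∈ X) (hb : b ∈ X) (hd : d ∈ X) :
    dl σ a b d = 1 ∨ dl σ a b d = 0 ∨ dl σ a b d = -1 := by
  by_cases h1 : a = b
  · subst h1
    have := h.self ha
    have := h.anti a ha d hd
    unfold dl; omega
  by_cases h2 : b = d
  · subst h2
    have := h.self hb
    have := h.anti a ha b hb
    unfold dl; omega
  by_cases h3 : a = d
  · subst h3
    have := h.self ha
    have := h.anti a ha b hb
    unfold dl; omega
  have := h.val ha hb hd h1 h2 h3
  tauto

lemma PO.dtrans (h : PO X σ) {x a b d} (hx : x ∈ X) (ha : a ∈ X) (hb : b ∈ X) (hd : d ∈ X)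
    (h1 : dl σ x a b = 1) (h2 : dl σ x b d = 1) : dl σ x a d = 1 := by
  have v1 := h.val' ha hb hd
  have v2 := h.val' hx ha hd
  have a1 := h.anti x hx b hb
  have a3 := h.anti d hd a ha
  have a4 := h.anti a ha b hb
  have a5 := h.anti x hx d hd
  have a6 := h.anti x hx a ha
  unfold dl at *
  omega

open Classical in
def insσ (σ : Fr n → Fr n → ℤ) (u : Fr n) (P : Fr n → Prop) (a b : Fr n) : ℤ :=
  if a = u then (if b = u then 0 else if P b then -1 else 1)
  else if b = u then (if P a then 1 else -1) else σ a b

lemma PO.ins (h : PO X σ) {s : Fin n × Bool} {g u : Fr n} (hg : g ∈ X) (hu : u = freeGen s * g)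
    (huX : u ∉ X) (P : Fr n → Prop) (P1 : P 1)
    (Pd : ∀ x ∈ X, ∀ y ∈ X, P y → σ x y = 1 → P x)
    (Pc : ∀ y ∈ X, y ≠ 1 → (freeGen s)⁻¹ * y ∈ X →
      (P y ↔ dl σ (freeGen s)⁻¹ ((freeGen s)⁻¹ * y) g = 1)) :
    PO (insert u X) (insσ σ u P) := by
  classical
  have hneX : ∀ x ∈ X, x ≠ u := fun x hx he => huX (he ▸ hx)
  have hghd : hd g ≠ some (linv s) := by
    intro hh
    obtain ⟨g', e1, e2⟩ := hd_tail hh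
    have : u = g' := by rw [hu, e1, freeGen_linv]; group
    rw [← this] at e1 e2
    exact huX (h.suff _ _ (e1 ▸ hg) e2)
  have hhdu : hd u = some s := by rw [hu]; exact hd_gen_mul hghd
  have hu1 : u ≠ 1 := fun he => huX (he ▸ h.one_mem)
  have e1 : ∀ a ∈ X, ∀ b ∈ X, insσ σ u P a b = σ a b := by
    intro a ha b hb
    simp [insσ, hneX a ha, hneX b hb]
  have e2 : ∀ a ∈ X, insσ σ u P a u = if P a then 1 else -1 := by
    intro a ha; simp [insσ, hneX a ha]
  have e3 : ∀ a ∈ X, insσ σ u P u a = if P a then -1 else 1 := by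
    intro a ha; simp [insσ, hneX a ha]
  have e4 : insσ σ u P u u = 0 := by simp [insσ]
  have anti' : ∀ a ∈ insert u X, ∀ b ∈ insert u X, insσ σ u P b a = - insσ σ u P a b := by
    rintro a (rfl | ha) b (rfl | hb)
    · rw [e4]; rfl
    · rw [e2 b hb, e3 b hb]; split_ifs <;> rfl
    · rw [e2 a ha, e3 a ha]; split_ifs <;> rfl
    · rw [e1 a ha b hb, e1 b hb a ha]; exact h.anti a ha b hb
  have self' : ∀ a ∈ insert u X, insσ σ u P a a = 0 := by
    intro a ha; have := anti' a ha a ha; omega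
  have sinv : (freeGen s)⁻¹ ∈ X := by rw [freeGen_inv]; exact h.gen_mem _
  -- main H
  have H : ∀ b ∈ X, ∀ d ∈ X, freeGen s * b ∈ X → freeGen s * d ∈ X →
      dl (insσ σ u P) u (freeGen s * b) (freeGen s * d) = dl σ g b d := by
    intro b hb d hd hsb hsd
    have key : ∀ b ∈ X, freeGen s * b ∈ X → freeGen s * b ≠ 1 →
        insσ σ u P u (freeGen s * b) = - dl σ (freeGen s)⁻¹ b g := by
      intro b hb hsb hne
      rw [e3 _ hsb]
      have := Pc _ hsb hne (by simpa using hb)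
      simp only [inv_mul_cancel_left] at this
      have hv := h.val sinv hb hg
        (by intro he; apply hne; rw [← he]; simp)
        (by rintro rfl; exact huX (hu ▸ hsb))
        (by intro he; apply hu1; rw [hu, ← he]; simp)
      by_cases hP : P (freeGen s * b)
      · rw [if_pos hP, this.1 hP]
      · rw [if_neg hP]
        have := mt this.2 hP
        omega
    have hinv := h.inv s _ sinv b hb d hd (by simpa using h.one_mem) hsb hsd
    rw [mul_inv_cancel] at hinv
    have a1 := h.anti b hb d hd
    have a2 := h.anti b hb g hg
    have a3 := h.anti d hd g hg
    have a4 := h.anti _ sinv b hb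
    have a5 := h.anti _ sinv d hd
    have a6 := anti' _ (Or.inr hsb) _ (Or.inr hsd)
    have a7 := anti' _ (Or.inr hsd) _ (Or.inl rfl)
    have a8 := h.anti _ hsb _ hsd
    have a9 := h.anti _ h.one_mem _ hsb
    have a10 := h.anti _ h.one_mem _ hsd
    have a11 := e1 _ hsb _ hsd
    have b0 : insσ σ u P u 1 = -1 := by rw [e3 _ h.one_mem, if_pos P1]
    by_cases hb1 : freeGen s * b = 1
    · have hbs : b = (freeGen s)⁻¹ := eq_inv_of_mul_eq_one_right hb1
      by_cases hd1 : freeGen s * d = 1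
      · have hds : d = (freeGen s)⁻¹ := eq_inv_of_mul_eq_one_right hd1
        have := h.self h.one_mem
        have := h.self sinv
        rw [hb1] at a6 a8 a9 a11 hinv ⊢
        rw [hd1] at a6 a7 a8 a10 a11 hinv ⊢
        subst hbs hds
        unfold dl at *
        omega
      · have k2 := key d hd hsd hd1
        have o2 := h.one _ hsd hd1
        rw [← hbs] at k2
        rw [hb1] at a6 a8 a9 a11 hinv ⊢
        unfold dl at *
        omega
    · have k1 := key b hb hsb hb1
      have o1 := h.one _ hsb hb1
      by_cases hd1 : freeGen s * d = 1
      · have hds : d = (freeGen s)⁻¹ := eq_inv_of_mul_eq_one_right hd1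
        rw [← hds] at k1
        rw [hd1] at a6 a7 a8 a10 a11 hinv ⊢
        unfold dl at *
        omega
      · have k2 := key d hd hsd hd1
        have o2 := h.one _ hsd hd1
        unfold dl at *
        omega
  have mv : ∀ t, ∀ x ∈ insert u X, freeGen t * x ∈ insert u X →
      (x = u → t = linv s) ∧ (freeGen t * x = u → t = s) := by
    intro t x hx htx
    have ne : freeGen t * x ≠ x := by
      intro he; exact freeGen_ne_one t (by simpa using he)
    constructor
    · rintro rfl
      rcases htx with he | htx
      · exact absurd he ne
      · by_contra hcon
        exact huX (h.suff t _ htx (by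
          rw [hhdu]; intro he; apply hcon
          have : s = linv t := by simpa using he
          rw [this]; simp))
    · intro he
      rcases hx with rfl | hx
      · exact absurd he ne
      · by_contra hcon
        have hx2 : x = freeGen (linv t) * u := by rw [← he, freeGen_linv]; simp
        apply huX
        apply h.suff (linv t) u (hx2 ▸ hx)
        rw [hhdu]; simpa using fun h => hcon h.symm
  have hinvs : ∀ a ∈ insert u X, ∀ b ∈ insert u X, ∀ d ∈ insert u X,
      freeGen s * a ∈ insert u X → freeGen s * b ∈ insert u X → freeGen s * d ∈ insert u X →
      dl (insσ σ u P) (freeGen s * a) (freeGen s * b) (freeGen s * d) = dl (insσ σ u P) a b d := by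
    have cl : ∀ a ∈ insert u X, freeGen s * a ∈ insert u X → a ∈ X ∧ (a = g ∨ freeGen s * a ∈ X) := by
      intro a ha hsa
      have hau : a ≠ u := fun he => linv_ne s ((mv s a ha hsa).1 he).symm
      refine ⟨ha.resolve_left hau, ?_⟩
      rcases hsa with he | hsa
      · left; rw [hu] at he; simpa using he
      · exact Or.inr hsa
    have R : ∀ b ∈ insert u X, ∀ d ∈ insert u X, freeGen s * b ∈ insert u X →
      freeGen s * d ∈ insert u X →
      dl (insσ σ u P) u (freeGen s * b) (freeGen s * d) = dl (insσ σ u P) g b d := by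
      intro b hb d hd hsb hsd
      obtain ⟨hb', hb2⟩ := cl b hb hsb
      obtain ⟨hd', hd2⟩ := cl d hd hsd
      have a1 := anti' _ hb _ hd
      have a2 := anti' _ hsb _ hsd
      rcases hb2 with rfl | hb2
      · rw [← hu]
        have := self' _ hb
        have := self' u (Or.inl rfl)
        have := anti' u (Or.inl rfl) _ hsd
        unfold dl; omega
      rcases hd2 with rfl | hd2
      · rw [← hu]
        have := self' _ hd
        have := self' u (Or.inl rfl)
        have := anti' u (Or.inl rfl) _ hsb
        unfold dl; omega
      rw [H b hb' d hd' hb2 hd2]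
      unfold dl
      rw [e1 _ hg _ hb', e1 _ hb' _ hd', e1 _ hd' _ hg]
    intro a ha b hb d hd hsa hsb hsd
    obtain ⟨ha', ha2⟩ := cl a ha hsa
    obtain ⟨hb', hb2⟩ := cl b hb hsb
    obtain ⟨hd', hd2⟩ := cl d hd hsd
    rcases ha2 with rfl | ha2
    · rw [← hu]; exact R b hb d hd hsb hsd
    rcases hb2 with rfl | hb2
    · have := R d hd a ha hsd hsa
      rw [← hu]; unfold dl at *; omega
    rcases hd2 with rfl | hd2
    · have := R a ha b hb hsa hsb
      rw [← hu]; unfold dl at *; omega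
    have := h.inv s a ha' b hb' d hd' ha2 hb2 hd2
    unfold dl at *
    simp only [e1, ha2, hb2, hd2, ha', hb', hd']
    exact this
  refine ⟨fun g hg => Or.inr (h.ball1 g hg), ?_, anti', ?_, ?_, ?_, ?_⟩
  · rintro t k (he | hk) hh
    · have h1 := hd_gen_mul hh
      rw [he, hhdu] at h1
      have : s = t := by simpa using h1
      subst this
      rw [hu] at he
      have : k = g := by simpa using he
      rw [this]; exact Or.inr hg
    · exact Or.inr (h.suff t k hk hh)
  · rintro a (rfl | ha) b (rfl | hb) hab
    · exact absurd rfl hab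
    · rw [e3 b hb]; split_ifs <;> simp
    · rw [e2 a ha]; split_ifs <;> simp
    · rw [e1 a ha b hb]; exact h.pm a ha b hb hab
  · rintro a (rfl | ha) b (rfl | hb) d (rfl | hd)
    · rw [e4]; simp
    · rw [e4]; simp
    · rw [e2 _ hb, e3 _ hb]; split_ifs <;> simp
    · rw [e1 _ hb _ hd, e3 _ hb, e3 _ hd]
      intro h1 h2
      have hb3 : ¬ P b := by intro hp; simp [hp] at h1
      rw [if_neg]
      intro hp; exact hb3 (Pd b hb d hd hp h2)
    · rw [e4]; simp
    · rw [e1 _ ha _ hd, e3 _ hd, e2 _ ha]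
      intro h1 h2
      have ha3 : P a := by by_contra hp; simp [hp] at h1
      have hd3 : ¬ P d := by intro hp; simp [hp] at h2
      rcases h.pm a ha d hd (by rintro rfl; exact hd3 ha3) with h4 | h4
      · exact h4
      · exact absurd (Pd d hd a ha ha3 (by rw [h.anti a ha d hd, h4]; rfl)) hd3
    · rw [e1 _ ha _ hb, e2 _ ha, e2 _ hb]
      intro h1 h2
      have hb3 : P b := by by_contra hp; simp [hp] at h2
      rw [if_pos (Pd a ha b hb hb3 h1)]
    · rw [e1 _ ha _ hb, e1 _ hb _ hd, e1 _ ha _ hd]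
      exact h.trans a ha b hb d hd
  · rintro a (rfl | ha) ha1
    · rw [e2 _ h.one_mem, if_pos P1]
    · rw [e1 _ h.one_mem _ ha]; exact h.one a ha ha1
  · intro t a ha b hb d hd hta htb htd
    by_cases hts : t = s
    · subst hts; exact hinvs a ha b hb d hd hta htb htd
    by_cases hts' : t = linv s
    · have cc : ∀ x, freeGen s * (freeGen t * x) = x := by
        intro x; rw [hts', freeGen_linv]; simp
      have := hinvs _ hta _ htb _ htd (by rwa [cc]) (by rwa [cc]) (by rwa [cc])
      rw [cc, cc, cc] at this
      exact this.symm
    have cl : ∀ x ∈ insert u X, freeGen t * x ∈ insert u X → x ∈ X ∧ freeGen t * x ∈ X := by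
      intro x hx htx
      obtain ⟨m1, m2⟩ := mv t x hx htx
      exact ⟨hx.resolve_left fun h => hts' (m1 h), htx.resolve_left fun h => hts (m2 h)⟩
    obtain ⟨ha', ha2⟩ := cl a ha hta
    obtain ⟨hb', hb2⟩ := cl b hb htb
    obtain ⟨hd', hd2⟩ := cl d hd htd
    have := h.inv t a ha' b hb' d hd' ha2 hb2 hd2
    unfold dl at *
    simp only [e1, ha2, hb2, hd2, ha', hb', hd']
    exact this

end po
end PP
end

noncomputable section
set_option linter.unusedSimpArgs false
set_option linter.unusedVariables false
namespace PP
section po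
variable {n : ℕ}

lemma PO.ext_one {X : Set (Fr n)} {σ : Fr n → Fr n → ℤ} (h : PO X σ) (hX : X ≠ Set.univ) :
    ∃ u σ', u ∉ X ∧ PO (insert u X) σ' ∧ ∀ a ∈ X, ∀ b ∈ X, σ' a b = σ a b := by
  classical
  have hex : ∃ N, ∃ u : Fr n, u ∉ X ∧ u.norm = N := by
    obtain ⟨u, hu⟩ := (Set.ne_univ_iff_exists_notMem X).1 hX
    exact ⟨_, u, hu, rfl⟩
  obtain ⟨u, huX, hun⟩ := Nat.find_spec hex
  have hmin : ∀ g : Fr n, g.norm < u.norm → g ∈ X := by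
    intro g hg
    by_contra hgX
    rw [hun] at hg
    exact Nat.find_min hex hg ⟨g, hgX, rfl⟩
  rcases hd_cases u with rfl | ⟨s, g, hu, hh⟩
  · exact absurd h.one_mem huX
  have hg : g ∈ X := hmin g (by rw [hu, norm_gen_mul hh]; omega)
  let P : Fr n → Prop := fun x => x = 1 ∨ ∃ y ∈ X, y ≠ 1 ∧ (freeGen s)⁻¹ * y ∈ X ∧
    dl σ (freeGen s)⁻¹ ((freeGen s)⁻¹ * y) g = 1 ∧ (x = y ∨ σ x y = 1)
  have sinv : (freeGen s)⁻¹ ∈ X := by rw [freeGen_inv]; exact h.gen_mem _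
  refine ⟨u, insσ σ u P, huX, h.ins hg hu huX P (Or.inl rfl) ?_ ?_, ?_⟩
  · intro x hx y hy hPy hxy
    rcases hPy with rfl | ⟨z, hz, hz1, hz2, hz3, hz4⟩
    · by_cases hx1 : x = 1
      · exact Or.inl hx1
      · have := h.one x hx hx1
        have := h.anti x hx 1 h.one_mem
        omega
    · refine Or.inr ⟨z, hz, hz1, hz2, hz3, Or.inr ?_⟩
      rcases hz4 with rfl | hz4
      · exact hxy
      · exact h.trans x hx y hy z hz hxy hz4
  · intro y hy hy1 hy2
    constructor
    · rintro (rfl | ⟨z, hz, hz1, hz2, hz3, hz4⟩)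
      · exact absurd rfl hy1
      · rcases hz4 with rfl | hz4
        · exact hz3
        · refine h.dtrans sinv hy2 hz2 hg ?_ hz3
          have := h.inv s _ sinv _ hy2 _ hz2 (by simpa using h.one_mem) (by simpa using hy)
            (by simpa using hz)
          rw [← this]
          simp only [mul_inv_cancel, mul_inv_cancel_left]
          have := h.one y hy hy1
          have := h.one z hz hz1
          have := h.anti 1 h.one_mem z hz
          unfold dl; omega
    · intro hy3
      exact Or.inr ⟨y, hy, hy1, hy2, hy3, Or.inl rfl⟩
  · intro a ha b hb
    have h1 : a ≠ u := fun he => huX (he ▸ ha)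
    have h2 : b ≠ u := fun he => huX (he ▸ hb)
    simp [insσ, h1, h2]

lemma PO.extend {X : Set (Fr n)} {σ : Fr n → Fr n → ℤ} (h : PO X σ) :
    ∃ σ', PO Set.univ σ' ∧ ∀ a ∈ X, ∀ b ∈ X, σ' a b = σ a b := by
  classical
  let T := {p : Set (Fr n) × (Fr n → Fr n → ℤ) // PO p.1 p.2 ∧ X ⊆ p.1 ∧
    ∀ a ∈ X, ∀ b ∈ X, p.2 a b = σ a b}
  let r : T → T → Prop := fun p q => p.1.1 ⊆ q.1.1 ∧ ∀ a ∈ p.1.1, ∀ b ∈ p.1.1, q.1.2 a b = p.1.2 a b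
  have rtrans : ∀ {a b c}, r a b → r b c → r a c := by
    intro p q t h1 h2
    refine ⟨h1.1.trans h2.1, fun a ha b hb => ?_⟩
    rw [h2.2 a (h1.1 ha) b (h1.1 hb), h1.2 a ha b hb]
  have rrefl : ∀ a, r a a := fun a => ⟨subset_rfl, fun _ _ _ _ => rfl⟩
  have chain : ∀ C : Set T, IsChain r C → ∃ ub, ∀ a ∈ C, r a ub := by
    intro C hC
    rcases C.eq_empty_or_nonempty with rfl | hne
    · exact ⟨⟨(X, σ), h, subset_rfl, fun _ _ _ _ => rfl⟩, by simp⟩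
    let Y : Set (Fr n) := ⋃ p ∈ C, p.1.1
    let τ : Fr n → Fr n → ℤ := fun a b =>
      if hab : ∃ p ∈ C, a ∈ p.1.1 ∧ b ∈ p.1.1 then hab.choose.1.2 a b else 0
    have hτ : ∀ p ∈ C, ∀ a ∈ p.1.1, ∀ b ∈ p.1.1, τ a b = p.1.2 a b := by
      intro p hp a ha b hb
      have hab : ∃ p ∈ C, a ∈ p.1.1 ∧ b ∈ p.1.1 := ⟨p, hp, ha, hb⟩
      have e : τ a b = hab.choose.1.2 a b := dif_pos hab
      rw [e]
      obtain ⟨hq, hqa, hqb⟩ := hab.choose_spec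
      rcases eq_or_ne hab.choose p with he | hne
      · rw [he]
      rcases hC hq hp hne with h1 | h1
      · exact (h1.2 a hqa b hqb).symm
      · exact h1.2 a ha b hb
    have dir : DirectedOn (fun p q : T => p.1.1 ⊆ q.1.1) C := by
      intro p hp q hq
      rcases eq_or_ne p q with rfl | hpq
      · exact ⟨p, hp, subset_rfl, subset_rfl⟩
      rcases hC hp hq hpq with h1 | h1
      · exact ⟨q, hq, h1.1, subset_rfl⟩
      · exact ⟨p, hp, subset_rfl, h1.1⟩
    have fin : ∀ S : Finset (Fr n), (S : Set (Fr n)) ⊆ Y → ∃ p ∈ C, (S : Set (Fr n)) ⊆ p.1.1 :=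
      fun S hS => DirectedOn.exists_mem_subset_of_finset_subset_biUnion hne dir hS
    have two : ∀ a ∈ Y, ∀ b ∈ Y, ∃ p ∈ C, a ∈ p.1.1 ∧ b ∈ p.1.1 := by
      intro a ha b hb
      obtain ⟨p, hp, hs⟩ := fin {a, b} (by simp [Set.insert_subset_iff, ha, hb])
      simp [Set.insert_subset_iff] at hs
      exact ⟨p, hp, hs⟩
    obtain ⟨p0, hp0⟩ := hne
    have hpo : PO Y τ := by
      refine ⟨?_, ?_, ?_, ?_, ?_, ?_, ?_⟩
      · intro g hg
        exact Set.mem_biUnion hp0 (p0.2.1.ball1 g hg)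
      · intro s g hg hh
        obtain ⟨p, hp, hm⟩ := Set.mem_iUnion₂.1 hg
        exact Set.mem_biUnion hp (p.2.1.suff s g hm hh)
      · intro a ha b hb
        obtain ⟨p, hp, ha, hb⟩ := two a ha b hb
        rw [hτ p hp a ha b hb, hτ p hp b hb a ha]
        exact p.2.1.anti a ha b hb
      · intro a ha b hb
        obtain ⟨p, hp, ha, hb⟩ := two a ha b hb
        rw [hτ p hp a ha b hb]
        exact p.2.1.pm a ha b hb
      · intro a ha b hb d hd
        obtain ⟨p, hp, hs⟩ := fin {a, b, d} (by simp [Set.insert_subset_iff, ha, hb, hd])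
        simp [Set.insert_subset_iff] at hs
        obtain ⟨ha, hb, hd⟩ := hs
        rw [hτ p hp a ha b hb, hτ p hp b hb d hd, hτ p hp a ha d hd]
        exact p.2.1.trans a ha b hb d hd
      · intro a ha h1
        obtain ⟨p, hp, ha⟩ := Set.mem_iUnion₂.1 ha
        rw [hτ p hp 1 p.2.1.one_mem a ha]
        exact p.2.1.one a ha h1
      · intro s a ha b hb d hd hsa hsb hsd
        obtain ⟨p, hp, hs⟩ := fin {a, b, d, freeGen s * a, freeGen s * b, freeGen s * d}
          (by simp [Set.insert_subset_iff, ha, hb, hd, hsa, hsb, hsd])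
        simp [Set.insert_subset_iff] at hs
        obtain ⟨ha, hb, hd, hsa, hsb, hsd⟩ := hs
        have := p.2.1.inv s a ha b hb d hd hsa hsb hsd
        unfold dl at *
        rw [hτ p hp a ha b hb, hτ p hp b hb d hd, hτ p hp d hd a ha, hτ p hp _ hsa _ hsb,
          hτ p hp _ hsb _ hsd, hτ p hp _ hsd _ hsa]
        exact this
    refine ⟨⟨(Y, τ), hpo, fun x hx => Set.mem_biUnion hp0 (p0.2.2.1 hx), ?_⟩, ?_⟩
    · intro a ha b hb
      show τ a b = _
      rw [hτ p0 hp0 a (p0.2.2.1 ha) b (p0.2.2.1 hb)]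
      exact p0.2.2.2 a ha b hb
    · intro p hp
      exact ⟨fun x hx => Set.mem_biUnion hp hx, fun a ha b hb => hτ p hp a ha b hb⟩
  obtain ⟨m, hm⟩ := exists_maximal_of_chains_bounded chain rtrans
  by_cases hu : m.1.1 = Set.univ
  · refine ⟨m.1.2, ?_, m.2.2.2⟩
    rw [← hu]; exact m.2.1
  · obtain ⟨u, σ', huX, hpo, hag⟩ := m.2.1.ext_one hu
    have := hm ⟨(insert u m.1.1, σ'), hpo, m.2.2.1.trans (Set.subset_insert _ _), ?_⟩
      ⟨Set.subset_insert _ _, hag⟩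
    · exact absurd (this.1 (Set.mem_insert u _)) huX
    · intro a ha b hb
      show σ' a b = _
      rw [hag a (m.2.2.1 ha) b (m.2.2.1 hb)]
      exact m.2.2.2 a ha b hb

lemma PO.isCO {σ : Fr n → Fr n → ℤ} (h : PO Set.univ σ) : IsCircularOrder (dl σ) := by
  have anti : ∀ a b, σ b a = - σ a b := fun a b => h.anti a trivial b trivial
  have self : ∀ a, σ a a = 0 := fun a => h.self trivial
  refine ⟨?_, fun a b d => h.val' trivial trivial trivial, ?_, ?_⟩
  · intro a b d
    constructor
    · intro h0
      by_contra hcon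
      push Not at hcon
      have := h.val (a := a) (b := b) (d := d) trivial trivial trivial hcon.1 hcon.2.1 hcon.2.2
      omega
    · rintro (rfl | rfl | rfl)
      · have := self a
        have := anti a d
        unfold dl; omega
      · have := self b
        have := anti a b
        unfold dl; omega
      · have := self a
        have := anti a b
        unfold dl; omega
  · intro a b d e
    have := anti a b
    have := anti a d
    have := anti a e
    have := anti b d
    have := anti b e
    have := anti d e
    unfold dl; omega
  · intro g
    induction g using fr_induction with
    | h1 => simp
    | hs s g hg ih =>
      intro u v w
      rw [mul_assoc, mul_assoc, mul_assoc, h.inv s _ trivial _ trivial _ trivial trivial trivial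
        trivial, ih]

lemma PO_of_co {c : Fr n → Fr n → Fr n → ℤ} (hc : IsCircularOrder c) {X : Set (Fr n)}
    (hb : ∀ g : Fr n, g.norm ≤ 1 → g ∈ X)
    (hs : ∀ s g, freeGen s * g ∈ X → hd g ≠ some (linv s) → g ∈ X) : PO X (sgc c) := by
  refine ⟨hb, hs, ?_, ?_, ?_, ?_, ?_⟩
  · intro a _ b _
    unfold sgc
    by_cases h1 : a = b
    · simp [h1]
    have h1' := Ne.symm h1
    by_cases h2 : a = 1
    · simp [h2, h2 ▸ h1, h2 ▸ h1']
    by_cases h3 : b = 1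
    · simp [h3, h2, Ne.symm h2]
    simp [h1, h1', h2, h3]
    exact co_swap hc _ _ _
  · intro a _ b _ hab
    unfold sgc
    by_cases h2 : a = 1
    · simp [h2, h2 ▸ hab]
    by_cases h3 : b = 1
    · simp [h3, h2]
    simp only [hab, h2, h3, if_false]
    exact co_ne hc (Ne.symm h2) hab (Ne.symm h3)
  · intro a _ b _ d _
    unfold sgc
    by_cases h1 : a = b
    · simp [h1]
    by_cases h2 : b = d
    · simp [h2]
    by_cases h3 : b = 1
    · subst h3; simp [h1]
    by_cases h4 : a = 1
    · subst h4
      by_cases h5 : d = 1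
      · simp [h5, h2, h3]
      · simp [h1, h2, h3, Ne.symm h5]
    by_cases h5 : d = 1
    · simp [h5, h2, h3]
    simp only [h1, h2, h3, h4, h5, if_false]
    intro e1 e2
    have := co_trans hc e1 e2
    rw [if_neg, this]
    rintro rfl
    have := co_00 hc 1 a
    omega
  · intro a _ ha
    simp [sgc, Ne.symm ha]
  · intro s a _ b _ d _ _ _ _
    unfold dl
    rw [← co_eq_sgc hc, ← co_eq_sgc hc, co_inv hc]

lemma cut_true {c : Fr n → Fr n → Fr n → ℤ} (hc : IsCircularOrder c) {S : Finset (Fr n)}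
    (hS : ∀ c' : Fr n → Fr n → Fr n → ℤ, IsCircularOrder c' →
      (∀ u ∈ S, ∀ v ∈ S, ∀ w ∈ S, c' u v w = c u v w) → c' = c)
    {X : Set (Fr n)} (hSX : ∀ g ∈ S, g ∈ X)
    (hb : ∀ g : Fr n, g.norm ≤ 1 → g ∈ X)
    (hs : ∀ s g, freeGen s * g ∈ X → hd g ≠ some (linv s) → g ∈ X)
    {s : Fin n × Bool} {g u : Fr n} (hg : g ∈ X) (hu : u = freeGen s * g)
    (huX : u ∉ X) (P : Fr n → Prop) (P1 : P 1)
    (Pd : ∀ x ∈ X, ∀ y ∈ X, y ≠ 1 → P y → c 1 x y = 1 → P x)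
    (Pc : ∀ y ∈ X, y ≠ 1 → (freeGen s)⁻¹ * y ∈ X → (P y ↔ c 1 y u = 1))
    {v : Fr n} (hv : v ∈ X) (hv1 : v ≠ 1) : P v ↔ c 1 v u = 1 := by
  have h := PO_of_co hc hb hs
  have hu1 : u ≠ 1 := fun he => huX (he ▸ h.one_mem)
  have hpo := h.ins hg hu huX P P1 ?_ ?_
  · obtain ⟨σ', hσ', hag⟩ := hpo.extend
    have hmem : ∀ x ∈ X, x ∈ insert u X := fun x hx => Or.inr hx
    have hX : ∀ a ∈ X, ∀ b ∈ X, σ' a b = sgc c a b := by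
      intro a ha b hb
      rw [hag a (hmem a ha) b (hmem b hb)]
      have h1 : a ≠ u := fun he => huX (he ▸ ha)
      have h2 : b ≠ u := fun he => huX (he ▸ hb)
      simp [insσ, h1, h2]
    have := hS _ hσ'.isCO ?_
    · rw [← this]
      have e1 := hag v (hmem v hv) u (Or.inl rfl)
      have hvu : v ≠ u := fun he => huX (he ▸ hv)
      have e2 := hσ'.one v trivial hv1
      have e3 := hσ'.one u trivial hu1
      have e4 := hσ'.anti 1 trivial u trivial
      unfold dl
      by_cases hP : P v
      · simp [insσ, hP, hvu] at e1
        simp only [hP, true_iff]; omega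
      · simp [insσ, hP, hvu] at e1
        simp only [hP, false_iff]; omega
    · intro a ha b hb d hd
      unfold dl
      rw [hX _ (hSX a ha) _ (hSX b hb), hX _ (hSX b hb) _ (hSX d hd), hX _ (hSX d hd) _ (hSX a ha),
        ← co_eq_sgc hc]
  · intro x hx y hy hP hxy
    unfold sgc at hxy
    by_cases h1 : x = 1
    · rw [h1]; exact P1
    by_cases h2 : x = y
    · rw [h2]; exact hP
    by_cases h3 : y = 1
    · rw [if_neg h2, if_neg h1, if_pos h3] at hxy; omega
    rw [if_neg h2, if_neg h1, if_neg h3] at hxy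
    exact Pd x hx y hy h3 hP hxy
  · intro y hy hy1 hy2
    rw [Pc y hy hy1 hy2]
    unfold dl
    rw [← co_eq_sgc hc, ← co_inv hc (freeGen s) (freeGen s)⁻¹]
    simp [hu]
end po
end PP
end

noncomputable section
set_option linter.unusedSimpArgs false
set_option linter.unusedVariables false
namespace PP
section iso
variable {n : ℕ} {c : Fr n → Fr n → Fr n → ℤ}

def Suf (g : Fr n) : Set (Fr n) := {h | h.toWord <:+ g.toWord}

lemma Suf_self (g : Fr n) : g ∈ Suf g := List.suffix_rfl
lemma Suf_norm {g h : Fr n} (hh : h ∈ Suf g) : h.norm ≤ g.norm := List.IsSuffix.length_le hh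
lemma Suf_eq {g h : Fr n} (hh : h ∈ Suf g) (hn : h.norm = g.norm) : h = g :=
  FreeGroup.toWord_injective (List.IsSuffix.eq_of_length hh hn)
lemma Suf_suff {g h : Fr n} {s : Fin n × Bool} (hh : freeGen s * h ∈ Suf g)
    (h2 : hd h ≠ some (linv s)) : h ∈ Suf g := by
  unfold Suf at *
  rw [Set.mem_ofPred_eq, toWord_gen_mul h2] at hh
  exact (List.suffix_cons s _).trans hh

lemma lemA (hc : IsCircularOrder c) {S : Finset (Fr n)}
    (hS : ∀ c' : Fr n → Fr n → Fr n → ℤ, IsCircularOrder c' →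
      (∀ u ∈ S, ∀ v ∈ S, ∀ w ∈ S, c' u v w = c u v w) → c' = c)
    {X : Set (Fr n)} (hSX : ∀ g ∈ S, g ∈ X)
    (hb : ∀ g : Fr n, g.norm ≤ 1 → g ∈ X)
    (hs : ∀ s g, freeGen s * g ∈ X → hd g ≠ some (linv s) → g ∈ X)
    {s : Fin n × Bool} {g u v : Fr n} (hg : g ∈ X) (hu : u = freeGen s * g)
    (huX : u ∉ X) (hv : v ∈ X) (hsv : (freeGen s)⁻¹ * v ∉ X) :
    ∃ y, y ≠ 1 ∧ y ∈ X ∧ (freeGen s)⁻¹ * y ∈ X ∧ c 1 y u ≠ c 1 y v := by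
  by_contra hcon
  push Not at hcon
  have hv1 : v ≠ 1 := by
    rintro rfl
    apply hsv
    apply hb
    rw [mul_one, FreeGroup.norm_inv_eq, norm_freeGen]
  by_cases hvu : c 1 v u = 1
  · have := cut_true hc hS hSX hb hs hg hu huX (fun x => x = 1 ∨ c 1 x v = 1) (Or.inl rfl) ?_ ?_ hv hv1
    · simp only [hv1, false_or] at this
      have h2 := this.2 hvu
      rw [co_00 hc] at h2; omega
    · rintro x hx y hy hy1 (rfl | h) hxy
      · exact absurd rfl hy1
      · exact Or.inr (co_trans hc hxy h)
    · intro y hy hy1 hy2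
      rw [hcon y hy1 hy hy2]
      simp [hy1]
  · have := cut_true hc hS hSX hb hs hg hu huX (fun x => x = 1 ∨ x = v ∨ c 1 x v = 1) (Or.inl rfl)
      ?_ ?_ hv hv1
    · exact hvu (this.1 (Or.inr (Or.inl rfl)))
    · rintro x hx y hy hy1 (rfl | rfl | h) hxy
      · exact absurd rfl hy1
      · exact Or.inr (Or.inr hxy)
      · exact Or.inr (Or.inr (co_trans hc hxy h))
    · intro y hy hy1 hy2
      rw [hcon y hy1 hy hy2]
      have : y ≠ v := by rintro rfl; exact hsv hy2
      simp [hy1, this]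

def Beq (c : Fr n → Fr n → Fr n → ℤ) (L : ℕ) (u v : Fr n) : Prop :=
  ∀ e : Fr n, e.norm ≤ L → e ≠ 1 → c 1 e u = c 1 e v

lemma Beq.symm {L : ℕ} {u v : Fr n} (h : Beq c L u v) : Beq c L v u :=
  fun e h1 h2 => (h e h1 h2).symm

lemma Beq.between (hc : IsCircularOrder c) {L : ℕ} {u v y : Fr n} (h : Beq c L u v)
    (hy : L < y.norm) (hu : L < u.norm) (hv : L < v.norm) (hyu : y ≠ u) (hyv : y ≠ v)
    (hne : c 1 y u ≠ c 1 y v) : Beq c L u y := by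
  have ne1 : ∀ x : Fr n, L < x.norm → 1 ≠ x := by
    rintro x hx rfl; simp at hx
  intro e he he1
  have heq := h e he he1
  have hey : e ≠ y := by rintro rfl; omega
  have heu : e ≠ u := by rintro rfl; omega
  have e1 := co_ne hc (ne1 y hy) hyu (ne1 u hu)
  have e2 := co_ne hc (ne1 y hy) hyv (ne1 v hv)
  have e3 := co_ne hc he1.symm heu (ne1 u hu)
  have s1 := co_swap hc 1 y u
  have s2 := co_swap hc 1 y v
  have s3 := co_swap hc 1 e u
  have s4 := co_swap hc 1 e v
  have s5 := co_swap hc 1 e y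
  have t1 := @co_trans _ _ _ hc 1 e u y
  have t2 := @co_trans _ _ _ hc 1 e v y
  have t3 := @co_trans _ _ _ hc 1 y u e
  have t4 := @co_trans _ _ _ hc 1 y v e
  omega

lemma beq_hd (hc : IsCircularOrder c) {S : Finset (Fr n)}
    (hS : ∀ c' : Fr n → Fr n → Fr n → ℤ, IsCircularOrder c' →
      (∀ u ∈ S, ∀ v ∈ S, ∀ w ∈ S, c' u v w = c u v w) → c' = c)
    {L : ℕ} (hL1 : 1 ≤ L) (hSL : ∀ g ∈ S, g.norm ≤ L) :
    ∀ N M, ∀ u v : Fr n, u.norm ≤ N → v.norm ≤ N → u.norm + v.norm ≤ M → L < u.norm → L < v.norm →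
      Beq c L u v → hd u = hd v := by
  intro N
  induction N with
  | zero => intro M u v h1 h2 h3 h4; omega
  | succ N IHa =>
  intro M
  induction M with
  | zero => intro u v h1 h2 h3 h4; omega
  | succ M IHb =>
  have IHa' : ∀ u v : Fr n, u.norm ≤ N → v.norm ≤ N → L < u.norm → L < v.norm →
      Beq c L u v → hd u = hd v := fun u v h1 h2 => IHa _ u v h1 h2 le_rfl
  have main : ∀ u v : Fr n, u.norm ≤ N + 1 → v.norm ≤ u.norm → u.norm + v.norm ≤ M + 1 →
      L < u.norm → L < v.norm → Beq c L u v → hd u = hd v := by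
    intro u v hu hvu hsum hLu hLv hB
    by_cases huN : u.norm ≤ N
    · exact IHa' u v huN (by omega) hLu hLv hB
    by_contra hne
    rcases hd_cases u with rfl | ⟨s, g, hug, hgh⟩
    · simp at hLu
    have hdu : hd u = some s := by rw [hug]; exact hd_gen_mul hgh
    have hgn : g.norm + 1 = u.norm := by rw [hug, norm_gen_mul hgh]
    have up : ∀ y : Fr n, hd y ≠ some s → ((freeGen s)⁻¹ * y).norm = y.norm + 1 ∧
        hd ((freeGen s)⁻¹ * y) = some (linv s) := by
      intro y hy
      rw [freeGen_inv]
      exact ⟨norm_gen_mul (by simpa using hy), hd_gen_mul (by simpa using hy)⟩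
    have Trans : ∀ y : Fr n, L < y.norm → Beq c L u y → hd y ≠ some s →
        (freeGen s)⁻¹ * y ∈ Suf g → False := by
      intro y hLy hBy hdy hysuf
      obtain ⟨up1, up2⟩ := up y hdy
      have h1 := Suf_norm hysuf
      have : ¬ Beq c L g ((freeGen s)⁻¹ * y) := by
        intro hB'
        have := IHa' _ _ (by omega) (by omega) (by omega) (by omega) hB'
        rw [up2] at this
        exact hgh this
      unfold Beq at this
      push Not at this
      obtain ⟨e, heL, he1, hene⟩ := this
      have q1 : c 1 e g = c (freeGen s) (freeGen s * e) u := by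
        rw [← co_inv hc (freeGen s), mul_one, hug]
      have q2 : c 1 e ((freeGen s)⁻¹ * y) = c (freeGen s) (freeGen s * e) y := by
        rw [← co_inv hc (freeGen s), mul_one, mul_inv_cancel_left]
      rw [q1, q2, co_eq hc, co_eq hc (freeGen s) (freeGen s * e) y] at hene
      have q3 := hBy (freeGen s) (by rw [norm_freeGen]; exact hL1) (freeGen_ne_one s)
      have q4 : c 1 (freeGen s * e) u ≠ c 1 (freeGen s * e) y := by omega
      have q5 : freeGen s * e ≠ 1 := by
        intro h; rw [h, co_01 hc, co_01 hc] at q4; exact q4 rfl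
      have q6 : L < (freeGen s * e).norm := by
        by_contra h; exact q4 (hBy _ (by omega) q5)
      have q7 : hd e ≠ some (linv s) := by
        intro h; have := (gen_mul_cancel h).2; omega
      have q8 := norm_gen_mul q7
      have q9 := hd_gen_mul q7
      have q10 := hBy.symm.between hc q6 hLy hLu
        (by intro h; rw [h] at q9; exact hdy q9) (by intro h; rw [h] at q8; omega) q4.symm
      have := IHa' _ _ (by omega) (by omega) hLy q6 q10
      rw [q9] at this; exact hdy this
    have hdv : hd v ≠ some s := by rw [← hdu]; exact fun h => hne h.symm
    obtain ⟨upv1, upv2⟩ := up v hdv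
    let X : Set (Fr n) := {h | h.norm ≤ L} ∪ (Suf g ∪ Suf v)
    by_cases hsv : (freeGen s)⁻¹ * v ∈ X
    · rcases hsv with h | h | h
      · rw [Set.mem_ofPred_eq] at h; omega
      · exact Trans v hLv hB hdv h
      · have := Suf_norm h; omega
    have huX : u ∉ X := by
      rintro (h | h | h)
      · rw [Set.mem_ofPred_eq] at h; omega
      · have := Suf_norm h; omega
      · have h1 := Suf_norm h
        have := Suf_eq h (by omega)
        rw [this] at hne; exact hne rfl
    obtain ⟨y, hy1, hyX, hsyX, hyne⟩ := lemA hc hS (X := X) (fun g hg => Or.inl (hSL g hg))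
      (fun g hg => Or.inl (by rw [Set.mem_ofPred_eq]; omega))
      (by
        rintro t h (h1 | h1 | h1) h2
        · rw [Set.mem_ofPred_eq, norm_gen_mul h2] at h1
          exact Or.inl (by rw [Set.mem_ofPred_eq]; omega)
        · exact Or.inr (Or.inl (Suf_suff h1 h2))
        · exact Or.inr (Or.inr (Suf_suff h1 h2)))
      (s := s) (g := g) (u := u) (v := v) (Or.inr (Or.inl (Suf_self g))) hug huX
      (Or.inr (Or.inr (Suf_self v))) hsv
    have hLy : L < y.norm := by
      by_contra h; exact hyne (hB y (by omega) hy1)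
    have hyu : y ≠ u := by rintro rfl; exact huX hyX
    have hyv : y ≠ v := by rintro rfl; exact hsv hsyX
    have B1 := hB.between hc hLy hLu hLv hyu hyv hyne
    have B2 := hB.symm.between hc hLy hLv hLu hyv hyu hyne.symm
    by_cases hdy : hd y = some s
    · have hlt : y.norm < u.norm := by
        rcases hyX with h | h | h
        · rw [Set.mem_ofPred_eq] at h; omega
        · have := Suf_norm h; omega
        · have h1 := Suf_norm h
          have h2 : y.norm ≠ v.norm := fun h3 => hyv (Suf_eq h h3)
          omega
      have := IHb v y (by omega) (by omega) (by omega) hLv hLy B2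
      rw [this] at hdv; exact hdv hdy
    · obtain ⟨u1, u2⟩ := up y hdy
      rcases hsyX with h | h | h
      · rw [Set.mem_ofPred_eq] at h; omega
      · exact Trans y hLy B1 hdy h
      · have h1 := Suf_norm h
        have := IHb u y (by omega) (by omega) (by omega) hLu hLy B1
        rw [← this] at hdy; exact hdy hdu
  intro u v h1 h2 h3 h4 h5 h6
  rcases le_total v.norm u.norm with h | h
  · exact main u v h1 h h3 h4 h5 h6
  · exact (main v u h2 h (by omega) h5 h4 h6.symm).symm

lemma isolated_star (hc : IsCircularOrder c) (h : IsIsolatedCO c) : Star c := by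
  obtain ⟨S, hS⟩ := h
  obtain ⟨L, hL1, hL⟩ := finset_ball S
  refine ⟨(ball_finite n L).toFinset, ?_⟩
  intro u v hu hv hh huv
  by_cases hu2 : u.norm ≤ L
  · exact ⟨u, by simpa using hu2, hu, Or.inl rfl, Or.inr huv⟩
  by_cases hv2 : v.norm ≤ L
  · exact ⟨v, by simpa using hv2, hv, Or.inr huv, Or.inl rfl⟩
  have : ¬ Beq c L u v := fun h => hh (beq_hd hc hS hL1 hL (u.norm + v.norm) (u.norm + v.norm) u v
    (by omega) (by omega) le_rfl (by omega) (by omega) h)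
  unfold Beq at this
  push Not at this
  obtain ⟨e, he, he1, hne⟩ := this
  refine ⟨e, by simpa using he, he1, Or.inr ?_, Or.inr ?_⟩
  all_goals
    have e1 := co_ne hc (Ne.symm he1) (by rintro rfl; omega : e ≠ u) hu.symm
    have e2 := co_ne hc (Ne.symm he1) (by rintro rfl; omega : e ≠ v) hv.symm
    have s1 := co_swap hc 1 e u
    have s2 := co_swap hc 1 e v
    have t1 := @co_trans _ _ _ hc 1 e u v
    omega
end iso
end PP
end

noncomputable section
set_option linter.unusedSimpArgs false
set_option linter.unusedVariables false
namespace PP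
section succ
variable {n : ℕ} {c : Fr n → Fr n → Fr n → ℤ}

lemma exists_succ (hn : 1 ≤ n) (hc : IsCircularOrder c) (h : Star c) :
    ∃ k : Fr n, k ≠ 1 ∧ ∀ g, g ≠ 1 → g ≠ k → c 1 k g = 1 := by
  classical
  obtain ⟨E, hE⟩ := h
  by_contra hcon
  push Not at hcon
  have nomin : ∀ z : Fr n, z ≠ 1 → ∃ u, c 1 u z = 1 := by
    intro z hz
    obtain ⟨g, g1, g2, g3⟩ := hcon z hz
    refine ⟨g, ?_⟩
    have := co_ne hc hz.symm g2.symm g1.symm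
    have := co_swap hc 1 z g
    omega
  have shrink : ∀ T : Finset (Fr n), ∃ z : Fr n, z ≠ 1 ∧ ∀ t ∈ T, t ≠ 1 → c 1 z t = 1 := by
    intro T
    induction T using Finset.induction_on with
    | empty => exact ⟨freeGen (⟨0, hn⟩, true), freeGen_ne_one _, by simp⟩
    | insert a T _ ih =>
      obtain ⟨z, hz1, hz⟩ := ih
      by_cases ha : a = 1
      · refine ⟨z, hz1, ?_⟩
        intro t ht ht1
        rw [Finset.mem_insert] at ht
        rcases ht with rfl | ht
        · exact absurd ha ht1
        · exact hz t ht ht1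
      · obtain ⟨w, hw⟩ : ∃ w, c 1 w a = 1 ∧ c 1 w z = 1 := by
          by_cases haz : a = z
          · subst haz
            obtain ⟨w, hw⟩ := nomin a ha
            exact ⟨w, hw, hw⟩
          · rcases co_ne hc (Ne.symm ha) haz hz1.symm with h | h
            · obtain ⟨w, hw⟩ := nomin a ha
              exact ⟨w, hw, co_trans hc hw h⟩
            · obtain ⟨w, hw⟩ := nomin z hz1
              refine ⟨w, co_trans hc hw ?_, hw⟩
              rw [co_swap hc, h]; rfl
        refine ⟨w, ?_, ?_⟩
        · exact ((co_of_ne hc (by rw [hw.1]; norm_num)).1).symm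
        · intro t ht ht1
          rw [Finset.mem_insert] at ht
          rcases ht with rfl | ht
          · exact hw.1
          · exact co_trans hc hw.2 (hz t ht ht1)
  have step : ∀ x z : Fr n, z ≠ 1 → (∀ u, c 1 u z = 1 → hd (x * u) ≠ hd x) →
      (x = 1 ∨ x ∈ E) ∧ ∃ x' z' : Fr n, x'.norm = x.norm + 1 ∧ z' ≠ 1 ∧
        ∀ u, c 1 u z' = 1 → hd (x' * u) ≠ hd x' := by
    intro x z hz hgood
    obtain ⟨z', hz', hT⟩ := shrink (insert z (insert x⁻¹ (E.image (x⁻¹ * ·))))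
    have hz'z : c 1 z' z = 1 := hT z (by simp) hz
    have lt1 : x ≠ 1 → ∀ u, c 1 u z' = 1 → c x (x * u) 1 = 1 := by
      intro hx u hu
      rw [co_base hc, inv_mul_cancel_left, mul_one]
      exact co_trans hc hu (hT _ (by simp) (by simpa using hx))
    have ltE : ∀ e ∈ E, e ≠ x → ∀ u, c 1 u z' = 1 → c x (x * u) e = 1 := by
      intro e he hex u hu
      rw [co_base hc, inv_mul_cancel_left]
      refine co_trans hc hu (hT _ ?_ ?_)
      · simp only [Finset.mem_insert, Finset.mem_image]
        exact Or.inr (Or.inr ⟨e, he, rfl⟩)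
      · rw [Ne, inv_mul_eq_one]; exact hex.symm
    have ne1 : ∀ u, c 1 u z' = 1 → u ≠ 1 := fun u hu =>
      ((co_of_ne hc (by rw [hu]; norm_num)).1).symm
    have xne1 : ∀ u, c 1 u z' = 1 → x * u ≠ 1 := by
      intro u hu
      by_cases hx : x = 1
      · rw [hx, one_mul]; exact ne1 u hu
      · exact (co_of_ne hc (by rw [lt1 hx u hu]; norm_num)).2.1
    have const : ∀ u v, c 1 u z' = 1 → c 1 v z' = 1 → c 1 (x * u) (x * v) = 1 →
        hd (x * u) = hd (x * v) := by
      intro u v hu hv huv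
      by_contra hne
      obtain ⟨e, heE, he1, ha, hb⟩ := hE _ _ (xne1 u hu) (xne1 v hv) hne huv
      by_cases hex : e = x
      · subst hex
        have r := co_rot hc 1 e (e * u)
        have := lt1 he1 u hu
        have s := co_swap hc 1 e (e * u)
        rcases ha with ha | ha
        · exact ne1 u hu (by simpa using ha)
        · omega
      · have l1 := ltE e heE hex u hu
        have l2 := ltE e heE hex v hv
        have n1 := (co_of_ne hc (by rw [l1]; norm_num)).2.1
        have n2 := (co_of_ne hc (by rw [l2]; norm_num)).2.1
        have ha := ha.resolve_left n1
        have hb := hb.resolve_left n2.symm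
        by_cases hx : x = 1
        · subst hx
          have := co_swap hc 1 e (1 * v)
          omega
        · have m1 := lt1 hx u hu
          have m2 := lt1 hx v hv
          have p1 := co_eq hc (x * u) e (x * v)
          have p2 := hc.2.2.1 x (x * u) e (x * v)
          have p3 := hc.2.2.1 x (x * u) (x * v) 1
          have p4 := co_rot hc 1 (x * u) (x * v)
          have p5 := co_swap hc x e (x * v)
          omega
    obtain ⟨u0, hu0⟩ := nomin z' hz'
    obtain ⟨t, ht⟩ : ∃ t, hd (x * u0) = some t := by
      rcases h : hd (x * u0) with _ | t
      · exact absurd (hd_eq_none.1 h) (xne1 u0 hu0)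
      · exact ⟨t, rfl⟩
    have allt : ∀ u, c 1 u z' = 1 → hd (x * u) = some t := by
      intro u hu
      by_cases huu : u = u0
      · rw [huu, ht]
      rw [← ht]
      rcases co_ne hc (xne1 u hu).symm (by simpa using huu) (xne1 u0 hu0).symm with h | h
      · exact const u u0 hu hu0 h
      · exact (const u0 u hu0 hu (by rw [co_swap hc, h]; rfl)).symm
    have hdx : hd x ≠ some t := by
      rw [← ht]; exact (hgood u0 (co_trans hc hu0 hz'z)).symm
    refine ⟨?_, freeGen (linv t) * x, z', norm_gen_mul (by simpa using hdx), hz', ?_⟩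
    · by_contra hcon2
      push Not at hcon2
      obtain ⟨hx1, hxE⟩ := hcon2
      have m1 := lt1 hx1 u0 hu0
      have r1 := co_rot hc 1 x (x * u0)
      obtain ⟨e, heE, he1, ha, hb⟩ := hE _ _ hx1 (xne1 u0 hu0) (by rw [ht]; exact hdx) (by omega)
      have hex : e ≠ x := by rintro rfl; exact hxE heE
      have l1 := ltE e heE hex u0 hu0
      have n1 := (co_of_ne hc (by rw [l1]; norm_num)).2.1
      have ha := ha.resolve_left hex.symm
      have hb := hb.resolve_left n1.symm
      have p1 := co_eq hc x e (x * u0)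
      have p2 := co_swap hc x e (x * u0)
      omega
    · intro u hu
      rw [hd_gen_mul (by simpa using hdx), mul_assoc]
      exact (gen_mul_cancel (by simpa using allt u hu)).1
  obtain ⟨L, _, hL⟩ := finset_ball E
  have all : ∀ N : ℕ, ∃ x z : Fr n, x.norm = N ∧ z ≠ 1 ∧ ∀ u, c 1 u z = 1 → hd (x * u) ≠ hd x := by
    intro N
    induction N with
    | zero =>
      refine ⟨1, freeGen (⟨0, hn⟩, true), by simp, freeGen_ne_one _, ?_⟩
      intro u hu
      have := (co_of_ne hc (by rw [hu]; norm_num)).1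
      rw [one_mul, hd_one, Ne, hd_eq_none]; exact this.symm
    | succ N ih =>
      obtain ⟨x, z, h1, h2, h3⟩ := ih
      obtain ⟨-, x', z', h4, h5, h6⟩ := step x z h2 h3
      exact ⟨x', z', by omega, h5, h6⟩
  obtain ⟨x, z, h1, h2, h3⟩ := all (L + 1)
  rcases (step x z h2 h3).1 with rfl | h
  · simp at h1
  · have := hL x h; omega

lemma succ_all (hc : IsCircularOrder c) {k : Fr n} (hk : ∀ g, g ≠ 1 → g ≠ k → c 1 k g = 1)
    (g h : Fr n) (h1 : h ≠ g) (h2 : h ≠ g * k) : c g (g * k) h = 1 := by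
  rw [co_base hc, inv_mul_cancel_left]
  apply hk
  · rw [Ne, inv_mul_eq_one]; exact h1.symm
  · rw [Ne, inv_mul_eq_iff_eq_mul]; exact h2

lemma succ_lt (hc : IsCircularOrder c) {k : Fr n} (hk1 : k ≠ 1)
    (hk : ∀ g, g ≠ 1 → g ≠ k → c 1 k g = 1) {e v : Fr n}
    (h : c 1 e v = 1) : e * k ≠ 1 ∧ c 1 e (e * k) = 1 ∧ (e * k = v ∨ c 1 (e * k) v = 1) := by
  obtain ⟨n1, n2, n3⟩ := co_of_ne hc (by rw [h]; norm_num)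
  have hek : e * k ≠ 1 := by
    intro h'
    have := succ_all hc hk e v n2.symm (by rw [h']; exact n3.symm)
    rw [h'] at this
    have r := co_rot hc e 1 v
    have s := co_swap hc 1 e v
    omega
  have h1 := succ_all hc hk e 1 n1 (Ne.symm hek)
  have r1 := co_rot hc 1 e (e * k)
  refine ⟨hek, by omega, ?_⟩
  by_cases hv : v = e * k
  · exact Or.inl hv.symm
  · right
    have h2 := succ_all hc hk e v n2.symm hv
    have := co_eq hc e (e * k) v
    omega

lemma pred_lt (hc : IsCircularOrder c) {k : Fr n} (hk1 : k ≠ 1)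
    (hk : ∀ g, g ≠ 1 → g ≠ k → c 1 k g = 1) {u e : Fr n}
    (h : c 1 u e = 1) : e * k⁻¹ ≠ 1 ∧ c 1 (e * k⁻¹) e = 1 ∧ (u = e * k⁻¹ ∨ c 1 u (e * k⁻¹) = 1) := by
  obtain ⟨n1, n2, n3⟩ := co_of_ne hc (by rw [h]; norm_num)
  have hek : e * k⁻¹ ≠ 1 := by
    intro h'
    rw [mul_inv_eq_one] at h'
    subst h'
    have := hk u n1.symm n2
    have := co_swap hc 1 e u
    omega
  have h1 := succ_all hc hk (e * k⁻¹) 1 (Ne.symm hek) (by simpa using n3)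
  rw [inv_mul_cancel_right] at h1
  have r1 := co_rot hc 1 (e * k⁻¹) e
  refine ⟨hek, by omega, ?_⟩
  by_cases hv : u = e * k⁻¹
  · exact Or.inl hv
  · right
    have h2 := succ_all hc hk (e * k⁻¹) u hv (by simpa using n2)
    rw [inv_mul_cancel_right] at h2
    have := co_eq hc (e * k⁻¹) e u
    have := co_swap hc 1 u e
    have := co_swap hc 1 u (e * k⁻¹)
    omega

lemma starstar (hc : IsCircularOrder c) (hst : Star c) {k : Fr n} (hk1 : k ≠ 1)
    (hk : ∀ g, g ≠ 1 → g ≠ k → c 1 k g = 1) (u v : Fr n) (hh : hd u ≠ hd v)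
    (huv : c 1 u v = 1) :
    ∃ e, e ≠ 1 ∧ e * k ≠ 1 ∧ hd e ≠ hd (e * k) ∧ (u = e ∨ c 1 u e = 1) ∧
      (e * k = v ∨ c 1 (e * k) v = 1) := by
  classical
  obtain ⟨E, hE⟩ := hst
  have letr : ∀ {a b d : Fr n}, (a = b ∨ c 1 a b = 1) → c 1 b d = 1 → c 1 a d = 1 := by
    rintro a b d (rfl | h1) h2
    · exact h2
    · exact co_trans hc h1 h2
  have letr' : ∀ {a b d : Fr n}, c 1 a b = 1 → (b = d ∨ c 1 b d = 1) → c 1 a d = 1 := by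
    rintro a b d h1 (rfl | h2)
    · exact h1
    · exact co_trans hc h1 h2
  have irr : ∀ {a : Fr n}, ¬ c 1 a a = 1 := by
    intro a h; rw [co_00 hc] at h; omega
  induction hN : (E.filter (fun e => (u = e ∨ c 1 u e = 1) ∧ (e = v ∨ c 1 e v = 1))).card
    using Nat.strong_induction_on generalizing u v with
  | _ N ih =>
  obtain ⟨n1, n2, n3⟩ := co_of_ne hc (by rw [huv]; norm_num)
  obtain ⟨e, heE, he1, hue, hev⟩ := hE u v n1.symm n3.symm hh huv
  by_cases hhe : hd e = hd u
  · have hev' : c 1 e v = 1 := by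
      refine hev.resolve_left ?_
      rintro rfl; exact hh hhe.symm
    obtain ⟨a1, a2, a3⟩ := succ_lt hc hk1 hk hev'
    by_cases hek : hd e = hd (e * k)
    · have hek2 : c 1 (e * k) v = 1 := by
        refine a3.resolve_left ?_
        intro h; rw [h] at hek; exact hh (by rw [← hhe, hek])
      obtain ⟨e', b1, b2, b3, b4, b5⟩ := ih _ (by
        rw [← hN]
        apply Finset.card_lt_card
        rw [Finset.ssubset_iff_of_subset]
        · refine ⟨e, Finset.mem_filter.2 ⟨heE, hue, hev⟩, ?_⟩
          intro hm
          exact irr (letr' a2 (Finset.mem_filter.1 hm).2.1)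
        · intro x hx
          rw [Finset.mem_filter] at hx ⊢
          refine ⟨hx.1, Or.inr ?_, hx.2.2⟩
          exact letr hue (letr' a2 hx.2.1)) (e * k) v (by rw [← hek, hhe]; exact hh) hek2 rfl
      refine ⟨e', b1, b2, b3, Or.inr (letr hue (letr' a2 b4)), b5⟩
    · exact ⟨e, he1, a1, hek, hue, a3⟩
  · have hue' : c 1 u e = 1 := by
      refine hue.resolve_left ?_
      rintro rfl; exact hhe rfl
    obtain ⟨a1, a2, a3⟩ := pred_lt hc hk1 hk hue'
    by_cases hek : hd (e * k⁻¹) = hd e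
    · have hek2 : c 1 u (e * k⁻¹) = 1 := by
        refine a3.resolve_left ?_
        intro h; rw [← h] at hek; exact hhe hek.symm
      obtain ⟨e', b1, b2, b3, b4, b5⟩ := ih _ (by
        rw [← hN]
        apply Finset.card_lt_card
        rw [Finset.ssubset_iff_of_subset]
        · refine ⟨e, Finset.mem_filter.2 ⟨heE, hue, hev⟩, ?_⟩
          intro hm
          exact irr (letr (Finset.mem_filter.1 hm).2.2 a2)
        · intro x hx
          rw [Finset.mem_filter] at hx ⊢
          refine ⟨hx.1, hx.2.1, Or.inr ?_⟩
          exact letr' (letr hx.2.2 a2) hev) u (e * k⁻¹) (by rw [hek]; exact Ne.symm hhe) hek2 rfl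
      refine ⟨e', b1, b2, b3, b4, Or.inr (letr b5 (letr' a2 hev))⟩
    · exact ⟨e * k⁻¹, a1, by simpa using he1, by simpa using hek, a3, by simpa using hev⟩
end succ
end PP
end

noncomputable section
set_option linter.unusedSimpArgs false
set_option linter.unusedVariables false
namespace PP
section circle

lemma rep_mem (x : S1) : 0 ≤ S1.rep x ∧ S1.rep x < 1 := by
  have := (AddCircle.equivIco (1 : ℝ) 0 x).2
  unfold S1.rep
  simpa using this

lemma rep_coe (x : S1) : ((S1.rep x : ℝ) : S1) = x := AddCircle.coe_equivIco

lemma rep_of_mem {r : ℝ} (h0 : 0 ≤ r) (h1 : r < 1) : S1.rep (r : S1) = r := by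
  unfold S1.rep
  exact AddCircle.equivIco_coe_of_mem (by simpa using ⟨h0, h1⟩)

lemma rep_inj {x y : S1} (h : S1.rep x = S1.rep y) : x = y := by
  rw [← rep_coe x, h, rep_coe]

def pt (b : S1) (r : ℝ) : S1 := b + (r : S1)
def th (b x : S1) : ℝ := S1.rep (x - b)

lemma th_nonneg (b x : S1) : 0 ≤ th b x := (rep_mem _).1
lemma th_lt (b x : S1) : th b x < 1 := (rep_mem _).2
lemma pt_th (b x : S1) : pt b (th b x) = x := by
  unfold pt th; rw [rep_coe]; abel
lemma th_pt (b : S1) {r : ℝ} (h0 : 0 ≤ r) (h1 : r < 1) : th b (pt b r) = r := by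
  unfold pt th; rw [add_sub_cancel_left]; exact rep_of_mem h0 h1
lemma th_inj {b x y : S1} (h : th b x = th b y) : x = y := by
  rw [← pt_th b x, h, pt_th]
lemma pt_zero (b : S1) : pt b 0 = b := by unfold pt; simp
lemma th_self (b : S1) : th b b = 0 := by
  have := th_pt b (r := 0) le_rfl one_pos
  rwa [pt_zero] at this
lemma th_eq_zero {b x : S1} : th b x = 0 ↔ x = b := by
  constructor
  · intro h; rw [← th_self b] at h; exact th_inj h
  · rintro rfl; exact th_self _
lemma th_pos {b x : S1} (h : x ≠ b) : 0 < th b x :=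
  lt_of_le_of_ne (th_nonneg b x) (fun h' => h (th_eq_zero.1 h'.symm))

lemma continuous_pt (b : S1) : Continuous (pt b) := by
  unfold pt
  exact continuous_const.add (AddCircle.continuous_mk' 1)

lemma isOpenMap_pt (b : S1) : IsOpenMap (pt b) := by
  unfold pt
  exact (Homeomorph.addLeft b).isOpenMap.comp (QuotientAddGroup.isOpenMap_coe)

lemma th_continuousAt {b x : S1} (h : x ≠ b) : ContinuousAt (th b) x := by
  unfold th S1.rep
  have h1 : x - b ≠ ((0 : ℝ) : S1) := by
    simpa [sub_eq_zero] using h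
  have h2 := AddCircle.continuousAt_equivIco (1 : ℝ) 0 h1
  have h3 : ContinuousAt (fun y : S1 => y - b) x := by fun_prop
  exact continuous_subtype_val.continuousAt.comp (ContinuousAt.comp (f := fun y : S1 => y - b) h2 h3)

open Classical in
def sg (r s : ℝ) : ℤ := if r < s then 1 else if s < r then -1 else 0

lemma sg_pos {r s : ℝ} (h : r < s) : sg r s = 1 := by simp [sg, h]
lemma sg_neg {r s : ℝ} (h : s < r) : sg r s = -1 := by simp [sg, h, not_lt.2 h.le]
lemma sg_self (r : ℝ) : sg r r = 0 := by simp [sg]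
lemma sg_anti (r s : ℝ) : sg s r = - sg r s := by
  rcases lt_trichotomy r s with h | h | h
  · rw [sg_pos h, sg_neg h]
  · subst h; rw [sg_self]; rfl
  · rw [sg_pos h, sg_neg h]; rfl
lemma sg_eq_one {r s : ℝ} : sg r s = 1 ↔ r < s := by
  constructor
  · intro h
    by_contra h'
    rcases lt_or_eq_of_le (not_lt.1 h') with h2 | h2
    · rw [sg_neg h2] at h; omega
    · rw [h2, sg_self] at h; omega
  · exact sg_pos

def cyc (r s t : ℝ) : ℤ := sg r s + sg s t + sg t r

lemma circOrd_rep (x y z : S1) : circOrd x y z = cyc (S1.rep x) (S1.rep y) (S1.rep z) := by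
  unfold circOrd cyc
  by_cases h1 : x = y
  · subst h1; simp [sg_self, sg_anti (S1.rep x) (S1.rep z)]
  by_cases h2 : y = z
  · subst h2; simp [sg_self, sg_anti (S1.rep x) (S1.rep y)]
  by_cases h3 : x = z
  · subst h3; simp [sg_self, sg_anti (S1.rep x) (S1.rep y)]
  rw [if_neg (by tauto)]
  have a1 : S1.rep x ≠ S1.rep y := fun h => h1 (rep_inj h)
  have a2 : S1.rep y ≠ S1.rep z := fun h => h2 (rep_inj h)
  have a3 : S1.rep x ≠ S1.rep z := fun h => h3 (rep_inj h)
  generalize S1.rep x = r at *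
  generalize S1.rep y = s at *
  generalize S1.rep z = t at *
  rcases lt_or_gt_of_ne a1 with h | h <;> rcases lt_or_gt_of_ne a2 with h' | h' <;>
    rcases lt_or_gt_of_ne a3 with h'' | h'' <;>
    first
    | (exfalso; linarith)
    | simp [sg, h, h', h'', not_lt.2 h.le, not_lt.2 h'.le, not_lt.2 h''.le]

open Classical in
lemma th_rep (b x : S1) : th b x = S1.rep x - S1.rep b + (if S1.rep b ≤ S1.rep x then 0 else 1) := by
  obtain ⟨b0, b1⟩ := rep_mem b
  obtain ⟨x0, x1⟩ := rep_mem x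
  have e : x - b = ((S1.rep x - S1.rep b : ℝ) : S1) := by
    rw [AddCircle.coe_sub, rep_coe, rep_coe]
  have e2 : ((S1.rep x - S1.rep b : ℝ) : S1) = ((S1.rep x - S1.rep b + 1 : ℝ) : S1) := by
    rw [AddCircle.coe_add_period]
  unfold th
  split_ifs with h
  · rw [e, rep_of_mem (by linarith) (by linarith)]; ring
  · rw [e, e2, rep_of_mem (by linarith) (by linarith)]

lemma circOrd_th (b x y z : S1) : circOrd x y z = cyc (th b x) (th b y) (th b z) := by
  classical
  rw [circOrd_rep]
  let χ : S1 → ℤ := fun x => if S1.rep b ≤ S1.rep x then 1 else 0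
  have key : ∀ x y : S1, sg (th b x) (th b y) = sg (S1.rep x) (S1.rep y) + 2 * (χ x - χ y) := by
    intro x y
    rw [th_rep, th_rep]
    obtain ⟨b0, b1⟩ := rep_mem b
    obtain ⟨x0, x1⟩ := rep_mem x
    obtain ⟨y0, y1⟩ := rep_mem y
    by_cases hx : S1.rep b ≤ S1.rep x <;> by_cases hy : S1.rep b ≤ S1.rep y
    · simp [χ, hx, hy, sg]
    · simp only [χ, hx, hy, if_true, if_false]
      rw [sg_pos, sg_neg] <;> push Not at * <;> first | rfl | linarith
    · simp only [χ, hx, hy, if_true, if_false]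
      rw [sg_neg, sg_pos] <;> push Not at * <;> first | rfl | linarith
    · simp [χ, hx, hy, sg]
  unfold cyc
  rw [key, key, key]; ring

lemma circOrd_base {b x y : S1} (hx : x ≠ b) (hy : y ≠ b) : circOrd b x y = sg (th b x) (th b y) := by
  rw [circOrd_th b, th_self]
  unfold cyc
  rw [sg_pos (th_pos hx), sg_neg (th_pos hy)]; ring

lemma circOrd_eq_one {b x y : S1} : circOrd b x y = 1 ↔ 0 < th b x ∧ th b x < th b y := by
  by_cases hx : x = b
  · subst hx; simp [circOrd, th_self]
  by_cases hy : y = b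
  · subst hy; simp [circOrd, th_self, th_nonneg]
  rw [circOrd_base hx hy, sg_eq_one]
  simp [th_pos hx]

lemma arc_eq (a d : S1) : {z | circOrd a z d = 1} = pt a '' Set.Ioo 0 (th a d) := by
  ext z
  simp only [Set.mem_ofPred_eq, circOrd_eq_one, Set.mem_image, Set.mem_Ioo]
  constructor
  · intro h; exact ⟨th a z, h, pt_th a z⟩
  · rintro ⟨r, ⟨h0, h1⟩, rfl⟩
    rw [th_pt a h0.le (h1.trans (th_lt a d))]
    exact ⟨h0, h1⟩

lemma arc_open (a d : S1) : IsOpen {z | circOrd a z d = 1} := by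
  rw [arc_eq]; exact isOpenMap_pt a _ isOpen_Ioo

lemma pt_pt (b : S1) (r s : ℝ) : pt (pt b r) s = pt b (r + s) := by
  unfold pt; rw [AddCircle.coe_add, add_assoc]

lemma arc_basis {x : S1} {U : Set S1} (hU : U ∈ nhds x) :
    ∃ a d, circOrd a x d = 1 ∧ ∀ z, circOrd a z d = 1 → z ∈ U := by
  have h := (continuous_pt x).continuousAt (x := 0)
  have h2 : pt x ⁻¹' U ∈ nhds (0 : ℝ) := h (by rwa [pt_zero])
  obtain ⟨ε, hε, hb⟩ := Metric.mem_nhds_iff.1 h2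
  set δ := min ε (1/4) / 2 with hδ
  have hm : min ε (1/4) ≤ ε := min_le_left _ _
  have hm2 : min ε (1/4) ≤ 1/4 := min_le_right _ _
  have hm3 : 0 < min ε (1/4) := lt_min hε (by norm_num)
  have hd : pt x δ = pt (pt x (-δ)) (2 * δ) := by rw [pt_pt]; congr 1; ring
  have hx : x = pt (pt x (-δ)) δ := by rw [pt_pt]; simp [pt_zero]
  have e1 : th (pt x (-δ)) (pt x δ) = 2 * δ := by
    rw [hd, th_pt _ (by linarith) (by linarith)]
  have e2 : th (pt x (-δ)) x = δ := by
    nth_rw 2 [hx]; rw [th_pt _ (by linarith) (by linarith)]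
  refine ⟨pt x (-δ), pt x δ, ?_, ?_⟩
  · rw [circOrd_eq_one, e1, e2]; constructor <;> linarith
  · intro z hz
    rw [circOrd_eq_one, e1] at hz
    have : z = pt x (-δ + th (pt x (-δ)) z) := by rw [← pt_pt, pt_th]
    rw [this]
    apply hb
    rw [Metric.mem_ball, Real.dist_eq, abs_lt]
    constructor <;> simp <;> linarith

lemma perm_continuous (f : Equiv.Perm S1)
    (h : ∀ x y z, circOrd (f x) (f y) (f z) = circOrd x y z) : Continuous f := by
  rw [continuous_iff_continuousAt]
  intro x U hU
  obtain ⟨a, d, h1, h2⟩ := arc_basis hU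
  have : {z | circOrd (f.symm a) z (f.symm d) = 1} ∈ nhds x := by
    apply (arc_open _ _).mem_nhds
    rw [Set.mem_ofPred_eq, ← h]; simpa using h1
  show f ⁻¹' U ∈ nhds x
  refine Filter.mem_of_superset this ?_
  intro z hz
  apply h2
  rw [Set.mem_ofPred_eq, ← h] at hz
  simpa using hz

def mkHP (f : Equiv.Perm S1) (h : ∀ x y z, circOrd (f x) (f y) (f z) = circOrd x y z) : ↥HomeoPos :=
  ⟨f, perm_continuous f h, perm_continuous f.symm (fun x y z => by
    rw [← h]; simp), h⟩

lemma ap_continuous (h : ↥HomeoPos) : Continuous (ap h) := h.2.1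
lemma ap_circOrd (h : ↥HomeoPos) (x y z : S1) : circOrd (ap h x) (ap h y) (ap h z) = circOrd x y z :=
  h.2.2.2 x y z
lemma ap_inv_ap (h : ↥HomeoPos) (x : S1) : ap h⁻¹ (ap h x) = x := by
  rw [← ap_mul]; simp [ap_one]
lemma ap_ap_inv (h : ↥HomeoPos) (x : S1) : ap h (ap h⁻¹ x) = x := by
  rw [← ap_mul]; simp [ap_one]
lemma ap_inj (h : ↥HomeoPos) {x y : S1} (hxy : ap h x = ap h y) : x = y := by
  rw [← ap_inv_ap h x, hxy, ap_inv_ap]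

lemma ap_th_lt (h : ↥HomeoPos) (b x y : S1) :
    th (ap h b) (ap h x) < th (ap h b) (ap h y) ↔ th b x < th b y := by
  by_cases hx : x = b
  · subst hx
    rw [th_self, th_self]
    constructor
    · intro hh; apply th_pos; rintro rfl; rw [th_self] at hh; exact lt_irrefl _ hh
    · intro hh; apply th_pos; intro he; rw [ap_inj h he, th_self] at hh; exact lt_irrefl _ hh
  · have k1 := @circOrd_eq_one b x y
    have k2 := @circOrd_eq_one (ap h b) (ap h x) (ap h y)
    rw [ap_circOrd, k1] at k2
    have p1 := th_pos hx
    have p2 : 0 < th (ap h b) (ap h x) := th_pos (fun he => hx (ap_inj h he))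
    tauto

end circle
end PP
end

noncomputable section
set_option linter.unusedSimpArgs false
set_option linter.unusedVariables false
namespace PP
section lexq

lemma lex_embed {K : Type*} [LinearOrder K] [Countable K] (o : K) (ho : ∀ k, o ≤ k) :
    ∃ e : K → ℚ≥0 → ℝ, (∀ k r, 0 ≤ e k r ∧ e k r < 1) ∧ e o 0 = 0 ∧
      (∀ k r k' r', e k r < e k' r' ↔ k < k' ∨ k = k' ∧ r < r') ∧
      ∀ a b : ℝ, 0 ≤ a → a < b → b ≤ 1 → ∃ k r, a < e k r ∧ e k r < b := by
  classical
  let Q := K ×ₗ ℚ≥0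
  have : DenselyOrdered Q := by
    constructor
    intro p q hpq
    rw [Prod.Lex.lt_iff] at hpq
    rcases hpq with h | ⟨h1, h2⟩
    · refine ⟨toLex ((ofLex p).1, (ofLex p).2 + 1), ?_, ?_⟩
      · rw [Prod.Lex.lt_iff]; right; simp
      · rw [Prod.Lex.lt_iff]; left; simpa using h
    · obtain ⟨r, hr1, hr2⟩ := exists_between h2
      refine ⟨toLex ((ofLex p).1, r), ?_, ?_⟩
      · rw [Prod.Lex.lt_iff]; right; simpa using hr1
      · rw [Prod.Lex.lt_iff]; right; exact ⟨h1, hr2⟩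
  have : NoMaxOrder Q := by
    constructor
    intro p
    refine ⟨toLex ((ofLex p).1, (ofLex p).2 + 1), ?_⟩
    rw [Prod.Lex.lt_iff]; right; simp
  have : Countable Q := inferInstanceAs (Countable (K × ℚ≥0))
  let bot : Q := toLex (o, 0)
  have hbot : ∀ q : Q, q = bot ∨ bot < q := by
    intro q
    rcases lt_trichotomy q bot with h | h | h
    · rw [Prod.Lex.lt_iff] at h
      rcases h with h | ⟨_, h⟩
      · exact absurd h (not_lt.2 (ho _))
      · exact absurd h (not_lt.2 (zero_le))
    · exact Or.inl h
    · exact Or.inr h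
  have : Nonempty (Set.Ioi bot) := by
    obtain ⟨q, hq⟩ := exists_gt bot
    exact ⟨⟨q, hq⟩⟩
  have : NoMinOrder (Set.Ioi bot) := by
    constructor
    rintro ⟨q, hq⟩
    obtain ⟨r, h1, h2⟩ := exists_between (Set.mem_Ioi.1 hq)
    exact ⟨⟨r, h1⟩, h2⟩
  have : Nonempty (Set.Ioo (0 : ℚ) 1) := ⟨⟨1/2, by norm_num, by norm_num⟩⟩
  have : NoMinOrder (Set.Ioo (0 : ℚ) 1) := by
    constructor
    rintro ⟨q, hq⟩
    obtain ⟨r, h1, h2⟩ := exists_between hq.1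
    exact ⟨⟨r, h1, h2.trans hq.2⟩, h2⟩
  have : NoMaxOrder (Set.Ioo (0 : ℚ) 1) := by
    constructor
    rintro ⟨q, hq⟩
    obtain ⟨r, h1, h2⟩ := exists_between hq.2
    exact ⟨⟨r, hq.1.trans h1, h2⟩, h1⟩
  obtain ⟨iso⟩ := Order.iso_of_countable_dense (Set.Ioi bot) (Set.Ioo (0 : ℚ) 1)
  let E : Q → ℝ := fun q => if h : bot < q then (((iso ⟨q, h⟩ : Set.Ioo (0:ℚ) 1) : ℚ) : ℝ) else 0
  have E0 : E bot = 0 := dif_neg (lt_irrefl bot)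
  have E1 : ∀ q (h : bot < q), E q = (((iso ⟨q, h⟩ : Set.Ioo (0:ℚ) 1) : ℚ) : ℝ) := by
    intro q h; simp [E, h]
  have Epos : ∀ q, bot < q → 0 < E q ∧ E q < 1 := by
    intro q h
    rw [E1 q h]
    have := (iso ⟨q, h⟩).2
    exact ⟨by exact_mod_cast this.1, by exact_mod_cast this.2⟩
  have Elt : ∀ p q, E p < E q ↔ p < q := by
    intro p q
    rcases hbot p with rfl | hp <;> rcases hbot q with rfl | hq
    · exact ⟨fun h => absurd h (lt_irrefl _), fun h => absurd h (lt_irrefl _)⟩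
    · rw [E0]; exact ⟨fun _ => hq, fun _ => (Epos q hq).1⟩
    · rw [E0]
      exact ⟨fun h => absurd h (not_lt.2 (Epos p hp).1.le), fun h => absurd h (not_lt.2 hp.le)⟩
    · rw [E1 p hp, E1 q hq, Rat.cast_lt, Subtype.coe_lt_coe, iso.lt_iff_lt]; rfl
  refine ⟨fun k r => E (toLex (k, r)), ?_, E0, ?_, ?_⟩
  · intro k r
    rcases hbot (toLex (k, r)) with h | h
    · simp [h, E0]
    · exact ⟨(Epos _ h).1.le, (Epos _ h).2⟩
  · intro k r k' r'
    rw [Elt, Prod.Lex.lt_iff]; rfl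
  · intro a b ha hab hb
    obtain ⟨q, h1, h2⟩ := exists_rat_btwn hab
    have hq : q ∈ Set.Ioo (0:ℚ) 1 :=
      ⟨by exact_mod_cast ha.trans_lt h1, by exact_mod_cast h2.trans_le hb⟩
    obtain ⟨⟨p, hp⟩, hpq⟩ := iso.surjective ⟨q, hq⟩
    refine ⟨(ofLex p).1, (ofLex p).2, ?_⟩
    have : E (toLex ((ofLex p).1, (ofLex p).2)) = q := by
      show E p = q
      rw [E1 p hp, hpq]
    exact ⟨h1.trans_eq this.symm, this.trans_lt h2⟩

end lexq

section ext
variable {Q : Type*}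

structure DenseFn (t : Q → ℝ) : Prop where
  nn : ∀ p, 0 ≤ t p
  lt : ∀ p, t p < 1
  dense : ∀ a b : ℝ, 0 ≤ a → a < b → b ≤ 1 → ∃ p, a < t p ∧ t p < b

def HH (t e : Q → ℝ) (τ : ℝ) : ℝ := sSup {η | ∃ p, t p ≤ τ ∧ e p = η}

variable {t e : Q → ℝ}

lemma HH_spec (ht : DenseFn t) (he : DenseFn e) (hte : ∀ p q, t p < t q ↔ e p < e q)
    (p0 : Q) (h1 : t p0 = 0) (h2 : e p0 = 0) {τ : ℝ} (hτ0 : 0 ≤ τ) (hτ1 : τ < 1) :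
    0 ≤ HH t e τ ∧ HH t e τ < 1 ∧ ∀ p, t p ≤ τ ↔ e p ≤ HH t e τ := by
  have bdd : BddAbove {η | ∃ p, t p ≤ τ ∧ e p = η} := ⟨1, by
    rintro _ ⟨p, _, rfl⟩; exact (he.lt p).le⟩
  have mem0 : (0 : ℝ) ∈ {η | ∃ p, t p ≤ τ ∧ e p = η} := ⟨p0, by rw [h1]; exact hτ0, h2⟩
  have up : ∀ p, τ < t p → HH t e τ ≤ e p := by
    intro p hp
    apply csSup_le ⟨0, mem0⟩
    rintro _ ⟨q, hq, rfl⟩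
    exact ((hte q p).1 (hq.trans_lt hp)).le
  refine ⟨le_csSup bdd mem0, ?_, ?_⟩
  · obtain ⟨p, hp, _⟩ := ht.dense τ 1 hτ0 hτ1 le_rfl
    exact (up p hp).trans_lt (he.lt p)
  · intro p
    constructor
    · intro h; exact le_csSup bdd ⟨p, h, rfl⟩
    · intro h
      by_contra hcon
      push Not at hcon
      obtain ⟨q, hq1, hq2⟩ := ht.dense τ (t p) hτ0 hcon (ht.lt p).le
      have a1 := up q hq1
      have a2 := (hte q p).1 hq2
      linarith

lemma dense_eq (he : DenseFn e) {a b : ℝ} (ha0 : 0 ≤ a) (ha : a < 1) (hb0 : 0 ≤ b) (hb : b < 1)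
    (h : ∀ p, e p ≤ a ↔ e p ≤ b) : a = b := by
  rcases lt_trichotomy a b with hl | hl | hl
  · obtain ⟨p, h1, h2⟩ := he.dense a b ha0 hl hb.le
    exact absurd ((h p).2 h2.le) (not_le.2 h1)
  · exact hl
  · obtain ⟨p, h1, h2⟩ := he.dense b a hb0 hl ha.le
    exact absurd ((h p).1 h2.le) (not_le.2 h1)

lemma exists_homeo (ht : DenseFn t) (he : DenseFn e) (hte : ∀ p q, t p < t q ↔ e p < e q)
    (p0 : Q) (h1 : t p0 = 0) (h2 : e p0 = 0) (b b' : S1) :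
    ∃ h : ↥HomeoPos, ∀ p, ap h (pt b (t p)) = pt b' (e p) := by
  have S := fun {τ : ℝ} => @HH_spec Q t e ht he hte p0 h1 h2 τ
  have S' := fun {τ : ℝ} => @HH_spec Q e t he ht (fun p q => (hte p q).symm) p0 h2 h1 τ
  have inv1 : ∀ τ, 0 ≤ τ → τ < 1 → HH e t (HH t e τ) = τ := by
    intro τ h0 h1
    obtain ⟨a1, a2, a3⟩ := S h0 h1
    obtain ⟨b1, b2, b3⟩ := S' a1 a2
    exact dense_eq ht b1 b2 h0 h1 (fun p => by rw [← b3, a3])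
  have inv2 : ∀ τ, 0 ≤ τ → τ < 1 → HH t e (HH e t τ) = τ := by
    intro τ h0 h1
    obtain ⟨a1, a2, a3⟩ := S' h0 h1
    obtain ⟨b1, b2, b3⟩ := S a1 a2
    exact dense_eq he b1 b2 h0 h1 (fun p => by rw [← b3, a3])
  have mono : ∀ τ τ', 0 ≤ τ → τ < τ' → τ' < 1 → HH t e τ < HH t e τ' := by
    intro τ τ' h0 hl h1
    obtain ⟨a1, a2, a3⟩ := S h0 (hl.trans h1)
    obtain ⟨b1, b2, b3⟩ := S (h0.trans hl.le) h1
    obtain ⟨p, p1, p2⟩ := ht.dense τ τ' h0 hl h1.le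
    have := mt (a3 p).2 (not_le.2 p1)
    have := (b3 p).1 p2.le
    linarith
  have sgH : ∀ x y : S1, sg (HH t e (th b x)) (HH t e (th b y)) = sg (th b x) (th b y) := by
    intro x y
    rcases lt_trichotomy (th b x) (th b y) with h | h | h
    · rw [sg_pos h, sg_pos (mono _ _ (th_nonneg _ _) h (th_lt _ _))]
    · rw [h, sg_self, sg_self]
    · rw [sg_neg h, sg_neg (mono _ _ (th_nonneg _ _) h (th_lt _ _))]
  let f : Equiv.Perm S1 :=
    { toFun := fun x => pt b' (HH t e (th b x))
      invFun := fun y => pt b (HH e t (th b' y))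
      left_inv := by
        intro x
        obtain ⟨a1, a2, a3⟩ := S (th_nonneg b x) (th_lt b x)
        simp only
        rw [th_pt b' a1 a2, inv1 _ (th_nonneg b x) (th_lt b x), pt_th]
      right_inv := by
        intro x
        obtain ⟨a1, a2, a3⟩ := S' (th_nonneg b' x) (th_lt b' x)
        simp only
        rw [th_pt b a1 a2, inv2 _ (th_nonneg b' x) (th_lt b' x), pt_th] }
  have hf : ∀ x, th b' (f x) = HH t e (th b x) := by
    intro x
    obtain ⟨a1, a2, a3⟩ := S (th_nonneg b x) (th_lt b x)
    exact th_pt b' a1 a2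
  refine ⟨mkHP f ?_, ?_⟩
  · intro x y z
    rw [circOrd_th b', hf, hf, hf, circOrd_th b]
    unfold cyc
    rw [sgH, sgH, sgH]
  · intro p
    show pt b' (HH t e (th b (pt b (t p)))) = _
    rw [th_pt b (ht.nn p) (ht.lt p)]
    obtain ⟨a1, a2, a3⟩ := S (ht.nn p) (ht.lt p)
    congr 1
    apply dense_eq he a1 a2 (he.nn p) (he.lt p)
    intro q
    rw [← a3, ← not_lt, ← not_lt, hte]

end ext
end PP
end

noncomputable section
set_option linter.unusedSimpArgs false
set_option linter.unusedVariables false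
namespace PP
section wgp
variable {n : ℕ}

def ph (ρ : Fr n →* ↥HomeoPos) (x0 : S1) (g : Fr n) : ℝ := th x0 (ap (ρ g) x0)

variable {ρ : Fr n →* ↥HomeoPos} {x0 : S1} {c : Fr n → Fr n → Fr n → ℤ}

lemma ph_one : ph ρ x0 1 = 0 := by
  unfold ph; rw [map_one, ap_one, th_self]
lemma ph_nonneg (g : Fr n) : 0 ≤ ph ρ x0 g := th_nonneg _ _
lemma ph_lt (g : Fr n) : ph ρ x0 g < 1 := th_lt _ _
lemma pt_ph (g : Fr n) : pt x0 (ph ρ x0 g) = ap (ρ g) x0 := pt_th _ _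

lemma orb_inj (h : TrivialStabilizer ρ x0) {g g' : Fr n} (e : ap (ρ g) x0 = ap (ρ g') x0) : g = g' := by
  have := h (g'⁻¹ * g) (by rw [map_mul, ap_mul, e, map_inv, ap_inv_ap])
  exact (inv_mul_eq_one.1 this).symm

lemma ph_inj (h : TrivialStabilizer ρ x0) {g g' : Fr n} (e : ph ρ x0 g = ph ρ x0 g') : g = g' :=
  orb_inj h (th_inj e)

lemma ph_pos (h : TrivialStabilizer ρ x0) {g : Fr n} (hg : g ≠ 1) : 0 < ph ρ x0 g :=
  th_pos (fun e => hg (h g e))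

lemma c_iff (h2 : ∀ g₁ g₂ g₃, inducedCO ρ x0 g₁ g₂ g₃ = c g₁ g₂ g₃) (a b : Fr n) :
    c 1 a b = 1 ↔ 0 < ph ρ x0 a ∧ ph ρ x0 a < ph ρ x0 b := by
  rw [← h2]; unfold inducedCO; rw [map_one, ap_one, circOrd_eq_one]; rfl

lemma c_cyc (h2 : ∀ g₁ g₂ g₃, inducedCO ρ x0 g₁ g₂ g₃ = c g₁ g₂ g₃) (a b d : Fr n) :
    c a b d = cyc (ph ρ x0 a) (ph ρ x0 b) (ph ρ x0 d) := by
  rw [← h2]; unfold inducedCO; rw [circOrd_th x0]; rfl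

structure Blow (c : Fr n → Fr n → Fr n → ℤ) (φ : Fr n → ℝ) (e : Fr n → ℚ≥0 → ℝ) : Prop where
  rng : ∀ k r, 0 ≤ e k r ∧ e k r < 1
  zero : e 1 0 = 0
  lt : ∀ k r k' r', e k r < e k' r' ↔ φ k < φ k' ∨ k = k' ∧ r < r'
  dense : ∀ a b : ℝ, 0 ≤ a → a < b → b ≤ 1 → ∃ k r, a < e k r ∧ e k r < b
  cyc : ∀ a b d, c a b d = cyc (φ a) (φ b) (φ d)
  inj : ∀ a b, φ a = φ b → a = b

lemma exists_blow (h : TrivialStabilizer ρ x0)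
    (h2 : ∀ g₁ g₂ g₃, inducedCO ρ x0 g₁ g₂ g₃ = c g₁ g₂ g₃) :
    ∃ e, Blow c (ph ρ x0) e := by
  let _ : LinearOrder (Fr n) := LinearOrder.lift' (ph ρ x0) (fun a b e => ph_inj h e)
  have hc : Countable (Fr n) := Quot.mk_surjective.countable
  obtain ⟨e, e1, e2, e3, e4⟩ := lex_embed (1 : Fr n) (fun k => by
    show ph ρ x0 1 ≤ ph ρ x0 k
    rw [ph_one]; exact ph_nonneg _)
  exact ⟨e, e1, e2, e3, e4, c_cyc h2, fun a b e => ph_inj h e⟩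

variable {φ : Fr n → ℝ} {e : Fr n → ℚ≥0 → ℝ}

lemma Blow.sg_same (B : Blow c φ e) (a : Fr n) (r s : ℚ≥0) (b : Fr n) :
    sg (e a r) (e a s) = sg (e b r) (e b s) := by
  unfold sg
  simp only [B.lt]
  simp

lemma Blow.sg_diff (B : Blow c φ e) {a b : Fr n} (h : a ≠ b) (r s : ℚ≥0) :
    sg (e a r) (e b s) = sg (φ a) (φ b) := by
  unfold sg
  simp only [B.lt]
  simp [h, h.symm]

lemma Blow.cyc_inv (B : Blow c φ e) (hc : IsCircularOrder c) (k a b d : Fr n) (r s t : ℚ≥0) :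
    PP.cyc (e (k*a) r) (e (k*b) s) (e (k*d) t) = PP.cyc (e a r) (e b s) (e d t) := by
  have hk : ∀ {x y : Fr n}, x ≠ y → k * x ≠ k * y := fun h h' => h (mul_left_cancel h')
  by_cases h1 : a = b
  · subst h1
    by_cases h2 : a = d
    · subst h2
      unfold PP.cyc
      rw [B.sg_same (k*a) r s a, B.sg_same (k*a) s t a, B.sg_same (k*a) t r a]
    · unfold PP.cyc
      rw [B.sg_same (k*a) r s a, B.sg_diff (hk h2), B.sg_diff (hk (Ne.symm h2)), B.sg_diff h2,
        B.sg_diff (Ne.symm h2), sg_anti (φ (k*a)), sg_anti (φ a)]; ring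
  by_cases h2 : b = d
  · subst h2
    unfold PP.cyc
    rw [B.sg_same (k*b) s t b, B.sg_diff (hk h1), B.sg_diff (hk (Ne.symm h1)), B.sg_diff h1,
        B.sg_diff (Ne.symm h1), sg_anti (φ (k*a)), sg_anti (φ a)]; ring
  by_cases h3 : a = d
  · subst h3
    unfold PP.cyc
    rw [B.sg_same (k*a) t r a, B.sg_diff (hk h1), B.sg_diff (hk (Ne.symm h1)), B.sg_diff h1,
        B.sg_diff (Ne.symm h1), sg_anti (φ (k*a)), sg_anti (φ a)]; ring
  have := hc.2.2.2 k a b d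
  rw [B.cyc, B.cyc] at this
  unfold PP.cyc at this ⊢
  rw [B.sg_diff (hk h1), B.sg_diff (hk h2), B.sg_diff (hk (Ne.symm h3)), B.sg_diff h1, B.sg_diff h2,
    B.sg_diff (Ne.symm h3), this]

lemma Blow.circ (B : Blow c φ e) (x0 : S1) (a b d : Fr n) (r s t : ℚ≥0) :
    circOrd (pt x0 (e a r)) (pt x0 (e b s)) (pt x0 (e d t)) = PP.cyc (e a r) (e b s) (e d t) := by
  rw [circOrd_th x0, th_pt _ (B.rng _ _).1 (B.rng _ _).2, th_pt _ (B.rng _ _).1 (B.rng _ _).2,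
    th_pt _ (B.rng _ _).1 (B.rng _ _).2]

lemma Blow.inj2 (B : Blow c φ e) {a b : Fr n} {r s : ℚ≥0} (h : e a r = e b s) : a = b ∧ r = s := by
  have h1 := (B.lt a r b s).not.1 (by rw [h]; exact lt_irrefl _)
  have h2 := (B.lt b s a r).not.1 (by rw [h]; exact lt_irrefl _)
  push Not at h1 h2
  have : a = b := B.inj _ _ (le_antisymm h2.1 h1.1)
  exact ⟨this, le_antisymm (h2.2 this.symm) (h1.2 this)⟩

lemma Blow.pt_inj (B : Blow c φ e) {a b : Fr n} {r s : ℚ≥0}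
    (h : pt x0 (e a r) = pt x0 (e b s)) : a = b ∧ r = s := by
  apply B.inj2
  rw [← th_pt x0 (B.rng a r).1 (B.rng a r).2, h, th_pt x0 (B.rng _ _).1 (B.rng _ _).2]

lemma Blow.dense_pt (B : Blow c φ e) {x : S1} {U : Set S1} (hU : IsOpen U) (hx : x ∈ U) :
    ∃ k r, pt x0 (e k r) ∈ U := by
  have : pt x0 ⁻¹' U ∈ nhds (th x0 x) :=
    (hU.preimage (continuous_pt x0)).mem_nhds (by show pt x0 _ ∈ U; rwa [pt_th])
  obtain ⟨ε, hε, hb⟩ := Metric.mem_nhds_iff.1 this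
  obtain ⟨k, r, h1, h2⟩ := B.dense (th x0 x) (min 1 (th x0 x + ε)) (th_nonneg _ _)
    (lt_min (th_lt _ _) (by linarith)) (min_le_left _ _)
  refine ⟨k, r, hb ?_⟩
  have := h2.trans_le (min_le_right _ _)
  rw [Metric.mem_ball, Real.dist_eq, abs_lt]
  constructor <;> linarith

lemma Blow.homeo (B : Blow c φ e) (hc : IsCircularOrder c) (x0 : S1) (k : Fr n) :
    ∃ h : ↥HomeoPos, ∀ a r, ap h (pt x0 (e a r)) = pt x0 (e (k*a) r) := by
  set b := pt x0 (e k⁻¹ 0) with hb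
  have := exists_homeo (Q := Fr n × ℚ≥0) (t := fun p => th b (pt x0 (e p.1 p.2)))
    (e := fun p => e (k * p.1) p.2) ?_ ?_ ?_ (k⁻¹, 0) (th_self _) (by simp [B.zero]) b x0
  · obtain ⟨h, hh⟩ := this
    refine ⟨h, fun a r => ?_⟩
    have := hh (a, r)
    simpa only [pt_th] using this
  · refine ⟨fun p => th_nonneg _ _, fun p => th_lt _ _, ?_⟩
    intro u v hu huv hv
    obtain ⟨k, r, w, hw, he⟩ := B.dense_pt (x0 := x0) (x := pt b ((u+v)/2)) (U := pt b '' Set.Ioo u v)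
      (isOpenMap_pt b _ isOpen_Ioo) ⟨_, ⟨by linarith, by linarith⟩, rfl⟩
    refine ⟨(k, r), ?_⟩
    simp only [← he]
    rw [th_pt b (hu.trans hw.1.le) (hw.2.trans_le hv)]
    exact hw
  · refine ⟨fun p => (B.rng _ _).1, fun p => (B.rng _ _).2, ?_⟩
    intro u v hu huv hv
    obtain ⟨g, r, h1⟩ := B.dense u v hu huv hv
    exact ⟨(k⁻¹ * g, r), by simpa using h1⟩
  · rintro ⟨a, r⟩ ⟨d, s⟩
    simp only
    have z : e (k * k⁻¹) 0 = 0 := by simp [B.zero]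
    have k0 := B.cyc_inv hc k k⁻¹ a d 0 r s
    rw [← B.circ x0, ← B.circ x0, z, pt_zero] at k0
    have k1 := @circOrd_eq_one b (pt x0 (e a r)) (pt x0 (e d s))
    have k2 := @circOrd_eq_one x0 (pt x0 (e (k*a) r)) (pt x0 (e (k*d) s))
    rw [k0, k1, th_pt _ (B.rng _ _).1 (B.rng _ _).2, th_pt _ (B.rng _ _).1 (B.rng _ _).2] at k2
    by_cases hp : a = k⁻¹ ∧ r = 0
    · obtain ⟨rfl, rfl⟩ := hp
      rw [z, ← hb, th_self]
      by_cases hq : d = k⁻¹ ∧ s = 0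
      · obtain ⟨rfl, rfl⟩ := hq
        rw [z, ← hb, th_self]
      · have q1 : 0 < th b (pt x0 (e d s)) := th_pos (fun h => hq (B.pt_inj h))
        have q2 : 0 < e (k*d) s := lt_of_le_of_ne (B.rng _ _).1 (fun h => hq (by
          rw [← z] at h
          obtain ⟨h1, h2⟩ := B.inj2 h
          exact ⟨(mul_left_cancel h1).symm, h2.symm⟩))
        tauto
    · have q1 : 0 < th b (pt x0 (e a r)) := th_pos (fun h => hp (B.pt_inj h))
      have q2 : 0 < e (k*a) r := lt_of_le_of_ne (B.rng _ _).1 (fun h => hp (by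
          rw [← z] at h
          obtain ⟨h1, h2⟩ := B.inj2 h
          exact ⟨(mul_left_cancel h1).symm, h2.symm⟩))
      tauto

lemma Blow.action (B : Blow c φ e) (hc : IsCircularOrder c) (x0 : S1) :
    ∃ ρ' : Fr n →* ↥HomeoPos, ∀ g a r, ap (ρ' g) (pt x0 (e a r)) = pt x0 (e (g*a) r) := by
  choose H hH using B.homeo hc x0
  refine ⟨FreeGroup.lift (fun i => H (FreeGroup.of i)), ?_⟩
  intro g
  induction g using FreeGroup.induction_on with
  | C1 => intro a r; rw [map_one, ap_one, one_mul]
  | of i => intro a r; rw [FreeGroup.lift_apply_of, hH]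
  | inv_of i ih =>
    intro a r
    apply ap_inj (FreeGroup.lift (fun i => H (FreeGroup.of i)) (FreeGroup.of i))
    rw [map_inv, ap_ap_inv]
    have := ih ((FreeGroup.of i)⁻¹ * a) r
    rw [this, mul_inv_cancel_left]
  | mul x y hx hy => intro a r; rw [map_mul, ap_mul, hy, hx, mul_assoc]

lemma blowup (hc : IsCircularOrder c) (hρ : IsDynamicalRealization ρ x0 c) :
    ∃ e : Fr n → ℚ≥0 → ℝ, Blow c (ph ρ x0) e ∧ ∃ f : S1 → S1, Continuous f ∧
      ∀ g, f (pt x0 (e g 0)) = ap (ρ g) x0 := by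
  obtain ⟨h1, h2, h3⟩ := hρ
  obtain ⟨e, B⟩ := exists_blow h1 h2
  obtain ⟨ρ', hρ'⟩ := B.action hc x0
  have e0 : pt x0 (e 1 0) = x0 := by rw [B.zero, pt_zero]
  have orb : ∀ g, ap (ρ' g) x0 = pt x0 (e g 0) := by
    intro g
    have := hρ' g 1 0
    rwa [e0, mul_one] at this
  have t1 : TrivialStabilizer ρ' x0 := by
    intro g hg
    rw [orb] at hg
    nth_rw 2 [← e0] at hg
    exact (B.pt_inj hg).1
  have t2 : ∀ g₁ g₂ g₃, inducedCO ρ' x0 g₁ g₂ g₃ = c g₁ g₂ g₃ := by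
    intro a b d
    unfold inducedCO
    rw [orb, orb, orb, B.circ, B.cyc]
    have : ∀ a b, sg (e a 0) (e b 0) = sg (ph ρ x0 a) (ph ρ x0 b) := by
      intro a b
      by_cases hab : a = b
      · subst hab; rw [sg_self, sg_self]
      · exact B.sg_diff hab 0 0
    unfold PP.cyc; rw [this, this, this]
  obtain ⟨f, ⟨f1, _, _⟩, f2, f3⟩ := h3 ρ' t1 t2
  refine ⟨e, B, f, f1, fun g => ?_⟩
  have := congrFun (f3 g) x0
  simp only [Function.comp] at this
  rw [← orb, ← this, f2]

lemma Blow.lt0 (B : Blow c φ e) {a b : Fr n} : e a 0 < e b 0 ↔ φ a < φ b := by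
  rw [B.lt]; simp

/-- No wandering gap property -/
lemma wgp (hc : IsCircularOrder c) (hρ : IsDynamicalRealization ρ x0 c) {y z : ℝ} (hyz : y < z)
    (hno : ∀ g, ¬ (y ≤ ph ρ x0 g ∧ ph ρ x0 g ≤ z))
    (hl : ∀ ε > 0, ∃ g, y - ε < ph ρ x0 g ∧ ph ρ x0 g < y)
    (hr : ∀ ε > 0, ∃ g, z < ph ρ x0 g ∧ ph ρ x0 g < z + ε) : False := by
  obtain ⟨e, B, f, hf, hfe⟩ := blowup hc hρ
  obtain ⟨gl, hl1, hl2⟩ := hl 1 one_pos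
  obtain ⟨g1, hg1, hg1'⟩ := hr 1 one_pos
  have hy : 0 < y := (ph_nonneg gl).trans_lt hl2
  have hz : z < 1 := hg1.trans (ph_lt _)
  obtain ⟨g0, hg0, hg0'⟩ := hl y hy
  rw [sub_self] at hg0
  set T := {t | ∃ g, ph ρ x0 g < y ∧ e g 0 = t} with hT
  have Tne : T.Nonempty := ⟨_, g0, hg0', rfl⟩
  have Tup : ∀ g, z < ph ρ x0 g → ∀ t ∈ T, t < e g 0 := by
    rintro g hg _ ⟨g', h', rfl⟩
    rw [B.lt0]; linarith
  have Tb : BddAbove T := ⟨e g1 0, fun t ht => (Tup g1 hg1 t ht).le⟩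
  set τ := sSup T with hτ
  have ub : ∀ g, z < ph ρ x0 g → τ ≤ e g 0 := fun g hg => csSup_le Tne (fun t ht => (Tup g hg t ht).le)
  have lb : ∀ g, ph ρ x0 g < y → e g 0 ≤ τ := fun g hg => le_csSup Tb ⟨g, hg, rfl⟩
  have cl : ∀ u v : ℝ, IsClosed (pt x0 '' Set.Icc u v) := fun u v =>
    (isCompact_Icc.image (continuous_pt x0)).isClosed
  have hF : Continuous (fun r => f (pt x0 r)) := hf.comp (continuous_pt x0)
  -- left
  have m1 : f (pt x0 τ) ∈ pt x0 '' Set.Icc (ph ρ x0 g0) y := by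
    have hc1 : τ ∈ closure {t | ∃ g, (ph ρ x0 g < y ∧ ph ρ x0 g0 ≤ ph ρ x0 g) ∧ e g 0 = t} := by
      rw [Metric.mem_closure_iff]
      intro ε hε
      obtain ⟨t, ⟨g, hg, rfl⟩, ht⟩ := exists_lt_of_lt_csSup Tne (show τ - ε < sSup T by linarith)
      rcases le_total (ph ρ x0 g0) (ph ρ x0 g) with h | h
      · refine ⟨_, ⟨g, ⟨hg, h⟩, rfl⟩, ?_⟩
        have := lb g hg
        rw [Real.dist_eq, abs_lt]; constructor <;> linarith
      · refine ⟨_, ⟨g0, ⟨hg0', le_rfl⟩, rfl⟩, ?_⟩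
        have := lb g0 hg0'
        have : ¬ (e g0 0 < e g 0) := by rw [B.lt0]; exact not_lt.2 h
        rw [Real.dist_eq, abs_lt]; constructor <;> linarith
    refine closure_minimal ?_ ((cl _ _).preimage hF) hc1
    rintro _ ⟨g, hg, rfl⟩
    exact ⟨ph ρ x0 g, ⟨hg.2, hg.1.le⟩, by rw [pt_ph]; exact (hfe g).symm⟩
  have m2 : f (pt x0 τ) ∈ pt x0 '' Set.Icc z (ph ρ x0 g1) := by
    have hc1 : τ ∈ closure {t | ∃ g, (z < ph ρ x0 g ∧ ph ρ x0 g ≤ ph ρ x0 g1) ∧ e g 0 = t} := by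
      rw [Metric.mem_closure_iff]
      intro ε hε
      have t0 : 0 ≤ τ := (B.rng g0 0).1.trans (lb g0 hg0')
      obtain ⟨g, r, h1, h2⟩ := B.dense τ (min (τ + ε) 1) t0
        (lt_min (by linarith) ((ub g1 hg1).trans_lt (B.rng _ _).2)) (min_le_right _ _)
      have h3 := h2.trans_le (min_le_left _ _)
      have hgz : z < ph ρ x0 g := by
        by_contra hcon
        have : ph ρ x0 g < y := by
          by_contra h'
          exact hno g ⟨not_lt.1 h', not_lt.1 hcon⟩
        obtain ⟨g', ha, hb⟩ := hl (y - ph ρ x0 g) (by linarith)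
        have hlt : e g r < e g' 0 := by rw [B.lt]; left; linarith
        have := lb g' hb
        linarith
      have e0 : e g 0 ≤ e g r := by
        by_contra hcon
        rw [not_le, B.lt] at hcon
        rcases hcon with h | h
        · exact lt_irrefl _ h
        · exact absurd h.2 (not_lt.2 (zero_le))
      have e1 := ub g hgz
      rcases le_total (ph ρ x0 g) (ph ρ x0 g1) with h | h
      · refine ⟨_, ⟨g, ⟨hgz, h⟩, rfl⟩, ?_⟩
        rw [Real.dist_eq, abs_lt]; constructor <;> linarith
      · refine ⟨_, ⟨g1, ⟨hg1, le_rfl⟩, rfl⟩, ?_⟩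
        have := ub g1 hg1
        have : ¬ (e g 0 < e g1 0) := by rw [B.lt0]; exact not_lt.2 h
        rw [Real.dist_eq, abs_lt]; constructor <;> linarith
    refine closure_minimal ?_ ((cl _ _).preimage hF) hc1
    rintro _ ⟨g, hg, rfl⟩
    exact ⟨ph ρ x0 g, ⟨hg.1.le, hg.2⟩, by rw [pt_ph]; exact (hfe g).symm⟩
  obtain ⟨u, hu, hu'⟩ := m1
  obtain ⟨v, hv, hv'⟩ := m2
  have a1 : th x0 (pt x0 u) = u := th_pt _ (hg0.le.trans hu.1) (by linarith [hu.2])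
  have a2 : th x0 (pt x0 v) = v := th_pt _ (by linarith [hv.1]) (hv.2.trans_lt (ph_lt _))
  rw [hu', ← hv', a2] at a1
  linarith [hu.2, hv.1]

end wgp
end PP
end

noncomputable section
set_option linter.unusedSimpArgs false
set_option linter.unusedVariables false
namespace PP
section pp1
variable {n : ℕ} {ρ : Fr n →* ↥HomeoPos} {x0 : S1} {c : Fr n → Fr n → Fr n → ℤ}

lemma orb_in_D {D : Fin n × Bool → Set S1}
    (hdis : Pairwise fun s t => Disjoint (D s) (D t))
    (hpp : ∀ s, (ap (ρ (freeGen s))) '' (Set.univ \ D (linv s)) ⊆ D s)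
    (hx0 : ∀ s, x0 ∉ D s) (g : Fr n) : ∀ s, hd g = some s → ap (ρ g) x0 ∈ D s := by
  induction g using fr_induction with
  | h1 => intro s hs; rw [hd_one] at hs; cases hs
  | hs s g hg ih =>
    intro t ht
    rw [hd_gen_mul hg] at ht
    cases ht
    rw [map_mul, ap_mul]
    apply hpp s
    refine ⟨_, ⟨trivial, ?_⟩, rfl⟩
    cases hgd : hd g with
    | none =>
      rw [hd_eq_none.1 hgd, map_one, ap_one]; exact hx0 _
    | some t =>
      intro hmem
      have hne : t ≠ linv s := by rintro rfl; exact hg hgd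
      exact Set.disjoint_left.1 (hdis hne) (ih t hgd) hmem

lemma sep_D {D : Fin n × Bool → Set S1} (hcl : ∀ s, IsClosed (D s))
    (hdis : Pairwise fun s t => Disjoint (D s) (D t)) (x0 : S1) :
    ∃ δ > 0, ∀ s t, s ≠ t → ∀ x ∈ D s, ∀ y ∈ D t, δ ≤ |th x0 x - th x0 y| := by
  have key : ∀ s t, ∃ r : ℝ, 0 < r ∧ (s ≠ t → ∀ x ∈ D s, ∀ y ∈ D t, r ≤ |th x0 x - th x0 y|) := by
    intro s t
    by_cases hst : s = t
    · exact ⟨1, one_pos, fun h => absurd hst h⟩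
    have hK : ∀ s, IsClosed (pt x0 ⁻¹' (D s)) := fun s => (hcl s).preimage (continuous_pt x0)
    obtain ⟨r, hr, h⟩ := _root_.Metric.exists_pos_forall_lt_edist
      (s := Set.Icc (0:ℝ) 1 ∩ pt x0 ⁻¹' (D s)) (t := pt x0 ⁻¹' (D t))
      (isCompact_Icc.inter_right (hK s)) (hK t)
      (by
        rw [Set.disjoint_left]
        rintro w ⟨_, h1⟩ h2
        exact Set.disjoint_left.1 (hdis hst) h1 h2)
    refine ⟨r, by exact_mod_cast hr, fun _ x hx y hy => ?_⟩
    have := h (th x0 x) ⟨⟨th_nonneg _ _, (th_lt _ _).le⟩, by show pt x0 (th x0 x) ∈ D s; rwa [pt_th]⟩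
      (th x0 y) (by show pt x0 (th x0 y) ∈ D t; rwa [pt_th])
    rw [edist_nndist] at this
    have h3 : r < nndist (th x0 x) (th x0 y) := by exact_mod_cast this
    have h4 : (r : ℝ) < dist (th x0 x) (th x0 y) := by
      rw [← coe_nndist]; exact_mod_cast h3
    exact h4.le
  choose r hr0 hr using key
  have : ∀ᶠ δ in nhdsWithin (0:ℝ) (Set.Ioi 0), ∀ s t, δ < r s t := by
    rw [Filter.eventually_all]; intro s
    rw [Filter.eventually_all]; intro t
    exact nhdsWithin_le_nhds (gt_mem_nhds (hr0 s t))
  obtain ⟨δ, h1, h2⟩ := (this.and self_mem_nhdsWithin).exists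
  exact ⟨δ, h2, fun s t hst x hx y hy => (h1 s t).le.trans (hr s t hst x hx y hy)⟩

lemma sep_finite {α : Type*} (φ : α → ℝ) (h0 : ∀ a, 0 ≤ φ a) (h1 : ∀ a, φ a < 1) {δ : ℝ} (hδ : 0 < δ)
    (A : Set α) (hA : ∀ a ∈ A, ∀ b ∈ A, a ≠ b → δ ≤ |φ a - φ b|) : A.Finite := by
  apply Set.Finite.of_finite_image (f := fun a => ⌊φ a / δ⌋)
  · apply (Set.finite_Icc (0:ℤ) ⌊1/δ⌋).subset
    rintro _ ⟨a, ha, rfl⟩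
    refine ⟨Int.floor_nonneg.2 (div_nonneg (h0 a) hδ.le), Int.floor_le_floor ?_⟩
    gcongr
    exact (h1 a).le
  · intro a ha b hb hab
    by_contra hne
    have := hA a ha b hb hne
    have h3 := Int.abs_sub_lt_one_of_floor_eq_floor hab
    rw [← sub_div, abs_div, abs_of_pos hδ, div_lt_one hδ] at h3
    linarith

lemma pp_star (hc : IsCircularOrder c) (hρ : IsDynamicalRealization ρ x0 c)
    {D : Fin n × Bool → Set S1} (hcl : ∀ s, IsClosed (D s))
    (hdis : Pairwise fun s t => Disjoint (D s) (D t))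
    (hpp : ∀ s, (ap (ρ (freeGen s))) '' (Set.univ \ D (linv s)) ⊆ D s)
    (hx0 : ∀ s, x0 ∉ D s) : Star c := by
  classical
  obtain ⟨δ, hδ, hsep⟩ := sep_D hcl hdis x0
  obtain ⟨t1, t2, t3⟩ := hρ
  have hρ : IsDynamicalRealization ρ x0 c := ⟨t1, t2, t3⟩
  set φ := ph ρ x0 with hφ
  have hsep2 : ∀ g g' s, hd g = some s → hd g' ≠ some s → g' ≠ 1 → δ ≤ |φ g - φ g'| := by
    intro g g' s h1 h2 h3
    cases h4 : hd g' with
    | none => exact absurd (hd_eq_none.1 h4) h3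
    | some t =>
      apply hsep s t
      · rintro rfl; exact h2 h4
      · exact orb_in_D hdis hpp hx0 _ _ h1
      · exact orb_in_D hdis hpp hx0 _ _ h4
  have f1 : {e : Fr n | ∀ g, ¬ (φ e < φ g ∧ φ g < φ e + δ)}.Finite := by
    apply sep_finite φ (fun a => ph_nonneg a) (fun a => ph_lt a) hδ
    intro a ha b hb hab
    rcases lt_or_gt_of_ne (fun h => hab (ph_inj t1 h) : φ a ≠ φ b) with h | h
    · rw [abs_of_neg (by linarith)]
      by_contra hcon
      exact ha b ⟨h, by linarith⟩
    · rw [abs_of_pos (by linarith)]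
      by_contra hcon
      exact hb a ⟨h, by linarith⟩
  have f2 : {e : Fr n | ∀ g, ¬ (φ e - δ < φ g ∧ φ g < φ e)}.Finite := by
    apply sep_finite φ (fun a => ph_nonneg a) (fun a => ph_lt a) hδ
    intro a ha b hb hab
    rcases lt_or_gt_of_ne (fun h => hab (ph_inj t1 h) : φ a ≠ φ b) with h | h
    · rw [abs_of_neg (by linarith)]
      by_contra hcon
      exact hb a ⟨by linarith, h⟩
    · rw [abs_of_pos (by linarith)]
      by_contra hcon
      exact ha b ⟨by linarith, h⟩
  refine ⟨f1.toFinset ∪ f2.toFinset, ?_⟩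
  intro u v hu hv huv hcuv
  rw [c_iff t2] at hcuv
  obtain ⟨hu0, huv'⟩ := hcuv
  have le1 : ∀ e, 0 < φ e → φ u ≤ φ e → (u = e ∨ c 1 u e = 1) := by
    intro e _ h
    rcases h.lt_or_eq with h | h
    · right; rw [c_iff t2]; exact ⟨hu0, h⟩
    · left; exact ph_inj t1 h
  have le2 : ∀ e, 0 < φ e → φ e ≤ φ v → (e = v ∨ c 1 e v = 1) := by
    intro e h0 h
    rcases h.lt_or_eq with h | h
    · right; rw [c_iff t2]; exact ⟨h0, h⟩
    · left; exact ph_inj t1 h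
  have ne1 : ∀ e, 0 < φ e → e ≠ 1 := by
    rintro e h rfl
    rw [hφ, ph_one] at h; exact lt_irrefl _ h
  obtain ⟨s, hs⟩ : ∃ s, hd u = some s := by
    cases h : hd u with
    | none => exact absurd (hd_eq_none.1 h) hu
    | some s => exact ⟨s, rfl⟩
  have hvs : hd v ≠ some s := fun h => huv (hs.trans h.symm)
  set Y := {r | ∃ g, (hd g = some s ∧ φ u ≤ φ g ∧ φ g ≤ φ v) ∧ φ g = r} with hY
  have Yu : φ u ∈ Y := ⟨u, ⟨hs, le_rfl, huv'.le⟩, rfl⟩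
  have Yb : ∀ r ∈ Y, r ≤ φ v := by rintro _ ⟨g, hg, rfl⟩; exact hg.2.2
  have Ybdd : BddAbove Y := ⟨_, Yb⟩
  set y := sSup Y with hy
  have yu : φ u ≤ y := le_csSup Ybdd Yu
  have yv : y ≤ φ v := csSup_le ⟨_, Yu⟩ Yb
  set Z := {r | ∃ g, (hd g ≠ some s ∧ y ≤ φ g ∧ φ g ≤ φ v) ∧ φ g = r} with hZ
  have Zv : φ v ∈ Z := ⟨v, ⟨hvs, yv, le_rfl⟩, rfl⟩
  have Zbdd : BddBelow Z := ⟨y, by rintro _ ⟨g, hg, rfl⟩; exact hg.2.1⟩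
  set z := sInf Z with hz
  have zv : z ≤ φ v := csInf_le Zbdd Zv
  have yz : y + δ ≤ z := by
    apply le_csInf ⟨_, Zv⟩
    rintro _ ⟨g', hg', rfl⟩
    have : y ≤ φ g' - δ := by
      apply csSup_le ⟨_, Yu⟩
      rintro _ ⟨g, hg, rfl⟩
      have gy : φ g ≤ y := le_csSup Ybdd ⟨g, hg, rfl⟩
      have := hsep2 g g' s hg.1 hg'.1 (ne1 _ (by linarith [hg'.2.1]))
      rw [abs_of_nonpos (by linarith [hg'.2.1])] at this
      linarith
    linarith
  have hYle : ∀ g, hd g = some s → φ u ≤ φ g → φ g ≤ φ v → φ g ≤ y :=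
    fun g h1 h2 h3 => le_csSup Ybdd ⟨g, ⟨h1, h2, h3⟩, rfl⟩
  have hZge : ∀ g, hd g ≠ some s → y ≤ φ g → φ g ≤ φ v → z ≤ φ g :=
    fun g h1 h2 h3 => csInf_le Zbdd ⟨g, ⟨h1, h2, h3⟩, rfl⟩
  have gap : ∀ g, ¬ (y < φ g ∧ φ g < z) := by
    rintro g ⟨h1, h2⟩
    by_cases h : hd g = some s
    · linarith [hYle g h (by linarith) (by linarith)]
    · linarith [hZge g h h1.le (by linarith)]
  by_cases hay : ∃ g, φ g = y
  · obtain ⟨e, he⟩ := hay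
    refine ⟨e, ?_, ne1 e (by linarith), le1 e (by linarith) (by linarith), le2 e (by linarith) (by linarith)⟩
    rw [Finset.mem_union]; left
    rw [Set.Finite.mem_toFinset]
    rintro g ⟨h1, h2⟩
    exact gap g ⟨by linarith, by linarith⟩
  by_cases haz : ∃ g, φ g = z
  · obtain ⟨e, he⟩ := haz
    refine ⟨e, ?_, ne1 e (by linarith), le1 e (by linarith) (by linarith), le2 e (by linarith) (by linarith)⟩
    rw [Finset.mem_union]; right
    rw [Set.Finite.mem_toFinset]
    rintro g ⟨h1, h2⟩
    exact gap g ⟨by linarith, by linarith⟩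
  push Not at hay haz
  exfalso
  apply wgp hc hρ (y := y) (z := z) (by linarith)
  · rintro g ⟨h1, h2⟩
    exact gap g ⟨lt_of_le_of_ne h1 (Ne.symm (hay g)), lt_of_le_of_ne h2 (haz g)⟩
  · intro ε hε
    obtain ⟨_, ⟨g, hg, rfl⟩, h⟩ := exists_lt_of_lt_csSup ⟨_, Yu⟩ (show y - ε < sSup Y by linarith)
    exact ⟨g, h, lt_of_le_of_ne (hYle g hg.1 hg.2.1 hg.2.2) (hay g)⟩
  · intro ε hε
    obtain ⟨_, ⟨g, hg, rfl⟩, h⟩ := exists_lt_of_csInf_lt ⟨_, Zv⟩ (show sInf Z < z + ε by linarith)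
    exact ⟨g, lt_of_le_of_ne (hZge g hg.1 hg.2.1 hg.2.2) (Ne.symm (haz g)), h⟩

end pp1
end PP
end

noncomputable section
set_option linter.unusedSimpArgs false
set_option linter.unusedVariables false
namespace PP
section comps

lemma sep_pre {x0 : S1} {Q : Set S1} (hQ : IsPreconnected Q) {a b z : S1} (ha : a ∈ Q) (hb : b ∈ Q)
    (h1 : th x0 a ≤ th x0 z) (h2 : th x0 z ≤ th x0 b) : x0 ∈ Q ∨ z ∈ Q := by
  by_cases h : x0 ∈ Q
  · exact Or.inl h
  right
  have hcont : ContinuousOn (th x0) Q := fun x hx =>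
    (th_continuousAt (b := x0) (x := x) (fun e => h (by rwa [e] at hx))).continuousWithinAt
  obtain ⟨w, hw, he⟩ := (hQ.image _ hcont).Icc_subset ⟨a, ha, rfl⟩ ⟨b, hb, rfl⟩ ⟨h1, h2⟩
  rwa [← th_inj he]

def segm (x0 : S1) (r r' : ℝ) : Set S1 := {x | r ≤ th x0 x ∧ th x0 x ≤ r'}

lemma segm_pre (x0 : S1) {r r' : ℝ} (h0 : 0 ≤ r) (h1 : r' < 1) : IsPreconnected (segm x0 r r') := by
  have : segm x0 r r' = pt x0 '' Set.Icc r r' := by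
    ext x
    constructor
    · intro h; exact ⟨th x0 x, h, pt_th _ _⟩
    · rintro ⟨w, hw, rfl⟩
      show r ≤ th x0 (pt x0 w) ∧ th x0 (pt x0 w) ≤ r'
      rw [th_pt x0 (h0.trans hw.1) (hw.2.trans_lt h1)]; exact hw
  rw [this]
  exact isPreconnected_Icc.image _ (continuous_pt x0).continuousOn

/-- points joined to `V` outside `A` -/
def joinD (A V : Set S1) : Set S1 :=
  {x | ∃ u ∈ V, ∃ P : Set S1, IsPreconnected P ∧ (∀ z ∈ P, z ∉ A) ∧ x ∈ P ∧ u ∈ P}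

lemma joinD_notA {A V : Set S1} {x : S1} (h : x ∈ joinD A V) : x ∉ A := by
  obtain ⟨u, hu, P, hP, h1, h2, h3⟩ := h
  exact h1 x h2

lemma joinD_ext {A V : Set S1} {x y : S1} (h : x ∈ joinD A V) {Q : Set S1} (hQ : IsPreconnected Q)
    (hA : ∀ z ∈ Q, z ∉ A) (hx : x ∈ Q) (hy : y ∈ Q) : y ∈ joinD A V := by
  obtain ⟨u, hu, P, hP, h1, h2, h3⟩ := h
  refine ⟨u, hu, P ∪ Q, hP.union x h2 hx hQ, ?_, Or.inr hy, Or.inl h3⟩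
  rintro z (hz | hz)
  · exact h1 z hz
  · exact hA z hz

variable {ι : Type*} {x0 : S1} {A : Set S1} {I : ι → Set S1}

def patt (x0 : S1) (a : ι → S1) (x : S1) : Set ι := {e | th x0 (a e) < th x0 x}

lemma same_patt (hIA : ∀ e, I e ⊆ A) (hA : ∀ x ∈ A, x = x0 ∨ ∃ e, x ∈ I e)
    (hpre : ∀ e, IsPreconnected (I e)) (hx0 : ∀ e, x0 ∉ I e) {a : ι → S1} (ha : ∀ e, a e ∈ I e)
    {x y : S1} (hx : x ∉ A) (hy : y ∉ A) (hp : patt x0 a x = patt x0 a y) :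
    ∀ z ∈ segm x0 (th x0 x) (th x0 y), z ∉ A ∧ patt x0 a z = patt x0 a x := by
  rintro z ⟨h1, h2⟩
  refine ⟨fun hz => ?_, ?_⟩
  · have n1 : th x0 x < th x0 z := lt_of_le_of_ne h1 (fun e => hx (th_inj e ▸ hz))
    have n2 : th x0 z < th x0 y := lt_of_le_of_ne h2 (fun e => hy (th_inj e ▸ hz))
    rcases hA z hz with rfl | ⟨e, he⟩
    · rw [th_self] at n1; exact absurd n1 (not_lt.2 (th_nonneg _ _))
    · by_cases hpat : e ∈ patt x0 a x
      · rcases sep_pre (x0 := x0) (hpre e) (ha e) he (le_of_lt hpat) h1 with h | h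
        · exact hx0 e h
        · exact hx (hIA e h)
      · have hpat' := hpat
        rw [hp] at hpat'
        rcases sep_pre (x0 := x0) (hpre e) he (ha e) h2 (not_lt.1 hpat') with h | h
        · exact hx0 e h
        · exact hy (hIA e h)
  · ext e
    constructor
    · intro h
      rw [hp]; exact lt_of_lt_of_le h h2
    · intro h
      exact lt_of_lt_of_le h h1

lemma patt_pre (hIA : ∀ e, I e ⊆ A) (hA : ∀ x ∈ A, x = x0 ∨ ∃ e, x ∈ I e)
    (hpre : ∀ e, IsPreconnected (I e)) (hx0 : ∀ e, x0 ∉ I e) {a : ι → S1} (ha : ∀ e, a e ∈ I e)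
    (p : Set ι) : IsPreconnected {x | x ∉ A ∧ patt x0 a x = p} := by
  apply isPreconnected_of_forall_pair
  rintro x ⟨hx, rfl⟩ y ⟨hy, hp⟩
  rcases le_total (th x0 x) (th x0 y) with h | h
  · exact ⟨segm x0 (th x0 x) (th x0 y),
      fun z hz => same_patt hIA hA hpre hx0 ha hx hy hp.symm z hz, ⟨le_rfl, h⟩, ⟨h, le_rfl⟩,
      segm_pre _ (th_nonneg _ _) (th_lt _ _)⟩
  · refine ⟨segm x0 (th x0 y) (th x0 x), ?_, ⟨h, le_rfl⟩, ⟨le_rfl, h⟩,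
      segm_pre _ (th_nonneg _ _) (th_lt _ _)⟩
    intro z hz
    have := same_patt hIA hA hpre hx0 ha hy hx hp z hz
    exact ⟨this.1, this.2.trans hp⟩

lemma joinD_closed [Finite ι] (hAo : IsOpen A) (hIA : ∀ e, I e ⊆ A) (hA : ∀ x ∈ A, x = x0 ∨ ∃ e, x ∈ I e)
    (hpre : ∀ e, IsPreconnected (I e)) (hx0 : ∀ e, x0 ∉ I e) {a : ι → S1} (ha : ∀ e, a e ∈ I e)
    (V : Set S1) : IsClosed (joinD A V) := by
  have cl : joinD A V = ⋃ p ∈ {p : Set ι | ∃ x ∈ joinD A V, patt x0 a x = p},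
      closure {x | x ∉ A ∧ patt x0 a x = p} := by
    ext x
    simp only [Set.mem_iUnion]
    constructor
    · intro hx
      exact ⟨patt x0 a x, ⟨x, hx, rfl⟩, subset_closure ⟨joinD_notA hx, rfl⟩⟩
    · rintro ⟨p, ⟨y, hy, rfl⟩, hx⟩
      refine joinD_ext hy (patt_pre hIA hA hpre hx0 ha (patt x0 a y)).closure ?_
        (subset_closure ⟨joinD_notA hy, rfl⟩) hx
      intro z hz
      exact closure_minimal (fun w hw => hw.1) hAo.isClosed_compl hz
  rw [cl]
  exact (Set.toFinite _).isClosed_biUnion (fun p _ => isClosed_closure)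

lemma joinD_comps [Finite ι] (hIA : ∀ e, I e ⊆ A) (hA : ∀ x ∈ A, x = x0 ∨ ∃ e, x ∈ I e)
    (hpre : ∀ e, IsPreconnected (I e)) (hx0 : ∀ e, x0 ∉ I e) {a : ι → S1} (ha : ∀ e, a e ∈ I e)
    (V : Set S1) : Finite (ConnectedComponents ↥(joinD A V)) := by
  have hs : Function.Surjective (ConnectedComponents.mk : ↥(joinD A V) → _) :=
    ConnectedComponents.surjective_coe
  apply Finite.of_injective (fun C : ConnectedComponents ↥(joinD A V) =>
    patt x0 a (Function.surjInv hs C).1)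
  intro C C' h
  simp only at h
  rw [← Function.surjInv_eq hs C, ← Function.surjInv_eq hs C']
  generalize Function.surjInv hs C = x at *
  generalize Function.surjInv hs C' = y at *
  rw [ConnectedComponents.coe_eq_coe']
  set K := {z : S1 | z ∉ A ∧ patt x0 a z = patt x0 a y.1} with hK
  have hKp : IsPreconnected K := patt_pre hIA hA hpre hx0 ha _
  have hyK : y.1 ∈ K := ⟨joinD_notA y.2, rfl⟩
  have hKsub : K ⊆ joinD A V := fun z hz => joinD_ext y.2 hKp (fun w hw => hw.1) hyK hz
  have hK2 : IsPreconnected (Subtype.val ⁻¹' K : Set ↥(joinD A V)) := by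
    rw [← Topology.IsInducing.subtypeVal.isPreconnected_image, Subtype.image_preimage_coe,
      Set.inter_eq_right.2 hKsub]
    exact hKp
  exact hK2.subset_connectedComponent hyK ⟨joinD_notA x.2, h⟩

end comps
end PP
end

noncomputable section
set_option linter.unusedSimpArgs false
set_option linter.unusedVariables false
namespace PP
section pp2
variable {n : ℕ}

lemma cyc_eq_one {r s t : ℝ} : cyc r s t = 1 ↔ (r < s ∧ s < t) ∨ (s < t ∧ t < r) ∨ (t < r ∧ r < s) := by
  unfold cyc sg
  split_ifs <;> constructor <;> intro h <;> first | omega | (exfalso; omega) | skip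
  all_goals first
    | (rcases h with h | h | h <;> exfalso <;> linarith [h.1, h.2])
    | (left; constructor <;> linarith)
    | (right; left; constructor <;> linarith)
    | (right; right; constructor <;> linarith)

def TT (ρ : Fr n →* ↥HomeoPos) (x0 : S1) (g : Fr n) (x : S1) : ℝ := th x0 (ap (ρ g⁻¹) x)
def PJ (ρ : Fr n →* ↥HomeoPos) (x0 : S1) (k : Fr n) (j : ℕ) : ℝ := ph ρ x0 k * (j / (k.norm + 1))
def AA (ρ : Fr n →* ↥HomeoPos) (x0 : S1) (k : Fr n) : Set S1 :=
  {x | x = x0 ∨ ∃ e, hd e ≠ hd (e * k) ∧ PJ ρ x0 k e.norm < TT ρ x0 e x ∧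
    TT ρ x0 e x < PJ ρ x0 k (e.norm + 1)}
def VV (ρ : Fr n →* ↥HomeoPos) (x0 : S1) (s : Fin n × Bool) : Set S1 :=
  {x | ∃ u, hd u = some s ∧ ap (ρ u) x0 = x}

structure Ctx (c : Fr n → Fr n → Fr n → ℤ) (ρ : Fr n →* ↥HomeoPos) (x0 : S1) (k : Fr n) : Prop where
  hc : IsCircularOrder c
  hρ : IsDynamicalRealization ρ x0 c
  k1 : k ≠ 1
  kmin : ∀ g, g ≠ 1 → g ≠ k → c 1 k g = 1
  ss : ∀ u v, hd u ≠ hd v → c 1 u v = 1 → ∃ e, e ≠ 1 ∧ e * k ≠ 1 ∧ hd e ≠ hd (e * k) ∧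
    (u = e ∨ c 1 u e = 1) ∧ (e * k = v ∨ c 1 (e * k) v = 1)

variable {ρ : Fr n →* ↥HomeoPos} {x0 : S1} {c : Fr n → Fr n → Fr n → ℤ} {k : Fr n}

lemma TT_act (g h : Fr n) (x : S1) : TT ρ x0 (g * h) (ap (ρ g) x) = TT ρ x0 h x := by
  unfold TT; rw [mul_inv_rev, map_mul, ap_mul, map_inv ρ g, ap_inv_ap]
lemma TT_orb (g u : Fr n) : TT ρ x0 g (ap (ρ u) x0) = ph ρ x0 (g⁻¹ * u) := by
  unfold TT ph; rw [map_mul, ap_mul]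
lemma TT_one (x : S1) : TT ρ x0 1 x = th x0 x := by
  unfold TT; rw [inv_one, map_one, ap_one]
lemma TT_base (g : Fr n) : TT ρ x0 g x0 = ph ρ x0 g⁻¹ := rfl
lemma TT_nonneg (g : Fr n) (x : S1) : 0 ≤ TT ρ x0 g x := th_nonneg _ _
lemma TT_inv {g : Fr n} {x y : S1} (h : TT ρ x0 g x = TT ρ x0 g y) : x = y := ap_inj _ (th_inj h)

lemma inJ (g h : Fr n) (x : S1) : (0 < TT ρ x0 g x ∧ TT ρ x0 g x < ph ρ x0 h) ↔
    cyc (ph ρ x0 g) (th x0 x) (ph ρ x0 (g * h)) = 1 := by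
  have : cyc (ph ρ x0 g) (th x0 x) (ph ρ x0 (g * h)) =
      circOrd (ap (ρ g) x0) x (ap (ρ (g * h)) x0) := (circOrd_th x0 _ _ _).symm
  rw [this]
  have h1 : x = ap (ρ g) (ap (ρ g⁻¹) x) := by rw [map_inv, ap_ap_inv]
  rw [h1, map_mul, ap_mul, ap_circOrd, ← h1, circOrd_eq_one]
  rfl

namespace Ctx

lemma q0 (C : Ctx c ρ x0 k) : 0 < ph ρ x0 k := ph_pos C.hρ.1 C.k1

lemma phge (C : Ctx c ρ x0 k) {g : Fr n} (h : g ≠ 1) : ph ρ x0 k ≤ ph ρ x0 g := by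
  by_cases h2 : g = k
  · rw [h2]
  · exact ((c_iff C.hρ.2.1 k g).1 (C.kmin g h h2)).2.le

lemma orbJ (C : Ctx c ρ x0 k) (g : Fr n) : ¬ (0 < ph ρ x0 g ∧ ph ρ x0 g < ph ρ x0 k) := by
  rintro ⟨h1, h2⟩
  have : g ≠ 1 := by rintro rfl; rw [ph_one] at h1; exact lt_irrefl _ h1
  linarith [C.phge this]

lemma nowrap (C : Ctx c ρ x0 k) {g : Fr n} (h1 : g ≠ 1) (h2 : g * k ≠ 1) : ph ρ x0 g < ph ρ x0 (g * k) := by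
  have := (inJ (ρ := ρ) g k x0).not.1 (by rw [TT_base]; exact C.orbJ _)
  rw [th_self, cyc_eq_one] at this
  push Not at this
  have a1 := ph_pos C.hρ.1 h1
  have a2 := ph_pos C.hρ.1 h2
  refine lt_of_le_of_ne (this.2.1 a2) (fun e => ?_)
  have := ph_inj C.hρ.1 e
  exact C.k1 (by simpa using this)

lemma disj0 (C : Ctx c ρ x0 k) {w : Fr n} {y : S1} (h1 : 0 < th x0 y) (h2 : th x0 y < ph ρ x0 k)
    (h3 : 0 < TT ρ x0 w y ∧ TT ρ x0 w y < ph ρ x0 k) : w = 1 := by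
  by_contra hw
  have hw' := C.phge hw
  rw [inJ, cyc_eq_one] at h3
  by_cases hwk : w * k = 1
  · rw [hwk, ph_one] at h3
    rcases h3 with h | h | h <;> linarith [h.1, h.2]
  · have := C.nowrap hw hwk
    rcases h3 with h | h | h <;> linarith [h.1, h.2]

lemma disjJ (C : Ctx c ρ x0 k) {g h : Fr n} {x : S1} (h1 : 0 < TT ρ x0 g x ∧ TT ρ x0 g x < ph ρ x0 k)
    (h2 : 0 < TT ρ x0 h x ∧ TT ρ x0 h x < ph ρ x0 k) : h = g := by
  have e1 : TT ρ x0 g x = th x0 (ap (ρ g⁻¹) x) := rfl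
  have e2 : TT ρ x0 h x = TT ρ x0 (g⁻¹ * h) (ap (ρ g⁻¹) x) := (TT_act _ _ _).symm
  rw [e1] at h1
  rw [e2] at h2
  have := C.disj0 h1.1 h1.2 h2
  exact (inv_mul_eq_one.1 this).symm

lemma pj_zero (C : Ctx c ρ x0 k) : PJ ρ x0 k 0 = 0 := by simp [PJ]
lemma pj_top (C : Ctx c ρ x0 k) : PJ ρ x0 k (k.norm + 1) = ph ρ x0 k := by
  unfold PJ
  have : ((k.norm + 1 : ℕ) : ℝ) / (k.norm + 1) = 1 := by
    push_cast; exact div_self (by positivity)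
  rw [this, mul_one]
lemma pj_lt (C : Ctx c ρ x0 k) {i j : ℕ} (h : i < j) : PJ ρ x0 k i < PJ ρ x0 k j := by
  unfold PJ
  have := C.q0
  have h2 : (i : ℝ) < j := by exact_mod_cast h
  gcongr
lemma pj_le (C : Ctx c ρ x0 k) {i j : ℕ} (h : i ≤ j) : PJ ρ x0 k i ≤ PJ ρ x0 k j := by
  rcases h.lt_or_eq with h | h
  · exact (C.pj_lt h).le
  · rw [h]
lemma pj_nonneg (C : Ctx c ρ x0 k) (i : ℕ) : 0 ≤ PJ ρ x0 k i := by
  rw [← C.pj_zero]; exact C.pj_le (Nat.zero_le _)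
lemma M_norm (C : Ctx c ρ x0 k) {e : Fr n} (h : hd e ≠ hd (e * k)) : e.norm ≤ k.norm := by
  have := fr_norm_inv_mul h
  rw [inv_mul_cancel_left] at this
  omega
lemma M_one (C : Ctx c ρ x0 k) : hd (1 : Fr n) ≠ hd (1 * k) := by
  rw [one_mul, hd_one]
  intro h; exact C.k1 (hd_eq_none.1 h.symm)
lemma M_inv (C : Ctx c ρ x0 k) {g : Fr n} (h : g * k = 1) : hd g ≠ hd (g * k) := by
  rw [h, hd_one]
  intro h2
  rw [hd_eq_none] at h2
  rw [h2, one_mul] at h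
  exact C.k1 h
lemma pj_J (C : Ctx c ρ x0 k) {e : Fr n} (h : hd e ≠ hd (e * k)) {τ : ℝ} (h1 : PJ ρ x0 k e.norm < τ)
    (h2 : τ < PJ ρ x0 k (e.norm + 1)) : 0 < τ ∧ τ < ph ρ x0 k := by
  refine ⟨(C.pj_nonneg _).trans_lt h1, h2.trans_le ?_⟩
  rw [← C.pj_top]
  exact C.pj_le (by have := C.M_norm h; omega)

lemma orbA (C : Ctx c ρ x0 k) {u : Fr n} (h : ap (ρ u) x0 ∈ AA ρ x0 k) : u = 1 := by
  rcases h with h | ⟨e, he, h1, h2⟩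
  · exact C.hρ.1 u h
  · have := C.pj_J he h1 h2
    rw [TT_orb] at this
    exact absurd this (C.orbJ _)

lemma LA (C : Ctx c ρ x0 k) {g : Fr n} {z : S1} (h1 : TT ρ x0 g z ≤ ph ρ x0 k) (hz : z ∈ AA ρ x0 k) :
    (g = 1 ∧ TT ρ x0 g z = 0) ∨ (g * k = 1 ∧ TT ρ x0 g z = ph ρ x0 k) ∨
    (hd g ≠ hd (g * k) ∧ PJ ρ x0 k g.norm < TT ρ x0 g z ∧ TT ρ x0 g z < PJ ρ x0 k (g.norm + 1)) := by
  rcases (TT_nonneg (ρ := ρ) (x0 := x0) g z).lt_or_eq with h0 | h0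
  · rcases h1.lt_or_eq with h2 | h2
    · right; right
      rcases hz with rfl | ⟨e, he, h3, h4⟩
      · rw [TT_base] at h0 h2; exact absurd ⟨h0, h2⟩ (C.orbJ _)
      · have := C.disjJ (C.pj_J he h3 h4) ⟨h0, h2⟩
        subst this
        exact ⟨he, h3, h4⟩
    · right; left
      refine ⟨?_, h2⟩
      have : z = ap (ρ (g * k)) x0 := by
        apply TT_inv (ρ := ρ) (x0 := x0) (g := g); rw [h2, TT_orb, inv_mul_cancel_left]
      rw [this] at hz
      exact C.orbA hz
  · left
    refine ⟨?_, h0.symm⟩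
    have : z = ap (ρ g) x0 := by
      apply TT_inv (ρ := ρ) (x0 := x0) (g := g); rw [← h0, TT_orb, inv_mul_cancel, ph_one]
    rw [this] at hz
    exact C.orbA hz

end Ctx

def sg2 (ρ : Fr n →* ↥HomeoPos) (x0 : S1) (g : Fr n) (r r' : ℝ) : Set S1 :=
  {x | r ≤ TT ρ x0 g x ∧ TT ρ x0 g x ≤ r'}

lemma image_eq (g : Fr n) (S : Set S1) : ap (ρ g) '' S = {x | ap (ρ g⁻¹) x ∈ S} := by
  ext x
  constructor
  · rintro ⟨y, hy, rfl⟩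
    show ap (ρ g⁻¹) (ap (ρ g) y) ∈ S
    rwa [map_inv, ap_inv_ap]
  · intro h; exact ⟨_, h, by rw [map_inv, ap_ap_inv]⟩

lemma sg2_pre (g : Fr n) {r r' : ℝ} (h0 : 0 ≤ r) (h1 : r' < 1) : IsPreconnected (sg2 ρ x0 g r r') := by
  have : sg2 ρ x0 g r r' = ap (ρ g) '' segm x0 r r' := by rw [image_eq]; rfl
  rw [this]
  exact (segm_pre x0 h0 h1).image _ (ap_continuous _).continuousOn

lemma arc_image (g : Fr n) {r r' : ℝ} (h0 : 0 ≤ r) (h1 : r' ≤ 1) :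
    {x | r < TT ρ x0 g x ∧ TT ρ x0 g x < r'} = ap (ρ g) '' (pt x0 '' Set.Ioo r r') := by
  rw [image_eq]
  ext x
  constructor
  · intro h; exact ⟨TT ρ x0 g x, h, pt_th _ _⟩
  · rintro ⟨w, hw, he⟩
    show r < th x0 (ap (ρ g⁻¹) x) ∧ th x0 (ap (ρ g⁻¹) x) < r'
    rw [← he, th_pt x0 (h0.trans hw.1.le) (hw.2.trans_le h1)]; exact hw

lemma arc_pre (g : Fr n) {r r' : ℝ} (h0 : 0 ≤ r) (h1 : r' ≤ 1) :
    IsPreconnected {x | r < TT ρ x0 g x ∧ TT ρ x0 g x < r'} := by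
  rw [arc_image g h0 h1]
  exact (isPreconnected_Ioo.image _ (continuous_pt x0).continuousOn).image _ (ap_continuous _).continuousOn

lemma ap_isOpenMap (h : ↥HomeoPos) : IsOpenMap (ap h) := by
  intro U hU
  have : ap h '' U = ap h⁻¹ ⁻¹' U := by
    ext x
    constructor
    · rintro ⟨y, hy, rfl⟩
      show ap h⁻¹ (ap h y) ∈ U
      rwa [ap_inv_ap]
    · intro hx; exact ⟨_, hx, ap_ap_inv _ _⟩
  rw [this]; exact hU.preimage (ap_continuous _)

lemma arc_open2 (g : Fr n) {r r' : ℝ} (h0 : 0 ≤ r) (h1 : r' ≤ 1) :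
    IsOpen {x | r < TT ρ x0 g x ∧ TT ρ x0 g x < r'} := by
  rw [arc_image g h0 h1]
  exact ap_isOpenMap _ _ (isOpenMap_pt _ _ isOpen_Ioo)

end pp2
end PP
end

noncomputable section
set_option linter.unusedSimpArgs false
set_option linter.unusedVariables false
namespace PP
section pp3
variable {n : ℕ} {ρ : Fr n →* ↥HomeoPos} {x0 : S1} {c : Fr n → Fr n → Fr n → ℤ} {k : Fr n}

def DD (ρ : Fr n →* ↥HomeoPos) (x0 : S1) (k : Fr n) (s : Fin n × Bool) : Set S1 :=
  joinD (AA ρ x0 k) (VV ρ x0 s)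

namespace Ctx

lemma pj_le_one (C : Ctx c ρ x0 k) {e : Fr n} (h : hd e ≠ hd (e * k)) :
    PJ ρ x0 k (e.norm + 1) ≤ 1 := by
  refine le_trans ?_ (ph_lt (ρ := ρ) (x0 := x0) k).le
  rw [← C.pj_top]
  exact C.pj_le (by have := C.M_norm h; omega)

lemma AA_open (C : Ctx c ρ x0 k) : IsOpen (AA ρ x0 k) := by
  rw [isOpen_iff_mem_nhds]
  intro x hx
  by_cases hx0 : x = x0
  · subst hx0
    have q1 : ph ρ x k < 1 := ph_lt k
    have p1 : 0 < PJ ρ x k 1 := by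
      have := C.pj_lt (i := 0) (j := 1) one_pos; rwa [C.pj_zero] at this
    have p1' : PJ ρ x k 1 ≤ ph ρ x k := by rw [← C.pj_top]; exact C.pj_le (by omega)
    have pm : PJ ρ x k k.norm < ph ρ x k := by rw [← C.pj_top]; exact C.pj_lt (by omega)
    have pm0 := C.pj_nonneg k.norm
    set a := ap (ρ k⁻¹) (pt x (PJ ρ x k k.norm)) with ha
    set d := pt x (PJ ρ x k 1) with hd'
    have hka : ap (ρ k) a = pt x (PJ ρ x k k.norm) := by rw [ha, map_inv, ap_ap_inv]
    have ca : ∀ z, circOrd a z x = 1 ↔ PJ ρ x k k.norm < TT ρ x k⁻¹ z ∧ TT ρ x k⁻¹ z < ph ρ x k := by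
      intro z
      rw [← ap_circOrd (ρ k), hka, circOrd_th x, th_pt x pm0 (pm.trans q1)]
      have e1 : th x (ap (ρ k) z) = TT ρ x k⁻¹ z := by unfold TT; rw [inv_inv]
      have e2 : th x (ap (ρ k) x) = ph ρ x k := rfl
      rw [e1, e2, cyc_eq_one]
      constructor
      · rintro (h | h | h)
        · exact h
        · linarith [h.1, h.2]
        · linarith [h.1, h.2]
      · intro h; exact Or.inl h
    have cd : ∀ z, circOrd x z d = 1 ↔ 0 < th x z ∧ th x z < PJ ρ x k 1 := by
      intro z
      rw [circOrd_eq_one, hd', th_pt x p1.le (p1'.trans_lt q1)]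
    have hax : a ≠ x := by
      intro e
      have h1 : ap (ρ k) x = pt x (PJ ρ x k k.norm) := by rw [← hka, e]
      have : ph ρ x k = PJ ρ x k k.norm := by
        unfold ph; rw [h1, th_pt x pm0 (pm.trans q1)]
      linarith
    -- `a` is not in the arc from `x` to `d`
    have haT : TT ρ x k⁻¹ a = PJ ρ x k k.norm := by
      unfold TT; rw [inv_inv, hka, th_pt x pm0 (pm.trans q1)]
    have had : th x d < th x a ∨ th x d = th x a := by
      rw [hd', th_pt x p1.le (p1'.trans_lt q1)]
      by_contra hcon
      push Not at hcon
      have hlt : th x a < PJ ρ x k 1 := lt_of_le_of_ne hcon.1 (Ne.symm hcon.2)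
      rcases pm0.lt_or_eq with h | h
      · have := C.disj0 (w := k⁻¹) (th_pos hax) (hlt.trans_le p1') ⟨by rw [haT]; exact h, by rw [haT]; exact pm⟩
        exact C.k1 (inv_eq_one.1 this)
      · rw [← h] at hka
        rw [pt_zero] at hka
        have : a = ap (ρ k⁻¹) x := by rw [← hka, map_inv, ap_inv_ap]
        have h2 : th x a = ph ρ x k⁻¹ := by rw [this]; rfl
        exact C.orbJ k⁻¹ ⟨by rw [← h2]; exact th_pos hax, by rw [← h2]; exact hlt.trans_le p1'⟩
    by_cases had2 : th x d = th x a
    · -- `d = a`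
      have hda : d = a := th_inj had2
      have hopen : {z | z ≠ d} ∈ nhds x := isOpen_ne.mem_nhds (by rw [hda]; exact hax.symm)
      refine Filter.mem_of_superset hopen ?_
      intro z hz
      by_cases hzx : z = x
      · exact Or.inl hzx
      right
      rcases lt_or_gt_of_ne (fun e => hz (th_inj e) : th x z ≠ th x d) with h | h
      · refine ⟨1, C.M_one, ?_, ?_⟩
        · rw [FreeGroup.norm_one, C.pj_zero, TT_one]; exact th_pos hzx
        · rw [FreeGroup.norm_one, TT_one]; exact ((cd z).1 (circOrd_eq_one.2 ⟨th_pos hzx, h⟩)).2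
      · refine ⟨k⁻¹, C.M_inv (by simp), ?_⟩
        rw [FreeGroup.norm_inv_eq, C.pj_top]
        apply (ca z).1
        rw [circOrd_th x, th_self, cyc_eq_one]
        right; right
        exact ⟨th_pos hax, by linarith⟩
    · have had : th x d < th x a := had.resolve_right had2
      have hdx : 0 < th x d := by rw [hd', th_pt x p1.le (p1'.trans_lt q1)]; exact p1
      have hopen : {z | circOrd a z d = 1} ∈ nhds x := by
        apply (arc_open a d).mem_nhds
        show circOrd a x d = 1
        rw [circOrd_th x, th_self, cyc_eq_one]
        right; left; exact ⟨hdx, had⟩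
      refine Filter.mem_of_superset hopen ?_
      intro z hz
      by_cases hzx : z = x
      · exact Or.inl hzx
      right
      have hz0 := th_pos hzx
      rw [Set.mem_ofPred_eq, circOrd_th x, cyc_eq_one] at hz
      rcases lt_or_ge (th x z) (th x d) with h | h
      · refine ⟨1, C.M_one, ?_, ?_⟩
        · rw [FreeGroup.norm_one, C.pj_zero, TT_one]; exact th_pos hzx
        · rw [FreeGroup.norm_one, TT_one]; exact ((cd z).1 (circOrd_eq_one.2 ⟨th_pos hzx, h⟩)).2
      · refine ⟨k⁻¹, C.M_inv (by simp), ?_⟩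
        rw [FreeGroup.norm_inv_eq, C.pj_top]
        apply (ca z).1
        rw [circOrd_th x, th_self, cyc_eq_one]
        right; right
        refine ⟨th_pos hax, ?_⟩
        rcases hz with h' | h' | h' <;> linarith [h'.1, h'.2]
  · rcases hx with h | ⟨e, he, h1, h2⟩
    · exact absurd h hx0
    · refine Filter.mem_of_superset ((arc_open2 (ρ := ρ) (x0 := x0) e (C.pj_nonneg e.norm)
        (C.pj_le_one he)).mem_nhds ⟨h1, h2⟩) ?_
      intro z hz
      exact Or.inr ⟨e, he, hz.1, hz.2⟩

lemma DD_top (C : Ctx c ρ x0 k) (s : Fin n × Bool) :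
    IsClosed (DD ρ x0 k s) ∧ Finite (ConnectedComponents ↥(DD ρ x0 k s)) := by
  have hfin : {e : Fr n | hd e ≠ hd (e * k)}.Finite :=
    (ball_finite n k.norm).subset (fun e he => C.M_norm he)
  have : Finite ↥{e : Fr n | hd e ≠ hd (e * k)} := hfin
  let I : ↥{e : Fr n | hd e ≠ hd (e * k)} → Set S1 := fun e =>
    {x | PJ ρ x0 k e.1.norm < TT ρ x0 e.1 x ∧ TT ρ x0 e.1 x < PJ ρ x0 k (e.1.norm + 1)}
  have hIA : ∀ e, I e ⊆ AA ρ x0 k := fun e x hx => Or.inr ⟨e.1, e.2, hx.1, hx.2⟩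
  have hA : ∀ x ∈ AA ρ x0 k, x = x0 ∨ ∃ e, x ∈ I e := by
    rintro x (h | ⟨e, he, h1, h2⟩)
    · exact Or.inl h
    · exact Or.inr ⟨⟨e, he⟩, h1, h2⟩
  have hpre : ∀ e, IsPreconnected (I e) := fun e => arc_pre e.1 (C.pj_nonneg _) (C.pj_le_one e.2)
  have hx0 : ∀ e, x0 ∉ I e := by
    intro e he
    have := C.pj_J e.2 he.1 he.2
    rw [TT_base] at this
    exact C.orbJ _ this
  have hne : ∀ e, ∃ a, a ∈ I e := by
    intro e
    obtain ⟨w, hw⟩ := exists_between (C.pj_lt (Nat.lt_succ_self e.1.norm))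
    refine ⟨ap (ρ e.1) (pt x0 w), ?_⟩
    have h2 := C.pj_le_one e.2
    have h3 := C.pj_nonneg e.1.norm
    have := arc_image (ρ := ρ) (x0 := x0) e.1 h3 h2
    show _ ∈ {x | PJ ρ x0 k e.1.norm < TT ρ x0 e.1 x ∧ TT ρ x0 e.1 x < PJ ρ x0 k (e.1.norm + 1)}
    rw [this]
    exact ⟨_, ⟨w, hw, rfl⟩, rfl⟩
  choose a ha using hne
  exact ⟨joinD_closed C.AA_open hIA hA hpre hx0 ha _, joinD_comps hIA hA hpre hx0 ha _⟩

lemma orbD (C : Ctx c ρ x0 k) {u : Fr n} {s : Fin n × Bool} (h : hd u = some s) :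
    ap (ρ u) x0 ∈ DD ρ x0 k s := by
  refine ⟨_, ⟨u, h, rfl⟩, {ap (ρ u) x0}, isPreconnected_singleton, ?_, rfl, rfl⟩
  rintro z rfl hz
  rw [C.orbA hz, hd_one] at h
  cases h

lemma DD_disj (C : Ctx c ρ x0 k) : Pairwise fun s t => Disjoint (DD ρ x0 k s) (DD ρ x0 k t) := by
  have key : ∀ (u v : Fr n) (Q : Set S1), IsPreconnected Q → (∀ z ∈ Q, z ∉ AA ρ x0 k) →
      ap (ρ u) x0 ∈ Q → ap (ρ v) x0 ∈ Q → hd u ≠ hd v → 0 < ph ρ x0 u → ph ρ x0 u < ph ρ x0 v → False := by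
    intro u v Q hQ hQA hu hv hne h0 huv
    obtain ⟨e, e1, e2, e3, e4, e5⟩ := C.ss u v hne ((c_iff C.hρ.2.1 u v).2 ⟨h0, huv⟩)
    have f4 : ph ρ x0 u ≤ ph ρ x0 e := by
      rcases e4 with rfl | h
      · exact le_rfl
      · exact ((c_iff C.hρ.2.1 _ _).1 h).2.le
    have f5 : ph ρ x0 (e * k) ≤ ph ρ x0 v := by
      rcases e5 with rfl | h
      · exact le_rfl
      · exact ((c_iff C.hρ.2.1 _ _).1 h).2.le
    have f6 := C.nowrap e1 e2
    obtain ⟨w, hw⟩ := exists_between (C.pj_lt (Nat.lt_succ_self e.norm))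
    have w1 : w < 1 := hw.2.trans_le (C.pj_le_one e3)
    have w0 : 0 ≤ w := (C.pj_nonneg _).trans hw.1.le
    set z := ap (ρ e) (pt x0 w) with hz
    have hT : TT ρ x0 e z = w := by
      unfold TT; rw [hz, map_inv, ap_inv_ap, th_pt x0 w0 w1]
    have hzA : z ∈ AA ρ x0 k := Or.inr ⟨e, e3, by rw [hT]; exact hw.1, by rw [hT]; exact hw.2⟩
    have hJ := C.pj_J e3 hw.1 hw.2
    rw [← hT, inJ, cyc_eq_one] at hJ
    have hth : ph ρ x0 e < th x0 z ∧ th x0 z < ph ρ x0 (e * k) := by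
      rcases hJ with h | h | h
      · exact h
      · linarith [h.1, h.2]
      · linarith [h.1, h.2]
    rcases sep_pre (x0 := x0) (z := z) hQ hu hv (f4.trans hth.1.le) (hth.2.le.trans f5) with h | h
    · exact hQA _ h (Or.inl rfl)
    · exact hQA _ h hzA
  intro s t hst
  rw [Set.disjoint_left]
  rintro x ⟨_, ⟨u, hu, rfl⟩, P, hP, P1, P2, P3⟩ ⟨_, ⟨v, hv, rfl⟩, P', hP', P1', P2', P3'⟩
  have hne : hd u ≠ hd v := by
    rw [hu, hv]; intro h; cases h; exact hst rfl
  have nu : u ≠ 1 := by rintro rfl; rw [hd_one] at hu; cases hu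
  have nv : v ≠ 1 := by rintro rfl; rw [hd_one] at hv; cases hv
  have hQ : IsPreconnected (P ∪ P') := hP.union x P2 P2' hP'
  have hQA : ∀ z ∈ P ∪ P', z ∉ AA ρ x0 k := by
    rintro z (hz | hz)
    · exact P1 z hz
    · exact P1' z hz
  rcases lt_trichotomy (ph ρ x0 u) (ph ρ x0 v) with h | h | h
  · exact key u v _ hQ hQA (Or.inl P3) (Or.inr P3') hne (ph_pos C.hρ.1 nu) h
  · exact hne (by rw [ph_inj C.hρ.1 h])
  · exact key v u _ hQ hQA (Or.inr P3') (Or.inl P3) hne.symm (ph_pos C.hρ.1 nv) h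

lemma mem_ends (C : Ctx c ρ x0 k) (g : Fr n) : TT ρ x0 g (ap (ρ g) x0) = 0 ∧
    TT ρ x0 g (ap (ρ (g * k)) x0) = ph ρ x0 k := by
  rw [TT_orb, TT_orb, inv_mul_cancel, ph_one, inv_mul_cancel_left]; exact ⟨rfl, rfl⟩

/-- the three kinds of segments -/
lemma seg_full (C : Ctx c ρ x0 k) {g : Fr n} (hg : hd g = hd (g * k)) {x : S1}
    (h : TT ρ x0 g x ≤ ph ρ x0 k) {s : Fin n × Bool} (hs : hd g = some s) : x ∈ DD ρ x0 k s := by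
  refine ⟨_, ⟨g, hs, rfl⟩, sg2 ρ x0 g 0 (ph ρ x0 k), sg2_pre g le_rfl (ph_lt k), ?_,
    ⟨TT_nonneg _ _, h⟩, ?_⟩
  · rintro z ⟨h1, h2⟩ hz
    rcases C.LA h2 hz with ⟨h3, _⟩ | ⟨h3, _⟩ | ⟨h3, _⟩
    · rw [h3, hd_one] at hs; cases hs
    · rw [hg, h3, hd_one] at hs; cases hs
    · exact h3 hg
  · constructor
    · exact TT_nonneg _ _
    · rw [(C.mem_ends g).1]; exact C.q0.le

lemma seg_left (C : Ctx c ρ x0 k) {g : Fr n} (hg : hd g ≠ hd (g * k)) {x : S1}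
    (h : TT ρ x0 g x ≤ PJ ρ x0 k g.norm) {s : Fin n × Bool} (hs : hd g = some s) :
    x ∈ DD ρ x0 k s := by
  have hlt : PJ ρ x0 k g.norm < ph ρ x0 k := by
    rw [← C.pj_top]; exact C.pj_lt (by have := C.M_norm hg; omega)
  refine ⟨_, ⟨g, hs, rfl⟩, sg2 ρ x0 g 0 (PJ ρ x0 k g.norm), sg2_pre g le_rfl (hlt.trans (ph_lt k)), ?_,
    ⟨TT_nonneg _ _, h⟩, ?_⟩
  · rintro z ⟨h1, h2⟩ hz
    rcases C.LA (h2.trans hlt.le) hz with ⟨h3, _⟩ | ⟨_, h3⟩ | ⟨_, h3, _⟩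
    · rw [h3, hd_one] at hs; cases hs
    · linarith
    · linarith
  · constructor
    · exact TT_nonneg _ _
    · rw [(C.mem_ends g).1]; exact C.pj_nonneg _

lemma seg_right (C : Ctx c ρ x0 k) {g : Fr n} (hg : hd g ≠ hd (g * k)) {x : S1}
    (h : PJ ρ x0 k (g.norm + 1) ≤ TT ρ x0 g x) (h' : TT ρ x0 g x ≤ ph ρ x0 k)
    {s : Fin n × Bool} (hs : hd (g * k) = some s) : x ∈ DD ρ x0 k s := by
  have hle : PJ ρ x0 k (g.norm + 1) ≤ ph ρ x0 k := by
    rw [← C.pj_top]; exact C.pj_le (by have := C.M_norm hg; omega)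
  have hpos : 0 < PJ ρ x0 k (g.norm + 1) := (C.pj_nonneg g.norm).trans_lt (C.pj_lt (by omega))
  refine ⟨_, ⟨g * k, hs, rfl⟩, sg2 ρ x0 g (PJ ρ x0 k (g.norm + 1)) (ph ρ x0 k),
    sg2_pre g hpos.le (ph_lt k), ?_, ⟨h, h'⟩, ?_⟩
  · rintro z ⟨h1, h2⟩ hz
    rcases C.LA h2 hz with ⟨_, h3⟩ | ⟨h3, _⟩ | ⟨_, _, h3⟩
    · linarith
    · rw [h3, hd_one] at hs; cases hs
    · linarith
  · show _ ∧ _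
    rw [(C.mem_ends g).2]; exact ⟨hle, le_rfl⟩

lemma sA (C : Ctx c ρ x0 k) (s : Fin n × Bool) {x : S1} (hx : x ∈ AA ρ x0 k) :
    ap (ρ (freeGen s)) x ∈ DD ρ x0 k s := by
  rcases hx with rfl | ⟨e, he, h1, h2⟩
  · exact C.orbD (hd_freeGen s)
  have hJ := C.pj_J he h1 h2
  rw [← TT_act (freeGen s) e x] at h1 h2 hJ
  have hek : freeGen s * e * k = freeGen s * (e * k) := mul_assoc _ _ _
  by_cases hM : hd (freeGen s * e) = hd (freeGen s * e * k)
  · apply C.seg_full hM hJ.2.le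
    by_cases hs : hd e = some (linv s)
    · rw [hM, hek]
      exact hd_gen_mul (fun h => he (hs.trans h.symm))
    · exact hd_gen_mul hs
  · by_cases hs : hd e = some (linv s)
    · apply C.seg_right hM _ hJ.2.le
      · rw [hek]; exact hd_gen_mul (fun h => he (hs.trans h.symm))
      · rw [← (gen_mul_cancel hs).2]; exact h1.le
    · apply C.seg_left hM _ (hd_gen_mul hs)
      rw [norm_gen_mul hs]; exact h2.le

lemma exists_hd {g : Fr n} (h : g ≠ 1) : ∃ s, hd g = some s := by
  cases h' : hd g with
  | none => exact absurd (hd_eq_none.1 h') h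
  | some s => exact ⟨s, rfl⟩

lemma cover (C : Ctx c ρ x0 k) {x : S1} (hx : x ∉ AA ρ x0 k) : ∃ t, x ∈ DD ρ x0 k t := by
  by_cases hJ : ∃ g, 0 < TT ρ x0 g x ∧ TT ρ x0 g x < ph ρ x0 k
  · obtain ⟨g, h1, h2⟩ := hJ
    by_cases hM : hd g = hd (g * k)
    · obtain ⟨s, hs⟩ := exists_hd (g := g) (by rintro rfl; exact C.M_one hM)
      exact ⟨s, C.seg_full hM h2.le hs⟩
    · rcases le_or_gt (TT ρ x0 g x) (PJ ρ x0 k g.norm) with h3 | h3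
      · obtain ⟨s, hs⟩ := exists_hd (g := g) (by
          rintro rfl
          rw [FreeGroup.norm_one, C.pj_zero] at h3; linarith)
        exact ⟨s, C.seg_left hM h3 hs⟩
      · have h4 : PJ ρ x0 k (g.norm + 1) ≤ TT ρ x0 g x := by
          by_contra hcon
          exact hx (Or.inr ⟨g, hM, h3, not_le.1 hcon⟩)
        obtain ⟨s, hs⟩ := exists_hd (g := g * k) (by
          intro hgk
          have : g = k⁻¹ := eq_inv_of_mul_eq_one_left hgk
          rw [this, FreeGroup.norm_inv_eq, C.pj_top, ← this] at h4
          linarith)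
        exact ⟨s, C.seg_right hM h4 h2.le hs⟩
  push Not at hJ
  by_cases horb : ∃ u, ap (ρ u) x0 = x
  · obtain ⟨u, rfl⟩ := horb
    obtain ⟨s, hs⟩ := exists_hd (g := u) (by
      rintro rfl; exact hx (Or.inl (by rw [map_one, ap_one])))
    exact ⟨s, C.orbD hs⟩
  have hno : ∀ g, ph ρ x0 g ≠ th x0 x := fun g e => horb ⟨g, th_inj e⟩
  have hcyc : ∀ g, cyc (ph ρ x0 g) (th x0 x) (ph ρ x0 (g * k)) ≠ 1 := by
    intro g h
    rw [← inJ] at h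
    linarith [hJ g h.1, h.2]
  have hne : ∀ g, ph ρ x0 g ≠ ph ρ x0 (g * k) := by
    intro g e
    have := ph_inj C.hρ.1 e
    exact C.k1 (by simpa using this)
  have up : ∀ g, ph ρ x0 g < th x0 x → ph ρ x0 g < ph ρ x0 (g * k) ∧ ph ρ x0 (g * k) < th x0 x := by
    intro g hg
    have := hcyc g
    rw [Ne, cyc_eq_one] at this
    push Not at this
    obtain ⟨t1, t2, t3⟩ := this
    have u1 := lt_of_le_of_ne (t1 hg) (hno _)
    refine ⟨lt_of_le_of_ne ?_ (hne g), u1⟩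
    by_contra h
    exact absurd (t3 (not_le.1 h)) (not_le.2 hg)
  have down : ∀ g, th x0 x < ph ρ x0 g → ph ρ x0 (g * k⁻¹) < ph ρ x0 g ∧ th x0 x < ph ρ x0 (g * k⁻¹) := by
    intro g hg
    have hh := hcyc (g * k⁻¹)
    have hn := hne (g * k⁻¹)
    rw [inv_mul_cancel_right] at hh hn
    rw [Ne, cyc_eq_one] at hh
    push Not at hh
    obtain ⟨t1, t2, t3⟩ := hh
    have u1 : th x0 x < ph ρ x0 (g * k⁻¹) := by
      by_contra h
      have := lt_of_le_of_ne (not_lt.1 h) (hno _)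
      exact absurd (t1 this) (not_le.2 hg)
    exact ⟨lt_of_le_of_ne (t2 hg) hn, u1⟩
  have hx0 : 0 < th x0 x := th_pos (fun e => hx (Or.inl e))
  have hx1 : th x0 x < ph ρ x0 k⁻¹ := by
    by_contra h
    have := (up k⁻¹ (lt_of_le_of_ne (not_lt.1 h) (hno _))).1
    rw [inv_mul_cancel, ph_one] at this
    exact absurd this (not_lt.2 (ph_nonneg _))
  set Y := {r | ∃ g, ph ρ x0 g < th x0 x ∧ ph ρ x0 g = r} with hY
  set Z := {r | ∃ g, th x0 x < ph ρ x0 g ∧ ph ρ x0 g = r} with hZ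
  have Yne : Y.Nonempty := ⟨_, 1, by rw [ph_one]; exact hx0, rfl⟩
  have Zne : Z.Nonempty := ⟨_, k⁻¹, hx1, rfl⟩
  have Yb : ∀ r ∈ Y, r ≤ th x0 x := by rintro _ ⟨g, hg, rfl⟩; exact hg.le
  have Zb : ∀ r ∈ Z, th x0 x ≤ r := by rintro _ ⟨g, hg, rfl⟩; exact hg.le
  have Ybdd : BddAbove Y := ⟨_, Yb⟩
  have Zbdd : BddBelow Z := ⟨_, Zb⟩
  set y := sSup Y
  set z := sInf Z
  have yx : y ≤ th x0 x := csSup_le Yne Yb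
  have xz : th x0 x ≤ z := le_csInf Zne Zb
  have Ylt : ∀ g, ph ρ x0 g < th x0 x → ph ρ x0 g < y := by
    intro g hg
    obtain ⟨a1, a2⟩ := up g hg
    exact a1.trans_le (le_csSup Ybdd ⟨_, a2, rfl⟩)
  have Zlt : ∀ g, th x0 x < ph ρ x0 g → z < ph ρ x0 g := by
    intro g hg
    obtain ⟨a1, a2⟩ := down g hg
    exact (csInf_le Zbdd ⟨_, a2, rfl⟩).trans_lt a1
  have eqyz : y = z := by
    by_contra hyz
    have hlt : y < z := lt_of_le_of_ne (yx.trans xz) hyz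
    apply wgp C.hc C.hρ hlt
    · rintro g ⟨h1, h2⟩
      rcases lt_or_gt_of_ne (hno g) with h | h
      · linarith [Ylt g h]
      · linarith [Zlt g h]
    · intro ε hε
      obtain ⟨_, ⟨g, hg, rfl⟩, h⟩ := exists_lt_of_lt_csSup Yne (show y - ε < sSup Y by linarith)
      exact ⟨g, h, Ylt g hg⟩
    · intro ε hε
      obtain ⟨_, ⟨g, hg, rfl⟩, h⟩ := exists_lt_of_csInf_lt Zne (show sInf Z < z + ε by linarith)
      exact ⟨g, Zlt g hg, h⟩
  have hyx : y = th x0 x := le_antisymm yx (by rw [eqyz]; exact xz)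
  have hcl : IsClosed (⋃ t, DD ρ x0 k t) := isClosed_iUnion_of_finite (fun t => (C.DD_top t).1)
  have hmem : x ∈ ⋃ t, DD ρ x0 k t := by
    rw [← hcl.closure_eq]
    rw [mem_closure_iff]
    intro U hU hxU
    have : pt x0 ⁻¹' U ∈ nhds (th x0 x) :=
      (hU.preimage (continuous_pt x0)).mem_nhds (by show pt x0 (th x0 x) ∈ U; rwa [pt_th])
    obtain ⟨ε, hε, hb⟩ := Metric.mem_nhds_iff.1 this
    obtain ⟨_, ⟨g, hg, rfl⟩, h⟩ := exists_lt_of_lt_csSup Yne (show y - ε < sSup Y by linarith)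
    obtain ⟨a1, a2⟩ := up g hg
    have hgk : g * k ≠ 1 := by
      intro e
      rw [e, ph_one] at a1
      exact absurd a1 (not_lt.2 (ph_nonneg _))
    obtain ⟨s, hs⟩ := exists_hd hgk
    refine ⟨ap (ρ (g * k)) x0, ?_, Set.mem_iUnion.2 ⟨s, C.orbD hs⟩⟩
    rw [← pt_ph]
    apply hb
    rw [Metric.mem_ball, Real.dist_eq, abs_lt]
    constructor <;> linarith
  exact Set.mem_iUnion.1 hmem

lemma pingpong (C : Ctx c ρ x0 k) (s : Fin n × Bool) {x : S1} (hx : x ∉ DD ρ x0 k (linv s)) :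
    ap (ρ (freeGen s)) x ∈ DD ρ x0 k s := by
  by_cases hA : x ∈ AA ρ x0 k
  · exact C.sA s hA
  obtain ⟨t, ht⟩ := C.cover hA
  have hts : t ≠ linv s := by rintro rfl; exact hx ht
  obtain ⟨_, ⟨u, hu, rfl⟩, P, hP, P1, P2, P3⟩ := ht
  refine ⟨_, ⟨freeGen s * u, hd_gen_mul ?_, rfl⟩, ap (ρ (freeGen s)) '' P,
    hP.image _ (ap_continuous _).continuousOn, ?_, ⟨x, P2, rfl⟩, ⟨_, P3, ?_⟩⟩
  · rw [hu]; intro h; cases h; exact hts rfl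
  · rintro _ ⟨y, hy, rfl⟩ hyA
    have h1 := C.sA (linv s) hyA
    rw [freeGen_linv, map_inv, ap_inv_ap] at h1
    exact Set.disjoint_left.1 (C.DD_disj hts) ⟨_, ⟨u, hu, rfl⟩, P, hP, P1, hy, P3⟩ h1
  · rw [map_mul, ap_mul]

end Ctx

lemma main_thm (n : ℕ) (hn : 1 ≤ n)
    (c : FreeGroup (Fin n) → FreeGroup (Fin n) → FreeGroup (Fin n) → ℤ)
    (hc : IsCircularOrder c)
    (ρ : FreeGroup (Fin n) →* ↥HomeoPos) (x₀ : S1)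
    (hρ : IsDynamicalRealization ρ x₀ c) :
    IsIsolatedCO c ↔
      ∃ D : Fin n × Bool → Set S1,
        (∀ s, (D s).Nonempty) ∧
        (∀ s, IsClosed (D s)) ∧
        (∀ s, Finite (ConnectedComponents ↥(D s))) ∧
        (Pairwise fun s t => Disjoint (D s) (D t)) ∧
        (∀ s, (ap (ρ (freeGen s))) '' (Set.univ \ D (s.1, !s.2)) ⊆ D s) ∧
        x₀ ∉ ⋃ s, D s := by
  constructor
  · intro hiso
    have hst := isolated_star hc hiso
    obtain ⟨k, hk1, hk⟩ := exists_succ hn hc hst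
    have C : Ctx c ρ x₀ k := ⟨hc, hρ, hk1, hk, starstar hc hst hk1 hk⟩
    refine ⟨DD ρ x₀ k, fun s => ⟨_, C.orbD (hd_freeGen s)⟩, fun s => (C.DD_top s).1,
      fun s => (C.DD_top s).2, C.DD_disj, ?_, ?_⟩
    · rintro s _ ⟨x, ⟨_, hx⟩, rfl⟩
      exact C.pingpong s hx
    · intro h
      obtain ⟨s, hs⟩ := Set.mem_iUnion.1 h
      exact joinD_notA hs (Or.inl rfl)
  · rintro ⟨D, h1, h2, h3, h4, h5, h6⟩
    exact star_isolated hc (pp_star hc hρ h2 h4 h5 (fun s hs => h6 (Set.mem_iUnion.2 ⟨s, hs⟩)))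

end pp3
end PP
end

/-- **Ping-pong characterization of isolated circular orders on free groups.**
Let `c` be a circular order on `F_n` with dynamical realization `ρ` with basepoint `x₀`.
Then `c` is isolated if and only if there are pairwise disjoint nonempty closed sets
`D(s) ⊆ S¹` for `s ∈ {a₁^{±1},…,aₙ^{±1}}`, each a finite union of intervals (i.e. with
finitely many connected components), with `ρ(s)(S¹ ∖ D(s⁻¹)) ⊆ D(s)` for all `s` and
`x₀ ∉ ⋃ₛ D(s)`. -/
theorem isolated_iff_ping_pong (n : ℕ) (hn : 1 ≤ n)
    (c : FreeGroup (Fin n) → FreeGroup (Fin n) → FreeGroup (Fin n) → ℤ)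
    (hc : IsCircularOrder c)
    (ρ : FreeGroup (Fin n) →* ↥HomeoPos) (x₀ : S1)
    (hρ : IsDynamicalRealization ρ x₀ c) :
    IsIsolatedCO c ↔
      ∃ D : Fin n × Bool → Set S1,
        (∀ s, (D s).Nonempty) ∧
        (∀ s, IsClosed (D s)) ∧
        (∀ s, Finite (ConnectedComponents ↥(D s))) ∧
        (Pairwise fun s t => Disjoint (D s) (D t)) ∧
        (∀ s, (ap (ρ (freeGen s))) '' (Set.univ \ D (s.1, !s.2)) ⊆ D s) ∧
        x₀ ∉ ⋃ s, D s := by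
  exact PP.main_thm n hn c hc ρ x₀ hρ

end
end

section
/- Let G be a group, ρ : G → Homeo₊(S¹) a homomorphism, x ∈ S¹, and K = {g ∈ G : ρ(g)x = x} the stabilizer of x. For every left order <_K on K there exists a circular order c on G such that: (i) c(g₁,g₂,g₃) = ord(ρ(g₁)x, ρ(g₂)x, ρ(g₃)x) whenever the three points ρ(g₁)x, ρ(g₂)x, ρ(g₃)x are pairwise distinct; and (ii) whenever ρ(g₁)x = ρ(g₂)x ≠ ρ(g₃)x, one has c(g₁,g₂,g₃) = 1 if and only if 1 <_K g₁⁻¹g₂. -/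
noncomputable section
variable {G : Type*} [Group G]

/-- A left-invariant (strict) total order on a group. -/
def IsLeftOrder {H : Type*} [Group H] (r : H → H → Prop) : Prop :=
  (∀ a, ¬ r a a) ∧ (∀ a b c, r a b → r b c → r a c) ∧
  (∀ a b, a ≠ b → r a b ∨ r b a) ∧ (∀ g a b, r a b → r (g * a) (g * b))

/-- The stabilizer of a point `x ∈ S¹` under an action `ρ : G → Homeo₊(S¹)`. -/
def stabSubgroup (ρ : G →* ↥HomeoPos) (x : S1) : Subgroup G where
  carrier := {g | ap (ρ g) x = x}
  one_mem' := by show ap (ρ 1) x = x; rw [map_one, ap_one]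
  mul_mem' := by
    intro a b ha hb
    show ap (ρ (a * b)) x = x
    rw [map_mul, ap_mul]
    rw [show ap (ρ b) x = x from hb, show ap (ρ a) x = x from ha]
  inv_mem' := by
    intro a ha
    show ap (ρ a⁻¹) x = x
    have h1 : ap (ρ a⁻¹) (ap (ρ a) x) = x := by
      rw [← ap_mul, ← map_mul, inv_mul_cancel, map_one, ap_one]
    conv_lhs => rw [← show ap (ρ a) x = x from ha]
    exact h1

open Classical in
def sg (x y : S1) : ℤ := if S1.rep x < S1.rep y then 1 else if S1.rep y < S1.rep x then -1 else 0

lemma rep_inj {x y : S1} (h : S1.rep x = S1.rep y) : x = y := by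
  unfold S1.rep at h
  exact (AddCircle.equivIco 1 0).injective (Subtype.ext h)

lemma circOrd_eq (x y z : S1) : circOrd x y z = sg x y + sg y z - sg x z := by
  have h1 := @rep_inj x y
  have h2 := @rep_inj y z
  have h3 := @rep_inj x z
  unfold circOrd sg
  by_cases e1 : x = y
  · subst e1; simp
  by_cases e2 : y = z
  · subst e2; simp
  by_cases e3 : x = z
  · subst e3; simp [e1]; split_ifs <;> first | rfl | (exfalso; grind)
  rcases lt_or_gt_of_ne (fun h => e1 (h1 h)) with a | a <;>
  rcases lt_or_gt_of_ne (fun h => e2 (h2 h)) with b | b <;>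
  rcases lt_or_gt_of_ne (fun h => e3 (h3 h)) with c | c <;>
  first
  | (exfalso; linarith)
  | simp [e1, e2, e3, a, b, c, a.not_gt, b.not_gt, c.not_gt]

lemma circOrd_deg (x y z : S1) (h : x = y ∨ y = z ∨ x = z) : circOrd x y z = 0 := by
  unfold circOrd; rw [if_pos h]

lemma circOrd_nondeg (x y z : S1) (h1 : x ≠ y) (h2 : y ≠ z) (h3 : x ≠ z) :
    circOrd x y z = 1 ∨ circOrd x y z = -1 := by
  unfold circOrd; rw [if_neg (by tauto)]; split_ifs <;> simp

open Classical in
def sK (pos : G → Prop) (a b : G) : ℤ :=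
  if pos (a⁻¹ * b) then 1 else if pos (b⁻¹ * a) then -1 else 0

/-- **Order completion.**  Given `ρ : G → Homeo₊(S¹)`, a point `x` with stabilizer `K`, and
a left order `<_K` on `K`, there is a circular order on `G` agreeing with the orientation
cocycle of the orbit of `x` on nondegenerate triples, and whose value on triples with
`ρ(g₁)x = ρ(g₂)x ≠ ρ(g₃)x` is determined by `<_K` via `c(g₁,g₂,g₃) = 1 ↔ 1 <_K g₁⁻¹g₂`. -/
theorem order_completion (ρ : G →* ↥HomeoPos) (x : S1)
    (rK : ↥(stabSubgroup ρ x) → ↥(stabSubgroup ρ x) → Prop) (hrK : IsLeftOrder rK) :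
    ∃ c : G → G → G → ℤ, IsCircularOrder c ∧
      (∀ g₁ g₂ g₃ : G, ap (ρ g₁) x ≠ ap (ρ g₂) x → ap (ρ g₂) x ≠ ap (ρ g₃) x →
        ap (ρ g₁) x ≠ ap (ρ g₃) x →
        c g₁ g₂ g₃ = circOrd (ap (ρ g₁) x) (ap (ρ g₂) x) (ap (ρ g₃) x)) ∧
      (∀ g₁ g₂ g₃ : G, (h₁₂ : ap (ρ g₁) x = ap (ρ g₂) x) → ap (ρ g₁) x ≠ ap (ρ g₃) x →
        (c g₁ g₂ g₃ = 1 ↔ rK 1 ⟨g₁⁻¹ * g₂, by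
          show ap (ρ (g₁⁻¹ * g₂)) x = x
          rw [map_mul, ap_mul, ← h₁₂, ← ap_mul, ← map_mul, inv_mul_cancel, map_one,
            ap_one]⟩)) := by
  have hPm : ∀ g u, ap (ρ (g * u)) x = ap (ρ g) (ap (ρ u) x) := fun g u => by
    rw [map_mul, ap_mul]
  have hmem : ∀ a b : G, a⁻¹ * b ∈ stabSubgroup ρ x ↔ ap (ρ a) x = ap (ρ b) x := by
    intro a b
    show ap (ρ (a⁻¹ * b)) x = x ↔ _
    constructor
    · intro h
      have := hPm a (a⁻¹ * b)
      rw [h, mul_inv_cancel_left] at this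
      exact this.symm
    · intro h
      rw [hPm, ← h, ← hPm, inv_mul_cancel, map_one, ap_one]
  obtain ⟨hirr, htr, htot, hinv⟩ := hrK
  let pos : G → Prop := fun k => ∃ h : k ∈ stabSubgroup ρ x, rK 1 ⟨k, h⟩
  have pK : ∀ a b, pos (a⁻¹ * b) → ap (ρ a) x = ap (ρ b) x := fun a b h => (hmem a b).1 h.1
  have p1 : ∀ a, ¬ pos (a⁻¹ * a) := by
    rintro a ⟨h, h'⟩
    apply hirr 1
    convert h'
    all_goals simp
  have pm : ∀ a b d, pos (a⁻¹ * b) → pos (b⁻¹ * d) → pos (a⁻¹ * d) := by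
    rintro a b d ⟨h, h'⟩ ⟨k, k'⟩
    refine ⟨by simpa [mul_assoc] using mul_mem h k, ?_⟩
    have := htr _ _ _ h' (by simpa using hinv ⟨_, h⟩ _ _ k')
    convert this using 2
    all_goals simp [mul_assoc]
  have pt : ∀ a b, ap (ρ a) x = ap (ρ b) x → a ≠ b → pos (a⁻¹ * b) ∨ pos (b⁻¹ * a) := by
    intro a b h hne
    have hk := (hmem a b).2 h
    have hk' := (hmem b a).2 h.symm
    rcases htot 1 ⟨_, hk⟩ (by
      intro h
      have := congrArg Subtype.val h
      simp only [Subgroup.coe_one] at this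
      exact hne (inv_mul_eq_one.1 this.symm)) with h | h
    · exact Or.inl ⟨hk, h⟩
    · right
      refine ⟨hk', ?_⟩
      have := hinv ⟨_, hk'⟩ _ _ h
      convert this using 1 <;> ext <;> simp [mul_assoc]
  have s1 : ∀ a b, pos (a⁻¹ * b) → sK pos a b = 1 ∧ sK pos b a = -1 := by
    intro a b h
    have h' : ¬ pos (b⁻¹ * a) := fun h' => p1 a (pm _ _ _ h h')
    simp [sK, h, h']
  have s0 : ∀ a, sK pos a a = 0 := fun a => by simp only [sK, p1, if_false]
  have sne : ∀ a b, ap (ρ a) x ≠ ap (ρ b) x → sK pos a b = 0 := by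
    intro a b h
    have h1 : ¬ pos (a⁻¹ * b) := fun h' => h (pK a b h')
    have h2 : ¬ pos (b⁻¹ * a) := fun h' => h (pK b a h').symm
    unfold sK; rw [if_neg h1, if_neg h2]
  have sinv : ∀ g a b, sK pos (g * a) (g * b) = sK pos a b := by
    intro g a b
    have e : ∀ u v : G, (g * u)⁻¹ * (g * v) = u⁻¹ * v := fun u v => by group
    unfold sK; rw [e, e]
  have spos : ∀ a b, sK pos a b = 1 ↔ pos (a⁻¹ * b) := by
    intro a b
    unfold sK
    split_ifs <;> simp_all
  have stri : ∀ a b, ap (ρ a) x = ap (ρ b) x → a = b ∨ pos (a⁻¹ * b) ∨ pos (b⁻¹ * a) :=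
    fun a b h => or_iff_not_imp_left.2 (pt a b h)
  let c : G → G → G → ℤ := fun a b d =>
    circOrd (ap (ρ a) x) (ap (ρ b) x) (ap (ρ d) x) + sK pos a b + sK pos b d - sK pos a d
  have key : ∀ a b d, (c a b d = 0 ∧ (a = b ∨ b = d ∨ a = d)) ∨
      ((c a b d = 1 ∨ c a b d = -1) ∧ ¬ (a = b ∨ b = d ∨ a = d)) := by
    intro a b d
    have hc : c a b d = circOrd (ap (ρ a) x) (ap (ρ b) x) (ap (ρ d) x) + sK pos a b
      + sK pos b d - sK pos a d := rfl
    have cd := circOrd_deg (ap (ρ a) x) (ap (ρ b) x) (ap (ρ d) x)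
    have cn := circOrd_nondeg (ap (ρ a) x) (ap (ρ b) x) (ap (ρ d) x)
    generalize c a b d = n at hc ⊢
    generalize circOrd (ap (ρ a) x) (ap (ρ b) x) (ap (ρ d) x) = m at *
    have t1 := stri a b
    have t2 := stri b d
    have t3 := stri a d
    have u1 := sne a b
    have u2 := sne b d
    have u3 := sne a d
    have v1 := s1 a b
    have v2 := s1 b d
    have v3 := s1 a d
    have w1 := s1 b a
    have w2 := s1 d b
    have w3 := s1 d a
    have z1 := s0 a
    have z2 := s0 b
    have y1 := pm a b d
    have y2 := pm d b a
    clear_value pos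
    clear stri sne s1 pm spos sinv pt p1 pK s0 hinv htot htr hirr hmem hPm
    by_cases e1 : ap (ρ a) x = ap (ρ b) x <;> by_cases e2 : ap (ρ b) x = ap (ρ d) x <;>
    by_cases e3 : ap (ρ a) x = ap (ρ d) x <;> grind
  refine ⟨c, ⟨?_, ?_, ?_, ?_⟩, ?_, ?_⟩
  · intro a b d
    rcases key a b d with ⟨h, h'⟩ | ⟨h, h'⟩
    · simp only [h, h']
    · simp only [h', iff_false]; omega
  · intro a b d
    rcases key a b d with ⟨h, h'⟩ | ⟨h, h'⟩ <;> omega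
  · intro a b d e
    simp only [c, circOrd_eq]; ring
  · intro g a b d
    simp only [c, sinv, hPm]
    have : circOrd (ap (ρ g) (ap (ρ a) x)) (ap (ρ g) (ap (ρ b) x)) (ap (ρ g) (ap (ρ d) x))
      = circOrd (ap (ρ a) x) (ap (ρ b) x) (ap (ρ d) x) := (ρ g).2.2.2 _ _ _
    rw [this]
  · intro a b d h1 h2 h3
    simp only [c, sne _ _ h1, sne _ _ h2, sne _ _ h3]; ring
  · intro a b d h1 h2
    have : c a b d = sK pos a b := by
      simp only [c, sne _ _ h2, sne b d (h1 ▸ h2), circOrd_deg _ _ _ (Or.inl h1)]; ring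
    rw [this, spos]
    exact ⟨fun ⟨_, h⟩ => h, fun h => ⟨_, h⟩⟩


end
end
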